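/- Let μ ∈ {1, −1}, let f, g, u₀, K be as in the discrete existence lemma and let T, ε > 0 be such that for every h ∈ (0,1) and k ∈ (0,ε) the difference scheme (dgNLS) with initial condition u₀ has a solution on ℝ_h × (ℝ_k ∩ [0,T]). Let N, n ∈ ℕ. Suppose there exists a constant C₀ > 0, independent of h ∈ (0,1), k ∈ (0,ε), and t_j ∈ [0,T], such that whenever u = (u₁,u₂) is the solution of the scheme on ℝ_h × (ℝ_k ∩ [0,T]) with initial condition u₀, one has for all j with t_j, t_{j+1} ∈ [0,T]: (⟨x⟩^{2N} D₊^n (Q_j u_{j+1}), D₊^n u_{j+1})_{L²_h} ≥ −C₀ ( ‖⟨x⟩^N D₊^n u_{j+1}‖_{L²_h}² + ‖⟨x⟩^N D₊^n u_j‖_{L²_h}² + 1 ). Then there exist k₀ with 0 < k₀ ≤ ε (depending on N and n) and C > 0, independent of h and k, such that for all h ∈ (0,1) and k ∈ (0,k₀), the solution u of the scheme on ℝ_h × (ℝ_k ∩ [0,T]) with initial condition u₀ satisfies ‖⟨x⟩^N D₊^n u_j‖_{L²_h} < C for every j with t_j ∈ [0,T]. -/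

import Mathlib

noncomputable section

/-- The Japanese bracket `⟨x⟩ = √(x² + 1)`. -/
def jb (x : ℝ) : ℝ := Real.sqrt (x ^ 2 + 1)

/-- Forward difference operator with mesh size `h` (mesh functions are `ℤ → ℝ`, `m ↦ u(mh)`). -/
def Dp (h : ℝ) (u : ℤ → ℝ) : ℤ → ℝ := fun m => (u (m + 1) - u m) / h

/-- Backward difference operator with mesh size `h`. -/
def Dm (h : ℝ) (u : ℤ → ℝ) : ℤ → ℝ := fun m => (u m - u (m - 1)) / h

/-- The discrete `L²_h` inner product `(u,v)_{L²_h} = Σ_m u(x_m) v(x_m) h`. -/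
def dip (h : ℝ) (u v : ℤ → ℝ) : ℝ := ∑' m : ℤ, u m * v m * h

/-- The `S_h` inner product of real-valued mesh functions. -/
def ship (h : ℝ) (u v : ℤ → ℝ) : ℝ :=
  dip h (fun m => jb ((m : ℝ) * h) * u m) (fun m => jb ((m : ℝ) * h) * v m) +
    dip h (fun m => jb ((m : ℝ) * h) * Dp h u m) (fun m => jb ((m : ℝ) * h) * Dp h v m) +
    dip h ((Dp h)^[2] u) ((Dp h)^[2] v)

/-- The squared `S_h` norm of an `ℝ²`-valued mesh function `(u₁, u₂)`. -/
def shnormSq (h : ℝ) (u1 u2 : ℤ → ℝ) : ℝ := ship h u1 u1 + ship h u2 u2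

/-- Finiteness of the `S_h` norm of a real-valued mesh function. -/
def InSh (h : ℝ) (u : ℤ → ℝ) : Prop :=
  Summable (fun m : ℤ => (jb ((m : ℝ) * h) * u m) ^ 2 * h) ∧
    Summable (fun m : ℤ => (jb ((m : ℝ) * h) * Dp h u m) ^ 2 * h) ∧
    Summable (fun m : ℤ => ((Dp h)^[2] u m) ^ 2 * h)

/-- The difference scheme (dgNLS) at time step `j`, at every mesh point. -/
def SchemeAt (μ h k : ℝ) (f1 f2 g1 g2 : ℝ → ℝ → ℝ) (u1 u2 : ℕ → ℤ → ℝ) (j : ℕ) : Prop :=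
  ∀ m : ℤ,
    ((u2 (j + 1) m - u2 j m) / k - Dp h (Dm h (u1 (j + 1))) m
      - μ * (u1 j m ^ 2 * u1 (j + 1) m
          + u1 j m * u2 j m * u2 (j + 1) m
          + f2 ((m : ℝ) * h) ((j : ℝ) * k) ^ 2 * u1 j m
          + 3 * f1 ((m : ℝ) * h) ((j : ℝ) * k) * u1 j m * u1 (j + 1) m
          + f1 ((m : ℝ) * h) ((j : ℝ) * k) * u2 j m * u2 (j + 1) m
          + 2 * f2 ((m : ℝ) * h) ((j : ℝ) * k) * u1 j m * u2 (j + 1) m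
          + 3 * f1 ((m : ℝ) * h) ((j : ℝ) * k) ^ 2 * u1 j m
          + 2 * f1 ((m : ℝ) * h) ((j : ℝ) * k) * f2 ((m : ℝ) * h) ((j : ℝ) * k) * u2 j m)
      - g1 ((m : ℝ) * h) ((j : ℝ) * k) = 0) ∧
    ((u1 (j + 1) m - u1 j m) / k + Dp h (Dm h (u2 (j + 1))) m
      + μ * (u1 j m * u2 j m * u1 (j + 1) m
          + u2 j m ^ 2 * u2 (j + 1) m
          + 2 * u2 j m * f1 ((m : ℝ) * h) ((j : ℝ) * k) * u1 (j + 1) m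
          + u1 j m * f2 ((m : ℝ) * h) ((j : ℝ) * k) * u1 (j + 1) m
          + 3 * u2 j m * f2 ((m : ℝ) * h) ((j : ℝ) * k) * u2 (j + 1) m
          + 2 * f1 ((m : ℝ) * h) ((j : ℝ) * k) * f2 ((m : ℝ) * h) ((j : ℝ) * k) * u1 j m
          + f1 ((m : ℝ) * h) ((j : ℝ) * k) ^ 2 * u2 j m
          + 3 * f2 ((m : ℝ) * h) ((j : ℝ) * k) ^ 2 * u2 j m)
      + g2 ((m : ℝ) * h) ((j : ℝ) * k) = 0)

/-- `(u1, u2)` is a solution of the difference scheme (dgNLS) on `ℝ_h × (ℝ_k ∩ [0,T])`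
with initial condition `(w1, w2)` (restricted to the mesh), lying in `S_h` at each time step. -/
def IsSolOn (μ h k T : ℝ) (f1 f2 g1 g2 : ℝ → ℝ → ℝ) (w1 w2 : ℝ → ℝ)
    (u1 u2 : ℕ → ℤ → ℝ) : Prop :=
  (∀ m : ℤ, u1 0 m = w1 ((m : ℝ) * h) ∧ u2 0 m = w2 ((m : ℝ) * h)) ∧
    (∀ j : ℕ, ((j : ℝ) + 1) * k ≤ T → SchemeAt μ h k f1 f2 g1 g2 u1 u2 j) ∧
    (∀ j : ℕ, (j : ℝ) * k ≤ T → InSh h (u1 j) ∧ InSh h (u2 j))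

/-- Squared weighted discrete norm `‖⟨x⟩^N D₊^n v‖_{L²_h}²` of a real-valued mesh function. -/
def wnormSq (h : ℝ) (N n : ℕ) (v : ℤ → ℝ) : ℝ :=
  ∑' m : ℤ, (jb ((m : ℝ) * h) ^ N * (Dp h)^[n] v m) ^ 2 * h

/-- First component of the operator `Q_j` built from the solution at time `t_j` and the
background `f` at time `t_j`. -/
def Q1 (μ h : ℝ) (u1 u2 f1 f2 ρ1 ρ2 : ℤ → ℝ) : ℤ → ℝ := fun m =>
  Dp h (Dm h ρ2) m + μ * u1 m * u2 m * ρ1 m + μ * u2 m ^ 2 * ρ2 m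
    + 2 * μ * u2 m * f1 m * ρ1 m + μ * u1 m * f2 m * ρ1 m + 3 * μ * u2 m * f2 m * ρ2 m

/-- Second component of the operator `Q_j`. -/
def Q2 (μ h : ℝ) (u1 u2 f1 f2 ρ1 ρ2 : ℤ → ℝ) : ℤ → ℝ := fun m =>
  -(Dp h (Dm h ρ1) m) - μ * u1 m ^ 2 * ρ1 m - μ * u1 m * u2 m * ρ2 m
    - 3 * μ * f1 m * u1 m * ρ1 m - μ * f1 m * u2 m * ρ2 m - 2 * μ * f2 m * u1 m * ρ2 m

/-- The square `⟨x⟩² = x² + 1` of the Japanese bracket. -/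
def jsq (x : ℝ) : ℝ := x ^ 2 + 1

lemma jsq_pos (x : ℝ) : 0 < jsq x := by unfold jsq; positivity

lemma one_le_jsq (x : ℝ) : 1 ≤ jsq x := by unfold jsq; nlinarith [sq_nonneg x]

lemma jsq_zpow_pos (x : ℝ) (b : ℤ) : 0 < jsq x ^ b := zpow_pos (jsq_pos x) b

lemma sq_le_jsq (x : ℝ) : x ^ 2 ≤ jsq x := by unfold jsq; linarith

lemma jb_sq (x : ℝ) : jb x ^ 2 = jsq x := by
  unfold jb jsq; exact Real.sq_sqrt (by positivity)

lemma jb_pos (x : ℝ) : 0 < jb x := by unfold jb; positivity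

lemma jsq_le_mul {x y c : ℝ} (hc : |y - x| ≤ c) : jsq y ≤ (2 + 2 * c ^ 2) * jsq x := by
  have h1 : (y - x) ^ 2 ≤ c ^ 2 := sq_le_sq' (by linarith [neg_abs_le (y - x)])
    ((le_abs_self _).trans hc)
  unfold jsq
  nlinarith [sq_nonneg (y - 2 * x), mul_nonneg (sq_nonneg c) (sq_nonneg x)]

/-- Integer powers of comparable positive numbers are comparable. -/
lemma zpow_le_mul_zpow {p q K : ℝ} (hp : 0 < p) (hq : 0 < q) (hpq : p ≤ K * q) (hqp : q ≤ K * p)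
    (b : ℤ) : p ^ b ≤ K ^ b.natAbs * q ^ b := by
  have hK : 0 < K := by
    by_contra hK
    nlinarith
  obtain ⟨n, rfl | rfl⟩ := b.eq_nat_or_neg
  · simp only [zpow_natCast, Int.natAbs_natCast, ← mul_pow]
    gcongr
  · simp only [zpow_neg, zpow_natCast, Int.natAbs_neg, Int.natAbs_natCast]
    rw [← div_eq_mul_inv, inv_le_comm₀ (by positivity) (by positivity), inv_div, div_le_iff₀ (by positivity)]
    rw [mul_comm, ← mul_pow]
    gcongr

lemma jsq_zpow_le {x y c : ℝ} (hc : |y - x| ≤ c) (b : ℤ) :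
    jsq y ^ b ≤ (2 + 2 * c ^ 2) ^ b.natAbs * jsq x ^ b :=
  zpow_le_mul_zpow (jsq_pos y) (jsq_pos x) (jsq_le_mul hc)
    (jsq_le_mul (by rwa [abs_sub_comm])) b

lemma hasDerivAt_jsq (x : ℝ) : HasDerivAt jsq (2 * x) x := by
  have := (hasDerivAt_pow 2 x).add_const (1 : ℝ)
  simp only [Nat.cast_ofNat, Nat.add_one_sub_one, pow_one] at this
  exact this

lemma hasDerivAt_jsq_zpow (b : ℤ) (x : ℝ) :
    HasDerivAt (fun y => jsq y ^ b) (b * jsq x ^ (b - 1) * (2 * x)) x :=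
  (hasDerivAt_zpow b (jsq x) (Or.inl (jsq_pos x).ne')).comp x (hasDerivAt_jsq x)

/-- Mean value theorem on a step of length `h`. -/
lemma exists_step_eq_deriv {F F' : ℝ → ℝ} (hF : ∀ x, HasDerivAt F (F' x) x) {h : ℝ} (hh : 0 < h)
    (x : ℝ) : ∃ ξ ∈ Set.Icc x (x + h), (F (x + h) - F x) = h * F' ξ := by
  obtain ⟨ξ, hξ, he⟩ := exists_hasDerivAt_eq_slope F F' (by linarith : x < x + h)
    (fun y _ => (hF y).continuousAt.continuousWithinAt) (fun y _ => hF y)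
  refine ⟨ξ, ⟨hξ.1.le, hξ.2.le⟩, ?_⟩
  rw [he, add_sub_cancel_left, mul_div_cancel₀ _ hh.ne']

/-- Step differences of the weight `⟨x⟩^{2b}`. -/
lemma exists_jsq_zpow_step (b : ℤ) : ∃ C > 0, ∀ h ∈ Set.Ioo (0 : ℝ) 1, ∀ x s t δ : ℝ, 0 < δ →
    |(jsq (x + h) ^ b - jsq x ^ b) * s * t| ≤
      h * (δ * (jsq x ^ b * s ^ 2) + C / δ * (jsq x ^ (b - 1) * t ^ 2)) := by
  set K : ℝ := (2 + 2 * 1 ^ 2) ^ (b - 1).natAbs with hK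
  have hKpos : 0 < K := by positivity
  refine ⟨4 * ((b : ℝ) * K) ^ 2 + 1, by positivity, ?_⟩
  intro h hh x s t δ hδ
  obtain ⟨ξ, hξ, he⟩ := exists_step_eq_deriv (hasDerivAt_jsq_zpow b) hh.1 x
  have hd : |ξ - x| ≤ 1 := by
    rw [abs_of_nonneg (by linarith [hξ.1])]; linarith [hξ.2, hh.2]
  have hξw : jsq ξ ^ (b - 1) ≤ K * jsq x ^ (b - 1) := jsq_zpow_le hd _
  have hξ2 : ξ ^ 2 ≤ 4 * jsq x := by
    have := jsq_le_mul hd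
    have := sq_le_jsq ξ
    linarith
  have hb : jsq x ^ b = jsq x ^ (b - 1) * jsq x := by
    rw [← zpow_add_one₀ (jsq_pos x).ne']; congr 1; ring
  rw [he]
  have hw := jsq_zpow_pos x (b - 1)
  have hw' := jsq_zpow_pos ξ (b - 1)
  have key : |(b : ℝ) * K * (2 * ξ) * s * t| ≤
      δ * (jsq x * s ^ 2) + (4 * ((b : ℝ) * K) ^ 2 + 1) / δ * t ^ 2 := by
    have e : |(b : ℝ) * K * (2 * ξ) * s * t| ≤ δ / 4 * (ξ * s) ^ 2 + 4 * (b * K * t) ^ 2 / δ := by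
      rw [abs_le]
      have h1 : δ / 4 * (ξ * s) ^ 2 + 4 * (b * K * t) ^ 2 / δ - (b : ℝ) * K * (2 * ξ) * s * t
          = (δ / 2 * (ξ * s) - 2 * (b * K * t)) ^ 2 / δ := by field_simp; ring
      have h2 : δ / 4 * (ξ * s) ^ 2 + 4 * (b * K * t) ^ 2 / δ + (b : ℝ) * K * (2 * ξ) * s * t
          = (δ / 2 * (ξ * s) + 2 * (b * K * t)) ^ 2 / δ := by field_simp; ring
      have p1 : 0 ≤ (δ / 2 * (ξ * s) - 2 * (b * K * t)) ^ 2 / δ := by positivity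
      have p2 : 0 ≤ (δ / 2 * (ξ * s) + 2 * (b * K * t)) ^ 2 / δ := by positivity
      constructor <;> linarith
    refine e.trans ?_
    have e1 : δ / 4 * (ξ * s) ^ 2 ≤ δ * (jsq x * s ^ 2) := by
      rw [mul_pow]
      have : ξ ^ 2 * s ^ 2 ≤ 4 * jsq x * s ^ 2 := by gcongr
      nlinarith
    have e2 : 4 * (b * K * t) ^ 2 / δ ≤ (4 * ((b : ℝ) * K) ^ 2 + 1) / δ * t ^ 2 := by
      rw [div_mul_eq_mul_div]
      apply div_le_div_of_nonneg_right _ hδ.le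
      nlinarith [sq_nonneg t]
    linarith
  have e0 : |h * (↑b * jsq ξ ^ (b - 1) * (2 * ξ)) * s * t|
      ≤ h * (jsq x ^ (b - 1) * |(b : ℝ) * K * (2 * ξ) * s * t|) := by
    have : h * (↑b * jsq ξ ^ (b - 1) * (2 * ξ)) * s * t
        = h * jsq ξ ^ (b - 1) * (b * (2 * ξ) * s * t) := by ring
    have h3 : (b : ℝ) * K * (2 * ξ) * s * t = K * (b * (2 * ξ) * s * t) := by ring
    rw [this, h3, abs_mul, abs_mul K, abs_of_pos hKpos, abs_of_pos (mul_pos hh.1 hw'),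
      mul_assoc, ← mul_assoc (jsq x ^ (b - 1)), mul_comm (jsq x ^ (b - 1)) K]
    have := hh.1
    gcongr
  refine e0.trans ?_
  rw [hb]
  calc _ ≤ h * (jsq x ^ (b - 1) * (δ * (jsq x * s ^ 2) + (4 * ((b : ℝ) * K) ^ 2 + 1) / δ * t ^ 2)) := by
        have := hh.1
        gcongr
    _ = _ := by ring

/-- Riemann sums of `⟨x⟩^{-2}` are bounded uniformly in the mesh size. -/
lemma sum_inv_jsq_le {h : ℝ} (hh : h ∈ Set.Ioc (0 : ℝ) 1) (s : Finset ℤ) :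
    ∑ m ∈ s, (jsq ((m : ℝ) * h))⁻¹ * h ≤ 16 := by
  have step : ∀ m : ℤ, (jsq ((m : ℝ) * h))⁻¹ * h ≤
      4 * (Real.arctan (((m + 1 : ℤ) : ℝ) * h) - Real.arctan ((m : ℝ) * h)) := by
    intro m
    obtain ⟨ξ, hξ, he⟩ := exists_step_eq_deriv Real.hasDerivAt_arctan hh.1 ((m : ℝ) * h)
    have e : (((m + 1 : ℤ) : ℝ) * h) = m * h + h := by push_cast; ring
    rw [e, he]
    have hd : |ξ - m * h| ≤ 1 := by
      rw [abs_of_nonneg (by linarith [hξ.1])]; linarith [hξ.2, hh.2]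
    have h1 := jsq_le_mul hd
    have h2 : (1 : ℝ) / (1 + ξ ^ 2) = (jsq ξ)⁻¹ := by unfold jsq; rw [one_div, add_comm]
    rw [h2]
    have h3 : (jsq (m * h))⁻¹ ≤ 4 * (jsq ξ)⁻¹ := by
      rw [inv_le_comm₀ (jsq_pos _) (by have := jsq_pos ξ; positivity), mul_inv, inv_inv]
      linarith
    have := hh.1
    nlinarith
  have mono : ∀ m : ℤ, 0 ≤ 4 * (Real.arctan (((m + 1 : ℤ) : ℝ) * h) - Real.arctan ((m : ℝ) * h)) :=
    fun m => le_trans (by have := jsq_pos (m * h); have := hh.1; positivity) (step m)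
  obtain ⟨M, hM⟩ : ∃ M : ℕ, s ⊆ Finset.Ico (-(M : ℤ)) M := by
    refine ⟨∑ m ∈ s, (m.natAbs + 1), fun m hm => ?_⟩
    have := Finset.single_le_sum (f := fun m : ℤ => m.natAbs + 1) (fun i _ => by positivity) hm
    rw [Finset.mem_Ico]
    omega
  have tele : ∀ M : ℕ, ∑ m ∈ Finset.Ico (-(M : ℤ)) M,
      4 * (Real.arctan (((m + 1 : ℤ) : ℝ) * h) - Real.arctan ((m : ℝ) * h))
      = 4 * (Real.arctan (M * h) - Real.arctan (-M * h)) := by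
    intro M
    have : ∀ l : ℕ, ∑ m ∈ Finset.Ico (-(M : ℤ)) (-(M : ℤ) + l),
        4 * (Real.arctan (((m + 1 : ℤ) : ℝ) * h) - Real.arctan ((m : ℝ) * h))
        = 4 * (Real.arctan ((-(M : ℝ) + l) * h) - Real.arctan (-M * h)) := by
      intro l
      induction l with
      | zero => simp
      | succ l ih =>
        have : Finset.Ico (-(M : ℤ)) (-(M : ℤ) + ((l + 1 : ℕ) : ℤ))
            = insert (-(M : ℤ) + l) (Finset.Ico (-(M : ℤ)) (-(M : ℤ) + l)) := by
          ext x; simp only [Finset.mem_Ico, Finset.mem_insert]; push_cast; omega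
        rw [this, Finset.sum_insert (by simp), ih]
        push_cast
        ring_nf
    have h2 := this (2 * M)
    have e1 : -(M : ℤ) + ((2 * M : ℕ) : ℤ) = M := by push_cast; ring
    have e2 : -(M : ℝ) + ((2 * M : ℕ) : ℝ) = M := by push_cast; ring
    rwa [e1, e2] at h2
  calc _ ≤ ∑ m ∈ s, 4 * (Real.arctan (((m + 1 : ℤ) : ℝ) * h) - Real.arctan ((m : ℝ) * h)) :=
        Finset.sum_le_sum fun m _ => step m
    _ ≤ _ := Finset.sum_le_sum_of_subset_of_nonneg hM fun m _ _ => mono m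
    _ = _ := tele M
    _ ≤ 16 := by
      have h1 := Real.arctan_lt_pi_div_two (M * h)
      have h2 := Real.neg_pi_div_two_lt_arctan (-M * h)
      have := Real.pi_lt_four
      linarith

lemma summable_inv_jsq {h : ℝ} (hh : h ∈ Set.Ioc (0 : ℝ) 1) :
    Summable fun m : ℤ => (jsq ((m : ℝ) * h))⁻¹ * h :=
  summable_of_sum_le (fun m => by have := jsq_pos (m * h); have := hh.1; positivity)
    (sum_inv_jsq_le hh)

lemma tsum_inv_jsq_le {h : ℝ} (hh : h ∈ Set.Ioc (0 : ℝ) 1) :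
    ∑' m : ℤ, (jsq ((m : ℝ) * h))⁻¹ * h ≤ 16 :=
  (summable_inv_jsq hh).tsum_le_of_sum_le (sum_inv_jsq_le hh)

/-- Mesh functions decaying faster than every power of the index. -/
def RapidDecay (v : ℤ → ℝ) : Prop :=
  ∀ N : ℕ, ∃ C : ℝ, ∀ m : ℤ, |v m| * (1 + |(m : ℝ)|) ^ N ≤ C

/-- Mesh functions of at most polynomial growth in the index. -/
def PolyGrowth (φ : ℤ → ℝ) : Prop :=
  ∃ N : ℕ, ∃ C : ℝ, ∀ m : ℤ, |φ m| ≤ C * (1 + |(m : ℝ)|) ^ N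

lemma PolyGrowth.of_bounded {φ : ℤ → ℝ} {C : ℝ} (h : ∀ m, |φ m| ≤ C) : PolyGrowth φ :=
  ⟨0, C, by simpa using h⟩

lemma RapidDecay.polyGrowth {v : ℤ → ℝ} (hv : RapidDecay v) : PolyGrowth v := by
  obtain ⟨C, hC⟩ := hv 0
  exact .of_bounded (C := C) (by simpa using hC)

lemma RapidDecay.mono {v w : ℤ → ℝ} (hv : RapidDecay v) (h : ∀ m, |w m| ≤ |v m|) :
    RapidDecay w := by
  intro N
  obtain ⟨C, hC⟩ := hv N
  exact ⟨C, fun m => le_trans (mul_le_mul_of_nonneg_right (h m) (by positivity)) (hC m)⟩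

lemma RapidDecay.polyGrowth_mul {φ v : ℤ → ℝ} (hφ : PolyGrowth φ) (hv : RapidDecay v) :
    RapidDecay fun m => φ m * v m := by
  intro N
  obtain ⟨M, C, hC⟩ := hφ
  obtain ⟨D, hD⟩ := hv (M + N)
  refine ⟨|C| * D, fun m => ?_⟩
  calc |φ m * v m| * (1 + |(m : ℝ)|) ^ N
      ≤ (|C| * (1 + |(m : ℝ)|) ^ M) * |v m| * (1 + |(m : ℝ)|) ^ N := by
        rw [abs_mul]
        gcongr
        exact (hC m).trans (by gcongr; exact le_abs_self C)
    _ = |C| * (|v m| * (1 + |(m : ℝ)|) ^ (M + N)) := by rw [pow_add]; ring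
    _ ≤ _ := by gcongr; exact hD m

lemma RapidDecay.mul_polyGrowth {φ v : ℤ → ℝ} (hv : RapidDecay v) (hφ : PolyGrowth φ) :
    RapidDecay fun m => v m * φ m := by
  simpa only [mul_comm] using hv.polyGrowth_mul hφ

lemma RapidDecay.mul {v w : ℤ → ℝ} (hv : RapidDecay v) (hw : RapidDecay w) :
    RapidDecay fun m => v m * w m := hw.polyGrowth_mul hv.polyGrowth

lemma RapidDecay.const_mul {v : ℤ → ℝ} (c : ℝ) (hv : RapidDecay v) :
    RapidDecay fun m => c * v m :=
  hv.polyGrowth_mul (.of_bounded (C := |c|) fun _ => le_rfl)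

lemma RapidDecay.mul_const {v : ℤ → ℝ} (hv : RapidDecay v) (c : ℝ) :
    RapidDecay fun m => v m * c := by simpa only [mul_comm] using hv.const_mul c

lemma RapidDecay.sq {v : ℤ → ℝ} (hv : RapidDecay v) : RapidDecay fun m => v m ^ 2 := by
  simpa only [pow_two] using hv.mul hv

lemma RapidDecay.add {v w : ℤ → ℝ} (hv : RapidDecay v) (hw : RapidDecay w) :
    RapidDecay fun m => v m + w m := by
  intro N
  obtain ⟨C, hC⟩ := hv N
  obtain ⟨D, hD⟩ := hw N
  refine ⟨C + D, fun m => ?_⟩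
  calc |v m + w m| * (1 + |(m : ℝ)|) ^ N ≤ (|v m| + |w m|) * (1 + |(m : ℝ)|) ^ N := by
        gcongr; exact abs_add_le _ _
    _ ≤ _ := by rw [add_mul]; exact add_le_add (hC m) (hD m)

lemma RapidDecay.neg {v : ℤ → ℝ} (hv : RapidDecay v) : RapidDecay fun m => - v m :=
  hv.mono fun m => by rw [abs_neg]

lemma RapidDecay.sub {v w : ℤ → ℝ} (hv : RapidDecay v) (hw : RapidDecay w) :
    RapidDecay fun m => v m - w m := by
  simpa only [sub_eq_add_neg] using hv.add hw.neg

lemma RapidDecay.abs {v : ℤ → ℝ} (hv : RapidDecay v) : RapidDecay fun m => |v m| :=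
  hv.mono fun m => by rw [abs_abs]

lemma RapidDecay.shift {v : ℤ → ℝ} (hv : RapidDecay v) (a : ℤ) :
    RapidDecay fun m => v (m + a) := by
  intro N
  obtain ⟨C, hC⟩ := hv N
  refine ⟨(1 + |(a : ℝ)|) ^ N * C, fun m => ?_⟩
  have : 1 + |(m : ℝ)| ≤ (1 + |(a : ℝ)|) * (1 + |((m + a : ℤ) : ℝ)|) := by
    have h1 : |(m : ℝ)| ≤ |((m + a : ℤ) : ℝ)| + |(a : ℝ)| := by
      have := abs_sub (((m + a : ℤ) : ℝ)) (a : ℝ)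
      simpa using this
    nlinarith [abs_nonneg (a : ℝ), abs_nonneg ((m + a : ℤ) : ℝ)]
  calc |v (m + a)| * (1 + |(m : ℝ)|) ^ N
      ≤ |v (m + a)| * ((1 + |(a : ℝ)|) * (1 + |((m + a : ℤ) : ℝ)|)) ^ N := by gcongr
    _ = (1 + |(a : ℝ)|) ^ N * (|v (m + a)| * (1 + |((m + a : ℤ) : ℝ)|) ^ N) := by
        rw [mul_pow]; ring
    _ ≤ _ := by gcongr; exact hC _

lemma RapidDecay.summable {v : ℤ → ℝ} (hv : RapidDecay v) : Summable v := by
  obtain ⟨C, hC⟩ := hv 2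
  have h1 := summable_inv_jsq (h := 1) ⟨one_pos, le_rfl⟩
  refine Summable.of_norm_bounded (h1.mul_left C) fun m => ?_
  have hp := jsq_pos (m * 1)
  rw [Real.norm_eq_abs, mul_one, ← div_eq_mul_inv, le_div_iff₀ hp]
  refine le_trans ?_ (hC m)
  gcongr
  unfold jsq
  nlinarith [abs_nonneg (m : ℝ), sq_abs (m : ℝ)]

lemma RapidDecay.Dp {v : ℤ → ℝ} (hv : RapidDecay v) (h : ℝ) : RapidDecay (Dp h v) := by
  have := ((hv.shift 1).sub hv).mul_const h⁻¹
  simp only [← div_eq_mul_inv] at this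
  exact this

lemma RapidDecay.Dm {v : ℤ → ℝ} (hv : RapidDecay v) (h : ℝ) : RapidDecay (Dm h v) := by
  have := (hv.sub (hv.shift (-1))).mul_const h⁻¹
  simp only [← div_eq_mul_inv] at this
  exact this

lemma RapidDecay.iterate_Dp {v : ℤ → ℝ} (hv : RapidDecay v) (h : ℝ) (n : ℕ) :
    RapidDecay ((_root_.Dp h)^[n] v) := by
  induction n generalizing v with
  | zero => exact hv
  | succ n ih => exact ih (hv.Dp h)

lemma PolyGrowth.pow {φ : ℤ → ℝ} (hφ : PolyGrowth φ) (n : ℕ) : PolyGrowth fun m => φ m ^ n := by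
  obtain ⟨N, C, hC⟩ := hφ
  refine ⟨N * n, |C| ^ n, fun m => ?_⟩
  rw [abs_pow, pow_mul, ← mul_pow]
  gcongr
  exact (hC m).trans (by gcongr; exact le_abs_self C)

lemma polyGrowth_jsq (h : ℝ) : PolyGrowth fun m : ℤ => jsq ((m : ℝ) * h) := by
  refine ⟨2, 1 + h ^ 2, fun m => ?_⟩
  rw [abs_of_pos (jsq_pos _)]
  unfold jsq
  have := sq_abs (m : ℝ)
  have h1 := abs_nonneg (m : ℝ)
  rw [mul_pow, ← this]
  nlinarith [mul_nonneg (sq_nonneg h) h1, sq_nonneg h, mul_nonneg (sq_nonneg h) (sq_nonneg |(m : ℝ)|)]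

lemma polyGrowth_jsq_zpow (h : ℝ) (b : ℤ) : PolyGrowth fun m : ℤ => jsq ((m : ℝ) * h) ^ b := by
  obtain ⟨n, rfl | rfl⟩ := b.eq_nat_or_neg
  · simpa only [zpow_natCast] using (polyGrowth_jsq h).pow n
  · refine .of_bounded (C := 1) fun m => ?_
    rw [abs_of_pos (jsq_zpow_pos _ _), zpow_neg, zpow_natCast]
    exact inv_le_one_of_one_le₀ (one_le_pow₀ (one_le_jsq _))

lemma RapidDecay.jsq_mul {v : ℤ → ℝ} (hv : RapidDecay v) (h : ℝ) (b : ℤ) :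
    RapidDecay fun m => jsq ((m : ℝ) * h) ^ b * v m :=
  hv.polyGrowth_mul (polyGrowth_jsq_zpow h b)

lemma tsum_shift (v : ℤ → ℝ) (a : ℤ) : ∑' m : ℤ, v (m + a) = ∑' m : ℤ, v m :=
  (Equiv.addRight a).tsum_eq v

lemma RapidDecay.tsum_sub_shift {v : ℤ → ℝ} (hv : RapidDecay v) :
    ∑' m : ℤ, (v (m + 1) - v m) = 0 := by
  rw [(hv.shift 1).summable.tsum_sub hv.summable, tsum_shift, sub_self]

lemma RapidDecay.tsum_le {v w : ℤ → ℝ} (hv : RapidDecay v) (hw : RapidDecay w)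
    (h : ∀ m, v m ≤ w m) : ∑' m, v m ≤ ∑' m, w m :=
  hv.summable.tsum_le_tsum h hw.summable

/-- A mesh function is bounded by the total variation of its tail. -/
lemma RapidDecay.le_tsum_abs_sub {v : ℤ → ℝ} (hv : RapidDecay v) (m : ℤ) :
    v m ≤ ∑' l : ℤ, |v (l + 1) - v l| := by
  set H : ℤ → ℝ := fun l => if m ≤ l then 1 else 0 with hH
  have hHb : ∀ l, |H l| ≤ 1 := fun l => by simp only [hH]; split_ifs <;> simp
  have hHv : RapidDecay fun l => H l * v l := hv.polyGrowth_mul (.of_bounded hHb)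
  have h1 := hHv.tsum_sub_shift
  have hd : RapidDecay fun l => v (l + 1) - v l := (hv.shift 1).sub hv
  have hHd : RapidDecay fun l => H l * (v (l + 1) - v l) := hd.polyGrowth_mul (.of_bounded hHb)
  have hE : RapidDecay fun l => (H (l + 1) - H l) * v (l + 1) :=
    (hv.shift 1).polyGrowth_mul (.of_bounded (C := 2) fun l => by
      have h1 := abs_sub (H (l + 1)) (H l)
      linarith [hHb l, hHb (l + 1)])
  have h2 : ∑' l, (H l * (v (l + 1) - v l) + (H (l + 1) - H l) * v (l + 1)) = 0 := by
    rw [← h1]; congr 1; ext l; ring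
  rw [hHd.summable.tsum_add hE.summable] at h2
  have h3 : ∑' l, (H (l + 1) - H l) * v (l + 1) = v m := by
    rw [tsum_eq_single (m - 1)]
    · simp [hH]
    · intro l hl
      have : H (l + 1) = H l := by
        simp only [hH]
        have : m ≤ l + 1 ↔ m ≤ l := by omega
        simp [this]
      rw [this]; ring
  have h4 : ∑' l, -(H l * (v (l + 1) - v l)) ≤ ∑' l, |v (l + 1) - v l| :=
    hHd.neg.tsum_le hd.abs fun l => by
      rw [← abs_neg]
      refine (le_abs_self _).trans ?_
      rw [abs_neg, abs_neg, abs_mul]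
      exact mul_le_of_le_one_left (abs_nonneg _) (hHb l)
  rw [tsum_neg] at h4
  linarith

/-- The weighted sum `‖⟨x⟩^b v‖²` over the mesh of size `h`. -/
def wsum (h : ℝ) (b : ℤ) (v : ℤ → ℝ) : ℝ := ∑' m : ℤ, jsq ((m : ℝ) * h) ^ b * v m ^ 2 * h

lemma RapidDecay.wsum_summand {v : ℤ → ℝ} (hv : RapidDecay v) (h : ℝ) (b : ℤ) :
    RapidDecay fun m => jsq ((m : ℝ) * h) ^ b * v m ^ 2 * h :=
  (hv.sq.jsq_mul h b).mul_const h

lemma RapidDecay.hasSum_wsum {v : ℤ → ℝ} (hv : RapidDecay v) (h : ℝ) (b : ℤ) :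
    HasSum (fun m : ℤ => jsq ((m : ℝ) * h) ^ b * v m ^ 2 * h) (wsum h b v) :=
  (hv.wsum_summand h b).summable.hasSum

lemma RapidDecay.hasSum_sub_shift {v : ℤ → ℝ} (hv : RapidDecay v) :
    HasSum (fun m : ℤ => v (m + 1) - v m) 0 := by
  have := ((hv.shift 1).sub hv).summable.hasSum
  rwa [hv.tsum_sub_shift] at this

lemma wsum_nonneg {h : ℝ} (hh : 0 ≤ h) (b : ℤ) (v : ℤ → ℝ) : 0 ≤ wsum h b v :=
  tsum_nonneg fun m => by have := jsq_zpow_pos (m * h) b; positivity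

lemma wsum_mono_weight {h : ℝ} (hh : 0 ≤ h) {b c : ℤ} (hbc : b ≤ c) {v : ℤ → ℝ}
    (hv : RapidDecay v) : wsum h b v ≤ wsum h c v :=
  hasSum_le (fun m => by gcongr; exact one_le_jsq _) (hv.hasSum_wsum h b) (hv.hasSum_wsum h c)

lemma wsum_add_le {h : ℝ} (hh : 0 ≤ h) (b : ℤ) {v w : ℤ → ℝ} (hv : RapidDecay v)
    (hw : RapidDecay w) :
    wsum h b (fun m => v m + w m) ≤ 2 * wsum h b v + 2 * wsum h b w := by
  refine hasSum_le (fun m => ?_) ((hv.add hw).hasSum_wsum h b)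
    (((hv.hasSum_wsum h b).mul_left 2).add ((hw.hasSum_wsum h b).mul_left 2))
  have hp := (jsq_zpow_pos (m * h) b).le
  have : (v m + w m) ^ 2 ≤ 2 * v m ^ 2 + 2 * w m ^ 2 := by nlinarith [sq_nonneg (v m - w m)]
  calc _ ≤ jsq (m * h) ^ b * (2 * v m ^ 2 + 2 * w m ^ 2) * h := by gcongr
    _ = _ := by ring

lemma step_sub_le {h : ℝ} (hh : h ∈ Set.Ioo (0 : ℝ) 1) (m : ℤ) :
    |((m : ℝ) * h) - ((m + 1 : ℤ) : ℝ) * h| ≤ 1 := by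
  have : ((m : ℝ) * h) - ((m + 1 : ℤ) : ℝ) * h = -h := by push_cast; ring
  rw [this, abs_neg, abs_of_pos hh.1]; exact hh.2.le

lemma wsum_shift_le {h : ℝ} (hh : h ∈ Set.Ioo (0 : ℝ) 1) (b : ℤ) {v : ℤ → ℝ}
    (hv : RapidDecay v) : wsum h b (fun m => v (m + 1)) ≤ 4 ^ b.natAbs * wsum h b v := by
  have h1 := (hv.wsum_summand h b).shift 1
  have h2 := h1.summable.hasSum
  rw [tsum_shift (fun m : ℤ => jsq ((m : ℝ) * h) ^ b * v m ^ 2 * h) 1] at h2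
  refine hasSum_le (fun m => ?_) ((hv.shift 1).hasSum_wsum h b) (h2.mul_left _)
  have e := jsq_zpow_le (step_sub_le hh m) b
  norm_num at e
  have := hh.1
  calc _ ≤ (4 ^ b.natAbs * jsq (((m + 1 : ℤ) : ℝ) * h) ^ b) * v (m + 1) ^ 2 * h := by
        gcongr; push_cast; exact e
    _ = _ := by ring

lemma iterate_Dp_shift (h : ℝ) (n : ℕ) (v : ℤ → ℝ) :
    (Dp h)^[n] (fun m => v (m + 1)) = fun m => (Dp h)^[n] v (m + 1) := by
  induction n generalizing v with
  | zero => rfl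
  | succ n ih => exact ih (Dp h v)

lemma iterate_Dp_add (h : ℝ) (n : ℕ) (v w : ℤ → ℝ) :
    (Dp h)^[n] (fun m => v m + w m) = fun m => (Dp h)^[n] v m + (Dp h)^[n] w m := by
  induction n generalizing v w with
  | zero => rfl
  | succ n ih =>
    rw [Function.iterate_succ_apply, Function.iterate_succ_apply, Function.iterate_succ_apply, ← ih]
    congr 1; ext m; simp only [Dp]; ring

lemma iterate_Dp_const_mul (h : ℝ) (n : ℕ) (c : ℝ) (v : ℤ → ℝ) :
    (Dp h)^[n] (fun m => c * v m) = fun m => c * (Dp h)^[n] v m := by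
  induction n generalizing v with
  | zero => rfl
  | succ n ih =>
    rw [Function.iterate_succ_apply, Function.iterate_succ_apply, ← ih]
    congr 1; ext m; simp only [Dp]; ring

lemma eq_add_mul_Dp {h : ℝ} (hh : 0 < h) (v : ℤ → ℝ) (m : ℤ) : v (m + 1) = v m + h * Dp h v m := by
  unfold Dp; field_simp; ring

/-- Weighted interpolation of `D₊v` between `v` and `D₊²v`. -/
lemma exists_wsum_Dp_le (b : ℤ) {δ : ℝ} (hδ : 0 < δ) : ∃ C ≥ 0, ∀ h ∈ Set.Ioo (0 : ℝ) 1,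
    ∀ v, RapidDecay v →
      wsum h b (Dp h v) ≤ δ * wsum h (b + 1) (Dp h (Dp h v)) + C * wsum h (b - 1) v := by
  obtain ⟨C, hC, hstep⟩ := exists_jsq_zpow_step b
  set K : ℝ := 4 ^ b.natAbs with hK
  set C1 : ℝ := 2 * C + K ^ 2 / δ with hC1
  have hC1p : 0 ≤ C1 := by positivity
  refine ⟨2 * C1 * 4 ^ (b - 1).natAbs, by positivity, fun h hh v hv => ?_⟩
  set w := Dp h v with hw
  set z := Dp h w with hz
  have hwd : RapidDecay w := hv.Dp h
  have hzd : RapidDecay z := hwd.Dp h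
  have hφ : RapidDecay fun m => jsq ((m : ℝ) * h) ^ b * (v m * w m) := (hv.mul hwd).jsq_mul h b
  have hsum := hasSum_le (f := fun m : ℤ => jsq ((m : ℝ) * h) ^ b * w m ^ 2 * h)
    (fun m => ?_) (hwd.hasSum_wsum h b)
    ((hφ.hasSum_sub_shift.add ((hwd.hasSum_wsum h b).mul_left (1 / 2))).add
      (((hzd.hasSum_wsum h (b + 1)).mul_left (δ / 2)).add
        (((hv.shift 1).hasSum_wsum h (b - 1)).mul_left C1)))
  · have := wsum_shift_le hh (b - 1) hv
    have h3 : C1 * wsum h (b - 1) (fun m => v (m + 1))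
        ≤ C1 * (4 ^ (b - 1).natAbs * wsum h (b - 1) v) := by gcongr
    linarith
  · have hh0 := hh.1
    set x := (m : ℝ) * h with hx
    have hx1' : ((m : ℝ) + 1) * h = x + h := by rw [hx]; ring
    simp only [Int.cast_add, Int.cast_one, hx1']
    set t := v (m + 1) with ht
    have hvt : v m = t - h * w m := by rw [ht, eq_add_mul_Dp hh0 v m]; ring
    have hw1 : w (m + 1) = w m + h * z m := eq_add_mul_Dp hh0 w m
    rw [hvt, hw1]
    have e1 := hstep h hh x (w m) t (1 / 2) (by norm_num)
    have e2 : |jsq (x + h) ^ b * t * z m| ≤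
        δ / 2 * (jsq x ^ (b + 1) * z m ^ 2) + K ^ 2 / δ * (jsq x ^ (b - 1) * t ^ 2) := by
      have hcmp : jsq (x + h) ^ b ≤ K * jsq x ^ b := by
        have := jsq_zpow_le (x := x) (y := x + h) (c := 1) (by
          rw [add_sub_cancel_left, abs_of_pos hh0]; exact hh.2.le) b
        norm_num at this
        exact this
      have hp := jsq_pos x
      have hb1 : jsq x ^ (b + 1) = jsq x ^ (b - 1) * jsq x ^ 2 := by
        rw [← zpow_natCast, ← zpow_add₀ hp.ne']; congr 1; push_cast; ring
      have hb0 : jsq x ^ b = jsq x ^ (b - 1) * jsq x := by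
        rw [← zpow_add_one₀ hp.ne']; congr 1; ring
      have hq := jsq_zpow_pos x (b - 1)
      rw [mul_assoc, abs_mul, abs_of_pos (jsq_zpow_pos _ _)]
      refine (mul_le_mul_of_nonneg_right hcmp (abs_nonneg _)).trans ?_
      rw [hb1, hb0]
      have : K * jsq x * |t * z m| ≤ δ / 2 * (jsq x ^ 2 * z m ^ 2) + K ^ 2 / δ * t ^ 2 := by
        rw [abs_mul]
        have e : δ / 2 * (jsq x ^ 2 * z m ^ 2) + K ^ 2 / δ * t ^ 2 - K * jsq x * (|t| * |z m|)
            = (δ * (jsq x * |z m|) - K * |t|) ^ 2 / (2 * δ) + K ^ 2 * t ^ 2 / (2 * δ) := by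
          rw [← sq_abs t, ← sq_abs (z m)]; field_simp; ring
        have : 0 ≤ (δ * (jsq x * |z m|) - K * |t|) ^ 2 / (2 * δ) + K ^ 2 * t ^ 2 / (2 * δ) := by
          positivity
        linarith
      nlinarith
    have e3 := (neg_abs_le _).trans' (neg_le_neg e1)
    have e4 := mul_le_mul_of_nonneg_left ((neg_abs_le _).trans' (neg_le_neg e2)) hh0.le
    have e5 : C / (1 / 2) = 2 * C := by ring
    rw [e5] at e3
    rw [hC1]
    nlinarith

lemma exists_wsum_iterate_Dp_le_succ (b : ℤ) (i : ℕ) {δ : ℝ} (hδ : 0 < δ) : ∃ C ≥ 0,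
    ∀ h ∈ Set.Ioo (0 : ℝ) 1, ∀ v, RapidDecay v →
      wsum h (b + i) ((Dp h)^[i] v) ≤
        δ * wsum h (b + (i + 1 : ℕ)) ((Dp h)^[i + 1] v) + C * wsum h b v := by
  induction i generalizing δ with
  | zero =>
    refine ⟨1, zero_le_one, fun h hh v hv => ?_⟩
    have := wsum_nonneg hh.1.le (b + (0 + 1 : ℕ)) ((Dp h)^[0 + 1] v)
    simp only [Nat.cast_zero, add_zero, Function.iterate_zero, id_eq, one_mul]
    nlinarith
  | succ i ih =>
    obtain ⟨C, hC, h1⟩ := exists_wsum_Dp_le (b + (i + 1 : ℕ)) (half_pos hδ)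
    obtain ⟨C', hC', h2⟩ := ih (δ := 1 / (2 * (C + 1))) (by positivity)
    refine ⟨2 * (C * C'), by positivity, fun h hh v hv => ?_⟩
    have e1 := h1 h hh _ (hv.iterate_Dp h i)
    have e2 := h2 h hh v hv
    rw [← Function.iterate_succ_apply' (Dp h) i v, ← Function.iterate_succ_apply' (Dp h) (i + 1) v] at e1
    have w1 : b + (i + 1 : ℕ) + 1 = b + (i + 1 + 1 : ℕ) := by push_cast; ring
    have w2 : b + (i + 1 : ℕ) - 1 = b + i := by push_cast; ring
    rw [w1, w2] at e1
    have e3 := mul_le_mul_of_nonneg_left e2 hC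
    have hX := wsum_nonneg hh.1.le (b + (i + 1 : ℕ)) ((Dp h)^[i + 1] v)
    have e4 : C * (1 / (2 * (C + 1))) ≤ 1 / 2 := by
      rw [mul_one_div, div_le_div_iff₀ (by positivity) (by positivity)]; linarith
    have e5 := mul_le_mul_of_nonneg_right e4 hX
    nlinarith

/-- Weighted interpolation of intermediate differences. -/
lemma exists_wsum_interpolate (b : ℤ) (n : ℕ) : ∃ C ≥ 0, ∀ h ∈ Set.Ioo (0 : ℝ) 1,
    ∀ v, RapidDecay v → ∀ i ≤ n,
      wsum h (b + i) ((Dp h)^[i] v) ≤ C * (wsum h b v + wsum h (b + n) ((Dp h)^[n] v)) := by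
  induction n with
  | zero =>
    refine ⟨1, zero_le_one, fun h hh v hv i hi => ?_⟩
    obtain rfl : i = 0 := by omega
    have := wsum_nonneg hh.1.le b v
    simp only [Nat.cast_zero, add_zero, Function.iterate_zero, id_eq, one_mul]
    linarith
  | succ n ih =>
    obtain ⟨C, hC, h1⟩ := ih
    obtain ⟨C', hC', h2⟩ := exists_wsum_iterate_Dp_le_succ b n one_pos
    refine ⟨C * (1 + C') + C + 1, by positivity, fun h hh v hv i hi => ?_⟩
    have hX0 := wsum_nonneg hh.1.le b v
    have hX1 := wsum_nonneg hh.1.le (b + (n + 1 : ℕ)) ((Dp h)^[n + 1] v)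
    rcases Nat.lt_or_ge n i with hlt | hle
    · obtain rfl : i = n + 1 := by omega
      nlinarith [mul_nonneg hC hX0, mul_nonneg hC hX1, mul_nonneg (mul_nonneg hC hC') hX0,
        mul_nonneg (mul_nonneg hC hC') hX1]
    · have e1 := h1 h hh v hv i hle
      have e2 := mul_le_mul_of_nonneg_left (h2 h hh v hv) hC
      nlinarith [mul_nonneg hC hX0, mul_nonneg hC hX1, mul_nonneg (mul_nonneg hC hC') hX0,
        mul_nonneg (mul_nonneg hC hC') hX1]

lemma hasDerivAt_mul_jsq_zpow (b : ℤ) (x : ℝ) :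
    HasDerivAt (fun y => y * jsq y ^ b)
      ((2 * b + 1) * jsq x ^ b - 2 * b * jsq x ^ (b - 1)) x := by
  have h1 := (hasDerivAt_id' x).mul (hasDerivAt_jsq_zpow b x)
  have hb : jsq x ^ b = jsq x ^ (b - 1) * (x ^ 2 + 1) := by
    change _ = jsq x ^ (b - 1) * jsq x
    rw [← zpow_add_one₀ (jsq_pos x).ne']; congr 1; ring
  refine h1.congr_deriv ?_
  rw [hb]; ring

lemma abs_mul_sq_step_le {h : ℝ} (hh : h ∈ Set.Ioo (0 : ℝ) 1) (y v w : ℝ) {A : ℝ} (hA : 0 < A) :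
    |y * (w * (2 * v + h * w))| ≤ 1 / (2 * A) * v ^ 2 + (2 * A + 1) * (jsq y * w ^ 2) := by
  have hh0 := hh.1
  have hy2 : y ^ 2 ≤ jsq y := sq_le_jsq y
  have hy0 : 0 ≤ jsq y := (jsq_pos y).le
  have hy1 : |y| ≤ jsq y := by
    unfold jsq; nlinarith [sq_abs y, abs_nonneg y, sq_nonneg (|y| - 1)]
  have a1 : |y * (w * (2 * v))| ≤ 1 / (2 * A) * v ^ 2 + 2 * A * (y ^ 2 * w ^ 2) := by
    rw [abs_le]
    have i1 : 1 / (2 * A) * v ^ 2 + 2 * A * (y ^ 2 * w ^ 2) - y * (w * (2 * v))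
        = (v - 2 * A * (y * w)) ^ 2 / (2 * A) := by field_simp; ring
    have i2 : 1 / (2 * A) * v ^ 2 + 2 * A * (y ^ 2 * w ^ 2) + y * (w * (2 * v))
        = (v + 2 * A * (y * w)) ^ 2 / (2 * A) := by field_simp; ring
    have i3 : 0 ≤ (v - 2 * A * (y * w)) ^ 2 / (2 * A) := by positivity
    have i4 : 0 ≤ (v + 2 * A * (y * w)) ^ 2 / (2 * A) := by positivity
    constructor <;> linarith
  have a2 : |y * (w * (h * w))| ≤ jsq y * w ^ 2 := by
    have : y * (w * (h * w)) = y * (h * w ^ 2) := by ring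
    rw [this, abs_mul, abs_of_nonneg (by positivity : 0 ≤ h * w ^ 2)]
    have : h * w ^ 2 ≤ w ^ 2 := mul_le_of_le_one_left (sq_nonneg _) hh.2.le
    gcongr
  have a3 : y * (w * (2 * v + h * w)) = y * (w * (2 * v)) + y * (w * (h * w)) := by ring
  rw [a3]
  refine (abs_add_le _ _).trans ?_
  have a4 : 2 * A * (y ^ 2 * w ^ 2) ≤ 2 * A * (jsq y * w ^ 2) := by gcongr
  linarith

/-- Discrete Hardy inequality, up to a term with a lower weight. -/
lemma exists_wsum_hardy (b : ℤ) : ∃ C ≥ 0, ∀ h ∈ Set.Ioo (0 : ℝ) 1, ∀ v, RapidDecay v →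
    wsum h b v ≤ C * (wsum h (b + 1) (Dp h v) + wsum h (b - 1) v) := by
  set c : ℝ := 2 * b + 1 with hc
  have hc1 : 1 ≤ c ^ 2 := by
    have h1 : (1 : ℤ) ≤ (2 * b + 1) ^ 2 := by
      have : (2 * b + 1) ≠ 0 := by omega
      have := pow_pos (abs_pos.2 this) 2
      rw [sq_abs] at this; omega
    rw [hc]; exact_mod_cast h1
  set K : ℝ := 4 ^ b.natAbs with hK
  set K' : ℝ := 4 ^ (b - 1).natAbs with hK'
  have hKp : 0 < K := by positivity
  have hK'p : 0 < K' := by positivity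
  set A : ℝ := K * |c| * K + 1 with hA
  have hAp : 0 < A := by positivity
  set C2 : ℝ := K * (2 * |b * c|) * K' with hC2
  set C1 : ℝ := A * (4 * (2 * A + 1)) with hC1
  have hC1p : 0 ≤ C1 := by positivity
  have hC2p : 0 ≤ C2 := by positivity
  refine ⟨2 * C1 + 2 * C2, by positivity, fun h hh v hv => ?_⟩
  have hh0 := hh.1
  set w := Dp h v with hw
  have hwd : RapidDecay w := hv.Dp h
  have hη : PolyGrowth fun m : ℤ => ((m : ℝ) * h) * jsq ((m : ℝ) * h) ^ b := by
    obtain ⟨N, C, hC⟩ := polyGrowth_jsq_zpow h (b + 1)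
    refine ⟨N, C, fun m => (le_trans ?_ (hC m))⟩
    rw [abs_mul, abs_of_pos (jsq_zpow_pos _ b), abs_of_pos (jsq_zpow_pos _ _),
      zpow_add_one₀ (jsq_pos _).ne', mul_comm]
    have := jsq_zpow_pos (m * h) b
    gcongr
    unfold jsq
    nlinarith [sq_abs (m * h), abs_nonneg ((m : ℝ) * h), sq_nonneg (|(m : ℝ) * h| - 1)]
  have hφ := hv.sq.polyGrowth_mul hη
  have hsum := hasSum_le (f := fun m : ℤ => jsq ((m : ℝ) * h) ^ b * v m ^ 2 * h)
    (fun m => ?_) (hv.hasSum_wsum h b)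
    (((hφ.hasSum_sub_shift.mul_left (K * c)).add ((hv.hasSum_wsum h b).mul_left (1 / 2))).add
      (((hwd.hasSum_wsum h (b + 1)).mul_left C1).add ((hv.hasSum_wsum h (b - 1)).mul_left C2)))
  · have h1 := wsum_nonneg hh0.le (b + 1) w
    have h2 := wsum_nonneg hh0.le (b - 1) v
    nlinarith [mul_nonneg hC1p h2, mul_nonneg hC2p h1]
  · set x := (m : ℝ) * h with hx
    have hx1' : ((m : ℝ) + 1) * h = x + h := by rw [hx]; ring
    simp only [Int.cast_add, Int.cast_one, hx1']
    obtain ⟨ξ, hξ, he⟩ := exists_step_eq_deriv (hasDerivAt_mul_jsq_zpow b) hh0 x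
    have hd : |ξ - x| ≤ 1 := by
      rw [abs_of_nonneg (by linarith [hξ.1])]; linarith [hξ.2, hh.2]
    have hd1 : |x + h - x| ≤ 1 := by
      rw [add_sub_cancel_left, abs_of_pos hh0]; exact hh.2.le
    have q1 := jsq_zpow_le (by rwa [abs_sub_comm] at hd : |x - ξ| ≤ 1) b
    have q2 := jsq_zpow_le hd (b - 1)
    have q3 := jsq_zpow_le hd1 b
    have q4 := jsq_le_mul hd1
    norm_num at q1 q2 q3 q4
    rw [← hK] at q1 q3
    rw [← hK'] at q2
    have p0 := jsq_zpow_pos x b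
    have p1 := jsq_zpow_pos ξ b
    have p2 := jsq_zpow_pos ξ (b - 1)
    have p3 := jsq_zpow_pos (x + h) b
    have hP1 : jsq x ^ (b + 1) = jsq x ^ b * jsq x := zpow_add_one₀ (jsq_pos x).ne' b
    -- lower bound for the difference of the multiplier
    have d1 : jsq x ^ b * v m ^ 2 * h ≤
        K * c * (((x + h) * jsq (x + h) ^ b - x * jsq x ^ b) * v m ^ 2)
          + C2 * (jsq x ^ (b - 1) * v m ^ 2 * h) := by
      rw [he]
      have s1 : jsq ξ ^ b ≤ c * (c * jsq ξ ^ b - 2 * b * jsq ξ ^ (b - 1))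
          + 2 * |b * c| * jsq ξ ^ (b - 1) := by
        have := mul_le_mul_of_nonneg_right (le_abs_self (b * c)) p2.le
        nlinarith
      have s2 : jsq x ^ b ≤ K * (c * (c * jsq ξ ^ b - 2 * b * jsq ξ ^ (b - 1)))
          + C2 * jsq x ^ (b - 1) := by
        have t1 := mul_le_mul_of_nonneg_left s1 hKp.le
        have t2 := mul_le_mul_of_nonneg_left q2 (by positivity : 0 ≤ K * (2 * |b * c|))
        rw [hC2]
        linarith
      have s3 := mul_le_mul_of_nonneg_right s2 (by positivity : 0 ≤ v m ^ 2 * h)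
      linarith
    have hv1 : v (m + 1) = v m + h * w m := eq_add_mul_Dp hh0 v m
    -- the remaining part of the difference
    have d2 : |K * c * ((x + h) * jsq (x + h) ^ b * (w m * (2 * v m + h * w m)))| ≤
        1 / 2 * (jsq x ^ b * v m ^ 2) + C1 * (jsq x ^ (b + 1) * w m ^ 2) := by
      have r1 := abs_mul_sq_step_le hh (x + h) (v m) (w m) hAp
      have r2 : K * c * ((x + h) * jsq (x + h) ^ b * (w m * (2 * v m + h * w m)))
          = (K * c * jsq (x + h) ^ b) * ((x + h) * (w m * (2 * v m + h * w m))) := by ring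
      have r3 : |K * c * jsq (x + h) ^ b| ≤ A * jsq x ^ b := by
        rw [abs_mul, abs_mul, abs_of_pos hKp, abs_of_pos p3]
        have := mul_le_mul_of_nonneg_left q3 (by positivity : 0 ≤ K * |c|)
        rw [hA]; nlinarith
      rw [r2, abs_mul]
      have r4 : 1 / (2 * A) * v m ^ 2 + (2 * A + 1) * (jsq (x + h) * w m ^ 2) ≤
          1 / (2 * A) * v m ^ 2 + (2 * A + 1) * (4 * jsq x * w m ^ 2) := by gcongr
      refine (mul_le_mul r3 (r1.trans r4) (abs_nonneg _) (by positivity)).trans (le_of_eq ?_)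
      rw [hP1, hC1]
      have hA1 : A * (1 / (2 * A)) = 1 / 2 := by rw [one_div, mul_inv]; field_simp
      linear_combination (jsq x ^ b * v m ^ 2) * hA1
    have d3 := mul_le_mul_of_nonneg_right ((neg_abs_le _).trans' (neg_le_neg d2)) hh0.le
    rw [hv1]
    have e : K * c * ((x + h) * jsq (x + h) ^ b * (v m + h * w m) ^ 2 - x * jsq x ^ b * v m ^ 2) =
        K * c * (((x + h) * jsq (x + h) ^ b - x * jsq x ^ b) * v m ^ 2) +
          K * c * ((x + h) * jsq (x + h) ^ b * (w m * (2 * v m + h * w m))) * h := by ring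
    rw [e]
    clear_value K K' A C1 C2 c w x
    linarith

lemma exists_wsum_le_top (b : ℤ) (n : ℕ) : ∃ C ≥ 0, ∀ h ∈ Set.Ioo (0 : ℝ) 1,
    ∀ v, RapidDecay v →
      wsum h b v ≤ C * (wsum h (b + n) ((Dp h)^[n] v) + wsum h (b - 1) v) := by
  induction n with
  | zero =>
    refine ⟨1, zero_le_one, fun h hh v hv => ?_⟩
    have := wsum_nonneg hh.1.le (b - 1) v
    simp only [Nat.cast_zero, add_zero, Function.iterate_zero, id_eq, one_mul]
    linarith
  | succ n ih =>
    obtain ⟨C, hC, h1⟩ := ih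
    obtain ⟨C', hC', h2⟩ := exists_wsum_hardy (b + n)
    obtain ⟨Cint, hCint, h3⟩ := exists_wsum_interpolate (b - 1) (n + 1)
    refine ⟨C * (C' * (1 + Cint)) + C, by positivity, fun h hh v hv => ?_⟩
    have e1 := h1 h hh v hv
    have e2 := h2 h hh _ (hv.iterate_Dp h n)
    have e3 := h3 h hh v hv n (by omega)
    have w1 : b + n + 1 = b + (n + 1 : ℕ) := by push_cast; ring
    have w2 : b + n - 1 = b - 1 + n := by ring
    rw [← Function.iterate_succ_apply' (Dp h) n v, w1, w2] at e2
    have e4 := wsum_mono_weight hh.1.le (by omega : b - 1 + (n + 1 : ℕ) ≤ b + (n + 1 : ℕ))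
      (hv.iterate_Dp h (n + 1))
    set X := wsum h (b + (n + 1 : ℕ)) ((Dp h)^[n + 1] v)
    set Y := wsum h (b - 1) v
    have hX : 0 ≤ X := wsum_nonneg hh.1.le _ _
    have hY : 0 ≤ Y := wsum_nonneg hh.1.le _ _
    have e5 : wsum h (b - 1 + n) ((Dp h)^[n] v) ≤ Cint * (Y + X) := e3.trans (by gcongr)
    calc wsum h b v ≤ C * (C' * (X + Cint * (Y + X)) + Y) := e1.trans (by
          gcongr; exact e2.trans (by gcongr))
      _ ≤ C * (C' * (1 + Cint) * (X + Y) + (X + Y)) := by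
          gcongr C * ?_
          nlinarith [mul_nonneg hC' hX, mul_nonneg hC' hY]
      _ = _ := by ring

/-- The compactly supported Lipschitz cut-off used for local masses. -/
def tent (r x : ℝ) : ℝ := max 0 (r + 1 - |x|)

lemma tent_nonneg (r x : ℝ) : 0 ≤ tent r x := le_max_left _ _

lemma tent_lipschitz (r x y : ℝ) : |tent r x - tent r y| ≤ |x - y| := by
  unfold tent
  have h1 := abs_max_sub_max_le_max (0 : ℝ) (r + 1 - |x|) 0 (r + 1 - |y|)
  refine h1.trans ?_
  rw [sub_zero, abs_zero]
  refine max_le (abs_nonneg _) ?_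
  have : r + 1 - |x| - (r + 1 - |y|) = |y| - |x| := by ring
  rw [this, abs_sub_comm x y]
  exact abs_abs_sub_abs_le_abs_sub y x

lemma tent_eq_zero {r x : ℝ} (hx : r + 1 ≤ |x|) : tent r x = 0 := max_eq_left (by linarith)

lemma one_le_tent {r x : ℝ} (hx : |x| ≤ r) : 1 ≤ tent r x :=
  le_trans (by linarith) (le_max_right _ _)

lemma tent_le {r : ℝ} (hr : 0 ≤ r) (x : ℝ) : tent r x ≤ r + 1 :=
  max_le (by linarith) (by linarith [abs_nonneg x])

lemma polyGrowth_tent {r : ℝ} (hr : 0 ≤ r) (h : ℝ) : PolyGrowth fun m : ℤ => tent r ((m : ℝ) * h) :=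
  .of_bounded (C := r + 1) fun m => by
    rw [abs_of_nonneg (tent_nonneg _ _)]; exact tent_le hr _

/-- The local mass `∑ χ |v|² h`. -/
def lmass (h r : ℝ) (v : ℤ → ℝ) : ℝ := ∑' m : ℤ, tent r ((m : ℝ) * h) * v m ^ 2 * h

lemma RapidDecay.hasSum_lmass {v : ℤ → ℝ} (hv : RapidDecay v) {r : ℝ} (hr : 0 ≤ r) (h : ℝ) :
    HasSum (fun m : ℤ => tent r ((m : ℝ) * h) * v m ^ 2 * h) (lmass h r v) :=
  ((hv.sq.polyGrowth_mul (polyGrowth_tent hr h)).mul_const h).summable.hasSum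

lemma lmass_nonneg {h : ℝ} (hh : 0 ≤ h) (r : ℝ) (v : ℤ → ℝ) : 0 ≤ lmass h r v :=
  tsum_nonneg fun m => by have := tent_nonneg r (m * h); positivity

lemma exists_wsum_sub_one_le (b : ℤ) {δ : ℝ} (hδ : 0 < δ) : ∃ r ≥ 0, ∃ C ≥ 0,
    ∀ h ∈ Set.Ioo (0 : ℝ) 1, ∀ v, RapidDecay v →
      wsum h (b - 1) v ≤ δ * wsum h b v + C * lmass h r v := by
  refine ⟨1 / δ + 1, by positivity, (jsq (1 / δ + 1)) ^ (b - 1).natAbs,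
    by have := jsq_pos (1 / δ + 1); positivity, fun h hh v hv => ?_⟩
  refine hasSum_le (fun m => ?_) (hv.hasSum_wsum h (b - 1))
    (((hv.hasSum_wsum h b).mul_left δ).add
      ((hv.hasSum_lmass (by positivity : 0 ≤ 1 / δ + 1) h).mul_left _))
  have hh0 := hh.1
  set x := (m : ℝ) * h
  have p := jsq_pos x
  have pb := jsq_zpow_pos x b
  have pb1 := jsq_zpow_pos x (b - 1)
  have hb : jsq x ^ b = jsq x ^ (b - 1) * jsq x := by
    rw [← zpow_add_one₀ p.ne']; congr 1; ring
  rcases le_total (1 / δ) |x| with hx | hx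
  · have h1 : 1 ≤ δ * jsq x := by
      have : 1 ≤ δ * |x| := by rwa [div_le_iff₀' hδ] at hx
      have : |x| ≤ jsq x := by
        unfold jsq; nlinarith [sq_abs x, abs_nonneg x, sq_nonneg (|x| - 1)]
      nlinarith
    have h2 : jsq x ^ (b - 1) * v m ^ 2 * h ≤ δ * (jsq x ^ b * v m ^ 2 * h) := by
      rw [hb]
      have := mul_le_mul_of_nonneg_left h1 (by positivity : 0 ≤ jsq x ^ (b - 1) * v m ^ 2 * h)
      linarith
    have := tent_nonneg (1 / δ + 1) x
    have := jsq_pos (1 / δ + 1)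
    have : 0 ≤ jsq (1 / δ + 1) ^ (b - 1).natAbs * (tent (1 / δ + 1) x * v m ^ 2 * h) := by
      positivity
    linarith
  · have h1 : 1 ≤ tent (1 / δ + 1) x := one_le_tent (by linarith)
    have h2 : jsq x ^ (b - 1) ≤ jsq (1 / δ + 1) ^ (b - 1).natAbs := by
      have h3 : jsq x ≤ jsq (1 / δ + 1) := by
        unfold jsq; rw [← sq_abs x]; gcongr; linarith
      calc jsq x ^ (b - 1) ≤ jsq x ^ ((b - 1).natAbs : ℤ) :=
            zpow_le_zpow_right₀ (one_le_jsq x) (Int.le_natAbs)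
        _ = jsq x ^ (b - 1).natAbs := zpow_natCast _ _
        _ ≤ _ := pow_le_pow_left₀ p.le h3 _
    have h4 : 0 ≤ δ * (jsq x ^ b * v m ^ 2 * h) := by positivity
    have h5 : jsq x ^ (b - 1) * v m ^ 2 * h ≤
        jsq (1 / δ + 1) ^ (b - 1).natAbs * (tent (1 / δ + 1) x * v m ^ 2 * h) := by
      have := jsq_pos (1 / δ + 1)
      calc _ ≤ jsq (1 / δ + 1) ^ (b - 1).natAbs * (v m ^ 2 * h) := by
            rw [mul_assoc]; gcongr
        _ ≤ _ := by
            gcongr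
            exact le_mul_of_one_le_left (sq_nonneg _) h1
    linarith

/-- All scale-invariant weighted norms are controlled by the top one and a local mass. -/
lemma exists_wsum_le_top_add_lmass (b : ℤ) (n : ℕ) : ∃ r ≥ 0, ∃ C ≥ 0,
    ∀ h ∈ Set.Ioo (0 : ℝ) 1, ∀ v, RapidDecay v → ∀ i ≤ n,
      wsum h (b + i) ((Dp h)^[i] v) ≤
        C * (wsum h (b + n) ((Dp h)^[n] v) + lmass h r v) := by
  obtain ⟨C, hC, h1⟩ := exists_wsum_le_top b n
  obtain ⟨C', hC', h2⟩ := exists_wsum_interpolate b n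
  obtain ⟨r, hr, Cint, hCint, h3⟩ := exists_wsum_sub_one_le b (δ := 1 / (2 * (C + 1)))
    (by positivity)
  refine ⟨r, hr, C' * (2 * C + 2 * (C * Cint) + 1), by positivity, fun h hh v hv i hi => ?_⟩
  have e1 := h1 h hh v hv
  have e2 := h2 h hh v hv i hi
  have e3 := mul_le_mul_of_nonneg_left (h3 h hh v hv) hC
  set X := wsum h (b + n) ((Dp h)^[n] v)
  set X0 := wsum h b v
  have hX : 0 ≤ X := wsum_nonneg hh.1.le _ _
  have hX0 : 0 ≤ X0 := wsum_nonneg hh.1.le _ _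
  have hY := lmass_nonneg hh.1.le r v
  have e4 : C * (1 / (2 * (C + 1))) ≤ 1 / 2 := by
    rw [mul_one_div, div_le_div_iff₀ (by positivity) (by positivity)]; linarith
  have e5 := mul_le_mul_of_nonneg_right e4 hX0
  have e6 : X0 ≤ 2 * C * X + 2 * (C * Cint) * lmass h r v := by linarith
  have e7 : X0 + X ≤ (2 * C + 2 * (C * Cint) + 1) * (X + lmass h r v) := by
    nlinarith [mul_nonneg hC hY, mul_nonneg (mul_nonneg hC hCint) hX]
  calc _ ≤ C' * (X0 + X) := e2
    _ ≤ C' * ((2 * C + 2 * (C * Cint) + 1) * (X + lmass h r v)) := by gcongr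
    _ = _ := by ring

/-- Discrete weighted Sobolev inequality. -/
lemma exists_jsq_zpow_mul_sq_le (b : ℤ) : ∃ C ≥ 0, ∀ h ∈ Set.Ioo (0 : ℝ) 1, ∀ v, RapidDecay v →
    ∀ m : ℤ, jsq ((m : ℝ) * h) ^ b * v m ^ 2 ≤ C * (wsum h b v + wsum h (b + 1) (Dp h v)) := by
  obtain ⟨C, hC, hstep⟩ := exists_jsq_zpow_step b
  set K : ℝ := 4 ^ b.natAbs with hK
  have hKp : 0 < K := by positivity
  refine ⟨1 + C + 2 * K, by positivity, fun h hh v hv m => ?_⟩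
  have hh0 := hh.1
  set w := Dp h v with hw
  have hwd : RapidDecay w := hv.Dp h
  have hφ : RapidDecay fun m => jsq ((m : ℝ) * h) ^ b * v m ^ 2 := hv.sq.jsq_mul h b
  refine (hφ.le_tsum_abs_sub m).trans ?_
  refine hasSum_le (fun l => ?_) ((hφ.shift 1).sub hφ).abs.summable.hasSum
    (((hv.hasSum_wsum h b).add (hwd.hasSum_wsum h (b + 1))).mul_left _)
  set x := (l : ℝ) * h with hx
  have hx1' : ((l : ℝ) + 1) * h = x + h := by rw [hx]; ring
  simp only [Int.cast_add, Int.cast_one, hx1']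
  have hv1 : v (l + 1) = v l + h * w l := eq_add_mul_Dp hh0 v l
  have e1 := hstep h hh x (v l) (v l) 1 one_pos
  have q3 := jsq_zpow_le (y := x + h) (x := x) (c := 1) (by
    rw [add_sub_cancel_left, abs_of_pos hh0]; exact hh.2.le) b
  norm_num at q3
  rw [← hK] at q3
  have o := one_le_jsq x
  have le1 : jsq x ^ (b - 1) ≤ jsq x ^ b := zpow_le_zpow_right₀ o (by omega)
  have le2 : jsq x ^ b ≤ jsq x ^ (b + 1) := zpow_le_zpow_right₀ o (by omega)
  have p0 := jsq_zpow_pos x b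
  have p3 := jsq_zpow_pos (x + h) b
  have e2 : |jsq (x + h) ^ b * (w l * (2 * v l + h * w l))| ≤
      2 * K * (jsq x ^ b * v l ^ 2 + jsq x ^ (b + 1) * w l ^ 2) := by
    rw [abs_mul, abs_of_pos p3]
    have a : |w l * (2 * v l + h * w l)| ≤ 2 * (v l ^ 2 + w l ^ 2) := by
      have hw2 : h * w l ^ 2 ≤ w l ^ 2 := mul_le_of_le_one_left (sq_nonneg _) hh.2.le
      have hw3 : 0 ≤ h * w l ^ 2 := by positivity
      rw [abs_le]
      constructor <;> nlinarith [sq_nonneg (w l - v l), sq_nonneg (w l + v l)]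
    calc _ ≤ (K * jsq x ^ b) * (2 * (v l ^ 2 + w l ^ 2)) := by gcongr
      _ = 2 * K * (jsq x ^ b * v l ^ 2 + jsq x ^ b * w l ^ 2) := by ring
      _ ≤ _ := by gcongr
  have e3 : jsq (x + h) ^ b * v (l + 1) ^ 2 - jsq x ^ b * v l ^ 2 =
      (jsq (x + h) ^ b - jsq x ^ b) * v l * v l +
        h * (jsq (x + h) ^ b * (w l * (2 * v l + h * w l))) := by rw [hv1]; ring
  rw [e3]
  refine (abs_add_le _ _).trans ?_
  rw [abs_mul h, abs_of_pos hh0]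
  have e4 : C / 1 * (jsq x ^ (b - 1) * v l ^ 2) ≤ C * (jsq x ^ b * v l ^ 2) := by
    rw [div_one]; gcongr
  have z1 : 0 ≤ jsq x ^ (b + 1) * w l ^ 2 := by have := jsq_zpow_pos x (b + 1); positivity
  calc _ ≤ h * (1 * (jsq x ^ b * v l ^ 2) + C * (jsq x ^ b * v l ^ 2)) +
        h * (2 * K * (jsq x ^ b * v l ^ 2 + jsq x ^ (b + 1) * w l ^ 2)) := by
        refine add_le_add (e1.trans ?_) ?_ <;> gcongr
    _ ≤ (1 + C + 2 * K) * (jsq x ^ b * v l ^ 2 * h + jsq x ^ (b + 1) * w l ^ 2 * h) := by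
        have := mul_nonneg (mul_nonneg (by positivity : 0 ≤ 1 + C) z1) hh0.le
        nlinarith

lemma wsum_mul_le {h : ℝ} (hh : 0 ≤ h) (b s : ℤ) {c : ℝ} {φ v : ℤ → ℝ}
    (hφ : ∀ m : ℤ, φ m ^ 2 ≤ c * jsq ((m : ℝ) * h) ^ (-s)) (hφv : RapidDecay fun m => φ m * v m)
    (hv : RapidDecay v) :
    wsum h b (fun m => φ m * v m) ≤ c * wsum h (b - s) v := by
  refine hasSum_le (fun m => ?_) (hφv.hasSum_wsum h b) ((hv.hasSum_wsum h (b - s)).mul_left c)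
  have p := jsq_zpow_pos (m * h) b
  have e : jsq ((m : ℝ) * h) ^ (b - s) = jsq (m * h) ^ b * jsq (m * h) ^ (-s) := by
    rw [← zpow_add₀ (jsq_pos _).ne']; congr 1
  rw [e, mul_pow]
  calc _ ≤ jsq (m * h) ^ b * ((c * jsq (m * h) ^ (-s)) * v m ^ 2) * h := by gcongr; exact hφ m
    _ = _ := by ring

lemma Dp_mul (h : ℝ) (φ v : ℤ → ℝ) :
    Dp h (fun m => φ m * v m) = fun m => Dp h φ m * v (m + 1) + φ m * Dp h v m := by
  ext m; simp only [Dp]; ring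

lemma polyGrowth_of_sq_le {h : ℝ} {φ : ℤ → ℝ} {c : ℝ} {s : ℤ}
    (hφ : ∀ m : ℤ, φ m ^ 2 ≤ c * jsq ((m : ℝ) * h) ^ s) : PolyGrowth φ := by
  obtain ⟨N, C, hC⟩ := polyGrowth_jsq_zpow h s
  refine ⟨N, 1 + |c| * |C|, fun m => ?_⟩
  have h1 : φ m ^ 2 ≤ |c| * (|C| * (1 + |(m : ℝ)|) ^ N) := by
    refine (hφ m).trans (mul_le_mul (le_abs_self c) ?_ (jsq_zpow_pos _ _).le (abs_nonneg _))
    exact (le_abs_self _).trans ((hC m).trans (by gcongr; exact le_abs_self C))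
  have h2 : 1 ≤ (1 + |(m : ℝ)|) ^ N := one_le_pow₀ (by linarith [abs_nonneg (m : ℝ)])
  have h3 : |φ m| ≤ 1 + φ m ^ 2 := by
    nlinarith [sq_abs (φ m), sq_nonneg (|φ m| - 1), abs_nonneg (φ m)]
  rw [add_mul]
  nlinarith

/-- Multiplication by a symbol of order `-s` in the scale of weighted norms. -/
lemma exists_wsum_iterate_Dp_mul_le (n : ℕ) (b s : ℤ) (c : ℝ) : ∃ C ≥ 0,
    ∀ h ∈ Set.Ioo (0 : ℝ) 1, ∀ φ v : ℤ → ℝ,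
      (∀ i ≤ n, ∀ m : ℤ, (Dp h)^[i] φ m ^ 2 ≤ c * jsq ((m : ℝ) * h) ^ (-(s + i))) →
      RapidDecay v →
      wsum h (b + n) ((Dp h)^[n] fun m => φ m * v m) ≤
        C * ∑ i ∈ Finset.range (n + 1), wsum h (b - s + i) ((Dp h)^[i] v) := by
  induction n generalizing b s with
  | zero =>
    refine ⟨|c|, abs_nonneg c, fun h hh φ v hφ hv => ?_⟩
    have h0 : ∀ m : ℤ, φ m ^ 2 ≤ c * jsq ((m : ℝ) * h) ^ (-s) := by
      simpa using hφ 0 le_rfl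
    have := wsum_mul_le hh.1.le b s h0 (hv.polyGrowth_mul (polyGrowth_of_sq_le h0)) hv
    have h2 := wsum_nonneg hh.1.le (b - s) v
    simp only [Nat.cast_zero, add_zero, Function.iterate_zero, id_eq, zero_add,
      Finset.range_one, Finset.sum_singleton]
    exact this.trans (mul_le_mul_of_nonneg_right (le_abs_self c) h2)
  | succ n ih =>
    obtain ⟨C1, hC1, h1⟩ := ih (b + 1) (s + 1)
    obtain ⟨C2, hC2, h2⟩ := ih (b + 1) s
    set K : ℝ := ∑ i ∈ Finset.range (n + 1), 4 ^ (b - s + i).natAbs with hK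
    have hKp : 0 ≤ K := by positivity
    refine ⟨2 * C1 * K + 2 * C2, by positivity, fun h hh φ v hφ hv => ?_⟩
    have hφ0 : PolyGrowth φ := polyGrowth_of_sq_le (hφ 0 (by omega))
    have hφ1 : PolyGrowth (Dp h φ) := polyGrowth_of_sq_le (hφ 1 (by omega))
    rw [Function.iterate_succ_apply, Dp_mul, iterate_Dp_add]
    have a1 := h1 h hh (Dp h φ) (fun m => v (m + 1)) (fun i hi m => by
      have := hφ (i + 1) (by omega) m
      rw [Function.iterate_succ_apply] at this
      convert this using 3
      push_cast; ring) (hv.shift 1)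
    have a2 := h2 h hh φ (Dp h v) (fun i hi m => hφ i (by omega) m) (hv.Dp h)
    have w1 : b + (n + 1 : ℕ) = b + 1 + n := by push_cast; ring
    rw [w1]
    have a3 := wsum_add_le hh.1.le (b + 1 + n)
      (((hv.shift 1).polyGrowth_mul hφ1).iterate_Dp h n)
      (((hv.Dp h).polyGrowth_mul hφ0).iterate_Dp h n)
    refine a3.trans ?_
    set S := ∑ i ∈ Finset.range (n + 1 + 1), wsum h (b - s + i) ((Dp h)^[i] v) with hS
    have hnn : ∀ i : ℕ, 0 ≤ wsum h (b - s + i) ((Dp h)^[i] v) := fun i => wsum_nonneg hh.1.le _ _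
    have b1 : ∑ i ∈ Finset.range (n + 1), wsum h (b + 1 - (s + 1) + i) ((Dp h)^[i] fun m => v (m + 1))
        ≤ K * S := by
      rw [hK, Finset.sum_mul]
      refine Finset.sum_le_sum fun i hi => ?_
      have e : b + 1 - (s + 1) + (i : ℤ) = b - s + i := by ring
      rw [iterate_Dp_shift, e]
      refine (wsum_shift_le hh _ (hv.iterate_Dp h i)).trans ?_
      gcongr
      exact Finset.single_le_sum (f := fun i : ℕ => wsum h (b - s + i) ((Dp h)^[i] v))
        (fun i _ => hnn i) (Finset.mem_range.2 (by have := Finset.mem_range.1 hi; omega))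
    have b2 : ∑ i ∈ Finset.range (n + 1), wsum h (b + 1 - s + i) ((Dp h)^[i] (Dp h v)) ≤ S := by
      rw [hS, Finset.sum_range_succ' _ (n + 1)]
      have : ∀ i : ℕ, wsum h (b + 1 - s + i) ((Dp h)^[i] (Dp h v))
          = wsum h (b - s + (i + 1 : ℕ)) ((Dp h)^[i + 1] v) := fun i => by
        rw [Function.iterate_succ_apply]; congr 1; push_cast; ring
      simp only [this]
      have := hnn 0
      linarith
    have c1 := a1.trans (mul_le_mul_of_nonneg_left b1 hC1)
    have c2 := a2.trans (mul_le_mul_of_nonneg_left b2 hC2)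
    linarith

lemma exists_iterate_Dp_mesh_eq {h : ℝ} (hh : 0 < h) (n : ℕ) {F : ℝ → ℝ}
    (hF : ∀ i : ℕ, ContDiff ℝ i F) (m : ℤ) :
    ∃ ξ, |ξ - m * h| ≤ n * h ∧
      (Dp h)^[n] (fun m : ℤ => F ((m : ℝ) * h)) m = iteratedDeriv n F ξ := by
  induction n generalizing F with
  | zero => exact ⟨m * h, by simp, by simp⟩
  | succ n ih =>
    set G : ℝ → ℝ := fun x => (F (x + h) - F x) / h with hG
    have hFs : ∀ i : ℕ, ContDiff ℝ i fun x => F (x + h) := fun i =>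
      (hF i).comp (contDiff_id.add contDiff_const)
    have e : Dp h (fun m : ℤ => F ((m : ℝ) * h)) = fun m : ℤ => G ((m : ℝ) * h) := by
      ext m
      simp only [Dp, hG, Int.cast_add, Int.cast_one, add_mul, one_mul]
    obtain ⟨ξ, h1, h2⟩ := ih (F := G) fun i => ((hFs i).sub (hF i)).div_const h
    have h3 : iteratedDeriv n G ξ = (iteratedDeriv n F (ξ + h) - iteratedDeriv n F ξ) / h := by
      rw [hG, iteratedDeriv_div_const (fun x => F (x + h) - F x) h,
        iteratedDeriv_fun_sub (hFs n).contDiffAt (hF n).contDiffAt, iteratedDeriv_comp_add_const]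
    have hd : ∀ x, HasDerivAt (iteratedDeriv n F) (iteratedDeriv (n + 1) F x) x := fun x => by
      rw [iteratedDeriv_succ]
      exact ((hF (n + 1)).differentiable_iteratedDeriv n (by exact_mod_cast n.lt_succ_self)
        x).hasDerivAt
    obtain ⟨ζ, h4, h5⟩ := exists_step_eq_deriv hd hh ξ
    refine ⟨ζ, ?_, ?_⟩
    · rw [abs_le] at h1 ⊢
      push_cast
      constructor <;> linarith [h4.1, h4.2, h1.1, h1.2]
    · rw [Function.iterate_succ_apply, e, h2, h3, h5]
      field_simp

lemma sq_iterate_Dp_mesh_le {h : ℝ} (hh : h ∈ Set.Ioo (0 : ℝ) 1) (n : ℕ) {F : ℝ → ℝ}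
    (hF : ∀ i : ℕ, ContDiff ℝ i F) {C : ℝ} (hC : 0 ≤ C) {s : ℤ}
    (hb : ∀ x, iteratedDeriv n F x ^ 2 ≤ C * jsq x ^ s) (m : ℤ) :
    (Dp h)^[n] (fun m : ℤ => F ((m : ℝ) * h)) m ^ 2 ≤
      C * (2 + 2 * (n : ℝ) ^ 2) ^ s.natAbs * jsq ((m : ℝ) * h) ^ s := by
  obtain ⟨ξ, h1, h2⟩ := exists_iterate_Dp_mesh_eq hh.1 n hF m
  rw [h2, mul_assoc]
  refine (hb ξ).trans (mul_le_mul_of_nonneg_left (jsq_zpow_le (h1.trans ?_) s) hC)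
  exact mul_le_of_le_one_right n.cast_nonneg hh.2.le

lemma sq_le_of_abs_le_jb_rpow {x y C : ℝ} {N : ℕ} (hy : |y| ≤ C * jb x ^ (-(N : ℝ))) :
    y ^ 2 ≤ C ^ 2 * jsq x ^ (-(N : ℤ)) := by
  rw [Real.rpow_neg (jb_pos x).le, Real.rpow_natCast] at hy
  rw [zpow_neg, zpow_natCast, ← jb_sq, ← sq_abs y]
  calc |y| ^ 2 ≤ (C * (jb x ^ N)⁻¹) ^ 2 := by gcongr
    _ = _ := by rw [mul_pow, inv_pow, ← pow_mul, ← pow_mul, mul_comm N 2]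

lemma one_add_abs_le_jb (x : ℝ) : 1 + |x| ≤ 2 * jb x := by
  have h1 := jb_sq x
  have h2 := jb_pos x
  unfold jsq at h1
  have h3 : |x| ≤ jb x := abs_le_of_sq_le_sq (by linarith) h2.le
  have h4 : 1 ≤ jb x := by nlinarith [sq_nonneg x]
  linarith

lemma jb_le_one_add_abs (x : ℝ) : jb x ≤ 1 + |x| := by
  unfold jb
  rw [Real.sqrt_le_left (by positivity)]
  nlinarith [sq_abs x, abs_nonneg x]

lemma rapidDecay_mesh {h : ℝ} (hh : 0 < h) {F : ℝ → ℝ}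
    (hF : ∀ N : ℕ, ∃ C, ∀ x, |F x| ≤ C * jb x ^ (-(N : ℝ))) :
    RapidDecay fun m : ℤ => F ((m : ℝ) * h) := by
  intro N
  obtain ⟨C, hC⟩ := hF N
  refine ⟨C * (2 * (1 + 1 / h)) ^ N, fun m => ?_⟩
  have h1 := one_add_abs_le_jb (m * h)
  have hj := jb_pos (m * h)
  rw [abs_mul, abs_of_pos hh] at h1
  have h2 : 1 + |(m : ℝ)| ≤ 2 * (1 + 1 / h) * jb (m * h) := by
    have : |(m : ℝ)| = 1 / h * (|(m : ℝ)| * h) := by field_simp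
    have h3 : 0 < 1 / h := by positivity
    have := abs_nonneg (m : ℝ)
    nlinarith [mul_le_mul_of_nonneg_left h1 h3.le, mul_nonneg this hh.le]
  calc |F (m * h)| * (1 + |(m : ℝ)|) ^ N
      ≤ (C * jb (m * h) ^ (-(N : ℝ))) * (2 * (1 + 1 / h) * jb (m * h)) ^ N := by
        refine mul_le_mul (hC _) (by gcongr) (by positivity) ((abs_nonneg _).trans (hC _))
    _ = C * (2 * (1 + 1 / h)) ^ N := by
        rw [Real.rpow_neg hj.le, Real.rpow_natCast, mul_pow _ (jb _)]
        field_simp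

lemma wsum_iterate_Dp_mesh_le {h : ℝ} (hh : h ∈ Set.Ioo (0 : ℝ) 1) (b : ℤ) (n : ℕ) {F : ℝ → ℝ}
    (hF : ∀ i : ℕ, ContDiff ℝ i F) {C : ℝ} (hC : 0 ≤ C)
    (hb : ∀ x, iteratedDeriv n F x ^ 2 ≤ C * jsq x ^ (-(b + 1))) :
    wsum h b ((Dp h)^[n] fun m : ℤ => F ((m : ℝ) * h)) ≤
      C * (2 + 2 * (n : ℝ) ^ 2) ^ (-(b + 1)).natAbs * 16 := by
  have hh' : h ∈ Set.Ioc (0 : ℝ) 1 := ⟨hh.1, hh.2.le⟩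
  set D := C * (2 + 2 * (n : ℝ) ^ 2) ^ (-(b + 1)).natAbs with hD
  have hs := (summable_inv_jsq hh').mul_left D
  have key : ∀ m : ℤ, jsq ((m : ℝ) * h) ^ b *
      (Dp h)^[n] (fun m : ℤ => F ((m : ℝ) * h)) m ^ 2 * h ≤ D * ((jsq ((m : ℝ) * h))⁻¹ * h) := by
    intro m
    have h1 := sq_iterate_Dp_mesh_le hh n hF hC hb m
    rw [← hD] at h1
    have p := jsq_zpow_pos (m * h) b
    rw [← mul_assoc]
    refine mul_le_mul_of_nonneg_right ((mul_le_mul_of_nonneg_left h1 p.le).trans (le_of_eq ?_))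
      hh.1.le
    rw [neg_add, zpow_add₀ (jsq_pos _).ne', zpow_neg, zpow_neg_one]
    field_simp
  refine (Summable.tsum_le_tsum key (Summable.of_nonneg_of_le (fun m => ?_) key hs) hs).trans ?_
  · have p := jsq_zpow_pos (m * h) b
    have := hh.1
    positivity
  · rw [tsum_mul_left]
    exact mul_le_mul_of_nonneg_left (tsum_inv_jsq_le hh') (by positivity)

lemma exists_schwartz_abs_le (w : SchwartzMap ℝ ℝ) (n N : ℕ) :
    ∃ C ≥ 0, ∀ x, |iteratedDeriv n w x| ≤ C * jb x ^ (-(N : ℝ)) := by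
  refine ⟨2 ^ N * ((Finset.Iic (N, n)).sup fun m => SchwartzMap.seminorm ℝ m.1 m.2) w,
    by positivity, fun x => ?_⟩
  have h2 := SchwartzMap.one_add_le_sup_seminorm_apply (𝕜 := ℝ) (m := (N, n)) le_rfl le_rfl w x
  rw [norm_iteratedFDeriv_eq_norm_iteratedDeriv, Real.norm_eq_abs, Real.norm_eq_abs] at h2
  rw [Real.rpow_neg (jb_pos x).le, Real.rpow_natCast, ← div_eq_mul_inv,
    le_div_iff₀ (pow_pos (jb_pos x) N), mul_comm]
  refine le_trans ?_ h2
  have := jb_le_one_add_abs x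
  have := (jb_pos x).le
  gcongr

lemma wnormSq_eq_wsum (h : ℝ) (N n : ℕ) (v : ℤ → ℝ) :
    wnormSq h N n v = wsum h N ((Dp h)^[n] v) := by
  unfold wnormSq wsum
  congr 1; ext m
  rw [mul_pow, ← pow_mul, mul_comm N 2, pow_mul, jb_sq, zpow_natCast]

lemma PolyGrowth.add {φ ψ : ℤ → ℝ} (hφ : PolyGrowth φ) (hψ : PolyGrowth ψ) :
    PolyGrowth fun m => φ m + ψ m := by
  obtain ⟨N, C, h1⟩ := hφ
  obtain ⟨N', C', h2⟩ := hψ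
  refine ⟨N + N', |C| + |C'|, fun m => (abs_add_le _ _).trans ?_⟩
  have p : 1 ≤ 1 + |(m : ℝ)| := by linarith [abs_nonneg (m : ℝ)]
  have e1 : (1 + |(m : ℝ)|) ^ N ≤ (1 + |(m : ℝ)|) ^ (N + N') := pow_le_pow_right₀ p (by omega)
  have e2 : (1 + |(m : ℝ)|) ^ N' ≤ (1 + |(m : ℝ)|) ^ (N + N') := pow_le_pow_right₀ p (by omega)
  rw [add_mul]
  have q1 : C * (1 + |(m : ℝ)|) ^ N ≤ |C| * (1 + |(m : ℝ)|) ^ (N + N') :=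
    mul_le_mul (le_abs_self C) e1 (by positivity) (abs_nonneg _)
  have q2 : C' * (1 + |(m : ℝ)|) ^ N' ≤ |C'| * (1 + |(m : ℝ)|) ^ (N + N') :=
    mul_le_mul (le_abs_self C') e2 (by positivity) (abs_nonneg _)
  linarith [h1 m, h2 m]

lemma PolyGrowth.mul {φ ψ : ℤ → ℝ} (hφ : PolyGrowth φ) (hψ : PolyGrowth ψ) :
    PolyGrowth fun m => φ m * ψ m := by
  obtain ⟨N, C, h1⟩ := hφ
  obtain ⟨N', C', h2⟩ := hψ
  refine ⟨N + N', C * C', fun m => ?_⟩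
  rw [abs_mul, pow_add]
  calc |φ m| * |ψ m| ≤ (C * (1 + |(m : ℝ)|) ^ N) * (C' * (1 + |(m : ℝ)|) ^ N') :=
        mul_le_mul (h1 m) (h2 m) (abs_nonneg _) ((abs_nonneg _).trans (h1 m))
    _ = _ := by ring

lemma polyGrowth_const (c : ℝ) : PolyGrowth fun _ => c := .of_bounded (C := |c|) fun _ => le_rfl

lemma exists_one_add_inv_pow_mul_lt {κ lam : ℝ} (hκ : 2 * lam < κ) (N : ℕ) :
    ∃ A ≥ (1 : ℝ), 2 * lam * (1 + A⁻¹) ^ N < κ := by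
  have h1 : Filter.Tendsto (fun A : ℝ => 2 * lam * (1 + A⁻¹) ^ N) Filter.atTop
      (nhds (2 * lam * (1 + 0) ^ N)) :=
    ((tendsto_inv_atTop_zero.const_add 1).pow N).const_mul _
  rw [add_zero, one_pow, mul_one] at h1
  obtain ⟨A, h2, h3⟩ := ((h1.eventually (gt_mem_nhds hκ)).and
    (Filter.eventually_ge_atTop 1)).exists
  exact ⟨A, h3, h2⟩

/-- A bounded solution of a strictly diagonally dominant three-term inequality with rapidly
decaying data decays rapidly. -/
lemma rapidDecay_of_three_term {b φ : ℤ → ℝ} {B κ lam : ℝ} (hlam : 0 ≤ lam) (hκ : 2 * lam < κ)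
    (hb0 : ∀ m, 0 ≤ b m) (hB : ∀ m, b m ≤ B) (hφ : RapidDecay φ)
    (h : ∀ m, κ * b m ≤ φ m + lam * (b (m + 1) + b (m - 1))) : RapidDecay b := by
  intro N
  obtain ⟨A, hA1, hA⟩ := exists_one_add_inv_pow_mul_lt hκ N
  have hA0 : 0 < A := by linarith
  have hκ0 : 0 < κ := by linarith
  obtain ⟨C, hC⟩ := hφ N
  have hC0 : 0 ≤ C := le_trans (by positivity) (hC 0)
  set θ : ℝ := (1 + A⁻¹) ^ N with hθ
  set E : ℤ → ℝ := fun m => (A + |(m : ℝ)|) ^ N with hE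
  have hEp : ∀ m, 0 < E m := fun m => by positivity
  have hEs : ∀ m m' : ℤ, |(m : ℝ) - m'| ≤ 1 → (E m')⁻¹ ≤ θ * (E m)⁻¹ := by
    intro m m' hm
    rw [← div_eq_mul_inv, inv_le_comm₀ (hEp _) (by have := hEp m; positivity), inv_div,
      div_le_iff₀ (by positivity), ← mul_pow]
    refine pow_le_pow_left₀ (by positivity) ?_ N
    have h1 : |(m : ℝ)| ≤ |(m' : ℝ)| + 1 := by
      have := abs_add_le ((m : ℝ) - m') m'
      rw [sub_add_cancel] at this; linarith
    have h2 : 0 ≤ |(m' : ℝ)| * A⁻¹ := by positivity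
    have h3 : A * A⁻¹ = 1 := mul_inv_cancel₀ hA0.ne'
    nlinarith
  have hφE : ∀ m, φ m ≤ C * A ^ N * (E m)⁻¹ := by
    intro m
    rw [← div_eq_mul_inv, le_div_iff₀ (hEp m)]
    have h1 : E m ≤ (A * (1 + |(m : ℝ)|)) ^ N :=
      pow_le_pow_left₀ (by positivity) (by nlinarith [abs_nonneg (m : ℝ)]) N
    calc φ m * E m ≤ |φ m| * (A * (1 + |(m : ℝ)|)) ^ N :=
          mul_le_mul (le_abs_self _) h1 (hEp m).le (abs_nonneg _)
      _ = (|φ m| * (1 + |(m : ℝ)|) ^ N) * A ^ N := by rw [mul_pow]; ring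
      _ ≤ C * A ^ N := by gcongr; exact hC m
  set D := C * A ^ N / (κ - 2 * lam * θ) with hD
  have hden : 0 < κ - 2 * lam * θ := by linarith
  have hDp : 0 ≤ D := by positivity
  have hDe : C * A ^ N + 2 * lam * θ * D = κ * D := by
    have : D * (κ - 2 * lam * θ) = C * A ^ N := div_mul_cancel₀ _ hden.ne'
    linarith
  set q := 2 * lam / κ with hq
  have hq0 : 0 ≤ q := by positivity
  have hq1 : q < 1 := by rw [hq, div_lt_one hκ0]; exact hκ
  have hqκ : q * κ = 2 * lam := div_mul_cancel₀ _ hκ0.ne'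
  have key : ∀ l : ℕ, ∀ m, b m ≤ D * (E m)⁻¹ + q ^ l * B := by
    intro l
    induction l with
    | zero =>
      intro m
      have := mul_nonneg hDp (inv_pos.2 (hEp m)).le
      simpa using (hB m).trans (by linarith)
    | succ l ih =>
      intro m
      have i1 := ih (m + 1)
      have i2 := ih (m - 1)
      have j1 := mul_le_mul_of_nonneg_left (hEs m (m + 1) (by push_cast; norm_num)) hDp
      have j2 := mul_le_mul_of_nonneg_left (hEs m (m - 1) (by push_cast; norm_num)) hDp
      have s : b (m + 1) + b (m - 1) ≤ 2 * (θ * D * (E m)⁻¹) + 2 * (q ^ l * B) := by linarith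
      have s' := mul_le_mul_of_nonneg_left s hlam
      have e : κ * (D * (E m)⁻¹ + q ^ (l + 1) * B) =
          (C * A ^ N + 2 * lam * θ * D) * (E m)⁻¹ + q ^ l * B * (2 * lam) := by
        rw [hDe, ← hqκ]; ring
      refine le_of_mul_le_mul_left ?_ hκ0
      rw [e]
      linarith [h m, hφE m]
  have lim : ∀ m, b m ≤ D * (E m)⁻¹ := by
    intro m
    have t : Filter.Tendsto (fun l : ℕ => D * (E m)⁻¹ + q ^ l * B) Filter.atTop
        (nhds (D * (E m)⁻¹ + 0 * B)) :=
      ((tendsto_pow_atTop_nhds_zero_of_lt_one hq0 hq1).mul_const B).const_add _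
    rw [zero_mul, add_zero] at t
    exact ge_of_tendsto' t fun l => key l m
  refine ⟨D, fun m => ?_⟩
  rw [abs_of_nonneg (hb0 m)]
  have h1 : (1 + |(m : ℝ)|) ^ N ≤ E m := pow_le_pow_left₀ (by positivity) (by linarith) N
  calc b m * (1 + |(m : ℝ)|) ^ N ≤ (D * (E m)⁻¹) * E m :=
        mul_le_mul (lim m) h1 (by positivity) ((hb0 m).trans (lim m))
    _ = D := by rw [mul_assoc, inv_mul_cancel₀ (hEp m).ne', mul_one]

lemma Dp_Dm_eq {h : ℝ} (hh : 0 < h) (v : ℤ → ℝ) (m : ℤ) :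
    Dp h (Dm h v) m = (v (m + 1) - 2 * v m + v (m - 1)) / h ^ 2 := by
  simp only [Dp, Dm, add_sub_cancel_right]
  field_simp
  ring

lemma rapidDecay_of_resolvent {h k : ℝ} (hh : 0 < h) (hk : 0 < k) {A B Φ Ψ : ℤ → ℝ} {K : ℝ}
    (hA : ∀ m, |A m| ≤ K) (hB : ∀ m, |B m| ≤ K) (hΦ : RapidDecay Φ) (hΨ : RapidDecay Ψ)
    (h1 : ∀ m, A m + k * Dp h (Dm h B) m = Φ m) (h2 : ∀ m, B m - k * Dp h (Dm h A) m = Ψ m) :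
    RapidDecay A ∧ RapidDecay B := by
  set lam := k / h ^ 2 with hlam
  have hl0 : 0 < lam := by positivity
  set z : ℤ → ℂ := fun m => ⟨A m, B m⟩ with hz
  have hκ : 2 * lam < ‖(⟨1, 2 * lam⟩ : ℂ)‖ := by
    exact (abs_of_pos (by positivity : 0 < 2 * lam)).symm.trans_lt
      (Complex.abs_im_lt_norm (z := ⟨1, 2 * lam⟩).2 one_ne_zero)
  have hzd : RapidDecay fun m => ‖z m‖ := by
    refine rapidDecay_of_three_term hl0.le hκ (fun m => norm_nonneg _)
      (B := K + K) (fun m => ?_) (hΦ.abs.add hΨ.abs) (fun m => ?_)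
    · exact (Complex.norm_le_abs_re_add_abs_im _).trans (add_le_add (hA m) (hB m))
    · have e : (⟨1, 2 * lam⟩ : ℂ) * z m =
          ⟨Φ m, Ψ m⟩ + ⟨0, lam⟩ * (z (m + 1) + z (m - 1)) := by
        have a1 := h1 m
        have a2 := h2 m
        rw [Dp_Dm_eq hh, mul_div_assoc', mul_comm k, mul_div_assoc, ← hlam] at a1 a2
        apply Complex.ext
        · simp only [hz, Complex.mul_re, Complex.add_re, Complex.add_im]; linarith
        · simp only [hz, Complex.mul_im, Complex.add_re, Complex.add_im]; linarith
      rw [← norm_mul, e]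
      refine (norm_add_le _ _).trans (add_le_add (Complex.norm_le_abs_re_add_abs_im _) ?_)
      rw [norm_mul]
      have : ‖(⟨0, lam⟩ : ℂ)‖ ≤ lam := by
        refine (Complex.norm_le_abs_re_add_abs_im _).trans ?_
        simp [abs_of_pos hl0]
      exact mul_le_mul this (norm_add_le _ _) (norm_nonneg _) hl0.le
  exact ⟨hzd.mono fun m => (Complex.abs_re_le_norm (z m)).trans (le_abs_self _),
    hzd.mono fun m => (Complex.abs_im_le_norm (z m)).trans (le_abs_self _)⟩

lemma InSh.exists_abs_le {h : ℝ} (hh : 0 < h) {v : ℤ → ℝ} (hv : InSh h v) :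
    ∃ K, ∀ m, |v m| ≤ K := by
  refine ⟨1 + (∑' m : ℤ, (jb ((m : ℝ) * h) * v m) ^ 2 * h) / h, fun m => ?_⟩
  have h1 := hv.1.le_tsum m fun _ _ => by positivity
  rw [← le_div_iff₀ hh, mul_pow, jb_sq] at h1
  have h2 := mul_le_mul_of_nonneg_right (one_le_jsq (m * h)) (sq_nonneg (v m))
  nlinarith [sq_abs (v m), sq_nonneg (|v m| - 1)]

/-- One step of the scheme, in terms of the mesh functions `(a, b)` (old values), `(A, B)`
(new values), `(p, q)` (background) and `(G, H)` (forcing). -/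
def SchemeStep (μ h k : ℝ) (p q G H a b A B : ℤ → ℝ) : Prop := ∀ m : ℤ,
  ((B m - b m) / k - Dp h (Dm h A) m
      - μ * (a m ^ 2 * A m + a m * b m * B m + q m ^ 2 * a m + 3 * p m * a m * A m
          + p m * b m * B m + 2 * q m * a m * B m + 3 * p m ^ 2 * a m + 2 * p m * q m * b m)
      - G m = 0) ∧
    ((A m - a m) / k + Dp h (Dm h B) m
      + μ * (a m * b m * A m + b m ^ 2 * B m + 2 * b m * p m * A m + a m * q m * A m
          + 3 * b m * q m * B m + 2 * p m * q m * a m + p m ^ 2 * b m + 3 * q m ^ 2 * b m)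
      + H m = 0)

lemma SchemeStep.rapidDecay {μ h k : ℝ} (hh : 0 < h) (hk : 0 < k) {p q G H a b A B : ℤ → ℝ}
    (hs : SchemeStep μ h k p q G H a b A B) (hp : PolyGrowth p) (hq : PolyGrowth q)
    (hG : RapidDecay G) (hH : RapidDecay H) (ha : RapidDecay a) (hb : RapidDecay b)
    {K : ℝ} (hA : ∀ m, |A m| ≤ K) (hB : ∀ m, |B m| ≤ K) : RapidDecay A ∧ RapidDecay B := by
  have hA' : PolyGrowth A := .of_bounded hA
  have hB' : PolyGrowth B := .of_bounded hB
  have ha' := ha.polyGrowth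
  have hb' := hb.polyGrowth
  have c := polyGrowth_const
  have r1 := ((ha.mul_polyGrowth ((c 1).add ((c (-(k * μ))).mul (((hb'.mul hA').add
    (hq.mul hA')).add ((c 2).mul (hp.mul hq)))))).add
    (hb.mul_polyGrowth ((c (-(k * μ))).mul ((((hb'.mul hB').add ((c 2).mul (hp.mul hA'))).add
    ((c 3).mul (hq.mul hB'))).add ((hp.mul hp).add ((c 3).mul (hq.mul hq))))))).add
    (hH.const_mul (-k))
  have r2 := ((ha.mul_polyGrowth ((c (k * μ)).mul ((((((ha'.mul hA').add (hb'.mul hB')).add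
    (hq.mul hq)).add ((c 3).mul (hp.mul hA'))).add ((c 2).mul (hq.mul hB'))).add
    ((c 3).mul (hp.mul hp))))).add
    (hb.mul_polyGrowth ((c 1).add ((c (k * μ)).mul ((hp.mul hB').add
    ((c 2).mul (hp.mul hq))))))).add (hG.const_mul k)
  refine rapidDecay_of_resolvent hh hk hA hB r1 r2 (fun m => ?_) (fun m => ?_)
  · have := (hs m).2
    have e : (A m - a m) / k * k = A m - a m := div_mul_cancel₀ _ hk.ne'
    linear_combination k * this - e
  · have := (hs m).1
    have e : (B m - b m) / k * k = B m - b m := div_mul_cancel₀ _ hk.ne'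
    linear_combination k * this - e

/-- The mesh function `φ` is a symbol of order `0`, up to `n` differences, with constant `c`. -/
def IsMeshSymbol (h : ℝ) (n : ℕ) (c : ℝ) (φ : ℤ → ℝ) : Prop :=
  ∀ i ≤ n, ∀ m : ℤ, (Dp h)^[i] φ m ^ 2 ≤ c * jsq ((m : ℝ) * h) ^ (-(i : ℤ))

lemma IsMeshSymbol.polyGrowth {h : ℝ} {n : ℕ} {c : ℝ} {φ : ℤ → ℝ} (hφ : IsMeshSymbol h n c φ) :
    PolyGrowth φ := polyGrowth_of_sq_le (hφ 0 n.zero_le)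

lemma IsMeshSymbol.sq_le {h : ℝ} {n : ℕ} {c : ℝ} {φ : ℤ → ℝ} (hφ : IsMeshSymbol h n c φ) (m : ℤ) :
    φ m ^ 2 ≤ c := by simpa using hφ 0 n.zero_le m

/-- Sum of the weighted norms of the differences of order at most `n`. -/
def lowNorms (h : ℝ) (b : ℤ) (n : ℕ) (v : ℤ → ℝ) : ℝ :=
  ∑ i ∈ Finset.range (n + 1), wsum h (b + i) ((Dp h)^[i] v)

lemma lowNorms_nonneg {h : ℝ} (hh : 0 ≤ h) (b : ℤ) (n : ℕ) (v : ℤ → ℝ) : 0 ≤ lowNorms h b n v :=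
  Finset.sum_nonneg fun _ _ => wsum_nonneg hh _ _

lemma lowNorms_mono {h : ℝ} (hh : 0 ≤ h) (b : ℤ) {i n : ℕ} (hi : i ≤ n) (v : ℤ → ℝ) :
    lowNorms h b i v ≤ lowNorms h b n v :=
  Finset.sum_le_sum_of_subset_of_nonneg (Finset.range_subset_range.2 (by omega))
    fun _ _ _ => wsum_nonneg hh _ _

lemma exists_wsum_iterate_Dp_mul_mul_le (n : ℕ) (b : ℤ) (c : ℝ) : ∃ C ≥ 0,
    ∀ h ∈ Set.Ioo (0 : ℝ) 1, ∀ φ ψ v : ℤ → ℝ, IsMeshSymbol h n c φ → IsMeshSymbol h n c ψ →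
      RapidDecay v →
      wsum h (b + n) ((Dp h)^[n] fun m => φ m * (ψ m * v m)) ≤ C * lowNorms h b n v := by
  have hl := fun i : ℕ => exists_wsum_iterate_Dp_mul_le i b 0 c
  choose C hC hl using hl
  refine ⟨C n * ∑ i ∈ Finset.range (n + 1), C i,
    mul_nonneg (hC n) (Finset.sum_nonneg fun i _ => hC i), fun h hh φ ψ v hφ hψ hv => ?_⟩
  have h1 := hl n h hh φ (fun m => ψ m * v m) (fun i hi m => by simpa using hφ i hi m)
    (hv.polyGrowth_mul hψ.polyGrowth)
  simp only [sub_zero] at h1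
  rw [mul_assoc, Finset.sum_mul]
  refine h1.trans (mul_le_mul_of_nonneg_left (Finset.sum_le_sum fun i hi => ?_) (hC n))
  have hi' : i ≤ n := by have := Finset.mem_range.1 hi; omega
  have h2 := hl i h hh ψ v (fun l hl m => by simpa using hψ l (hl.trans hi') m) hv
  simp only [sub_zero] at h2
  exact h2.trans (mul_le_mul_of_nonneg_left (lowNorms_mono hh.1.le b hi' v) (hC i))

lemma wsum_const_mul (h : ℝ) (b : ℤ) (α : ℝ) (v : ℤ → ℝ) :
    wsum h b (fun m => α * v m) = α ^ 2 * wsum h b v := by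
  unfold wsum
  rw [← tsum_mul_left]
  congr 1; ext m; ring

lemma RapidDecay.potential {p q x y : ℤ → ℝ} (α β γ : ℝ) (hp : PolyGrowth p) (hq : PolyGrowth q)
    (hx : RapidDecay x) (hy : RapidDecay y) :
    RapidDecay fun m => α * (p m * (q m * x m)) +
      (β * (p m * (p m * y m)) + γ * (q m * (q m * y m))) :=
  (((hx.polyGrowth_mul hq).polyGrowth_mul hp).const_mul α).add
    ((((hy.polyGrowth_mul hp).polyGrowth_mul hp).const_mul β).add
      (((hy.polyGrowth_mul hq).polyGrowth_mul hq).const_mul γ))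

lemma exists_wsum_iterate_Dp_potential_le (n : ℕ) (b : ℤ) (c α β γ : ℝ) : ∃ C ≥ 0,
    ∀ h ∈ Set.Ioo (0 : ℝ) 1, ∀ p q x y : ℤ → ℝ, IsMeshSymbol h n c p → IsMeshSymbol h n c q →
      RapidDecay x → RapidDecay y →
      wsum h (b + n) ((Dp h)^[n] fun m => α * (p m * (q m * x m)) +
        (β * (p m * (p m * y m)) + γ * (q m * (q m * y m)))) ≤
      C * (lowNorms h b n x + lowNorms h b n y) := by
  obtain ⟨C, hC, hl⟩ := exists_wsum_iterate_Dp_mul_mul_le n b c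
  refine ⟨2 * α ^ 2 * C + 4 * β ^ 2 * C + 4 * γ ^ 2 * C, by positivity,
    fun h hh p q x y hp hq hx hy => ?_⟩
  have hp' := hp.polyGrowth
  have hq' := hq.polyGrowth
  have r1 := ((hx.polyGrowth_mul hq').polyGrowth_mul hp').iterate_Dp h n
  have r2 := ((hy.polyGrowth_mul hp').polyGrowth_mul hp').iterate_Dp h n
  have r3 := ((hy.polyGrowth_mul hq').polyGrowth_mul hq').iterate_Dp h n
  have e1 := hl h hh p q x hp hq hx
  have e2 := hl h hh p p y hp hp hy
  have e3 := hl h hh q q y hq hq hy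
  have n1 := lowNorms_nonneg hh.1.le b n x
  have n2 := lowNorms_nonneg hh.1.le b n y
  simp only [iterate_Dp_add, iterate_Dp_const_mul]
  refine (wsum_add_le hh.1.le _ (r1.const_mul α) ((r2.const_mul β).add (r3.const_mul γ))).trans ?_
  have s := wsum_add_le hh.1.le (b + n) (r2.const_mul β) (r3.const_mul γ)
  simp only [wsum_const_mul] at s ⊢
  have f1 := mul_le_mul_of_nonneg_left e1 (sq_nonneg α)
  have f2 := mul_le_mul_of_nonneg_left e2 (sq_nonneg β)
  have f3 := mul_le_mul_of_nonneg_left e3 (sq_nonneg γ)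
  have g1 : 0 ≤ (α ^ 2 * C) * lowNorms h b n y := by positivity
  have g2 : 0 ≤ (β ^ 2 * C) * lowNorms h b n x := by positivity
  have g3 : 0 ≤ (γ ^ 2 * C) * lowNorms h b n x := by positivity
  linarith

lemma RapidDecay.Q1 {μ h : ℝ} {a b p q A B : ℤ → ℝ} (hp : PolyGrowth p) (hq : PolyGrowth q)
    (ha : RapidDecay a) (hb : RapidDecay b) (hA : RapidDecay A) (hB : RapidDecay B) :
    RapidDecay (Q1 μ h a b p q A B) := by
  have c := polyGrowth_const
  have ha' := ha.polyGrowth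
  have hb' := hb.polyGrowth
  exact ((((((hB.Dm h).Dp h).add (hA.polyGrowth_mul (((c μ).mul ha').mul hb'))).add
    (hB.polyGrowth_mul ((c μ).mul (hb'.pow 2)))).add
    (hA.polyGrowth_mul (((c (2 * μ)).mul hb').mul hp))).add
    (hA.polyGrowth_mul (((c μ).mul ha').mul hq))).add
    (hB.polyGrowth_mul (((c (3 * μ)).mul hb').mul hq))

lemma RapidDecay.Q2 {μ h : ℝ} {a b p q A B : ℤ → ℝ} (hp : PolyGrowth p) (hq : PolyGrowth q)
    (ha : RapidDecay a) (hb : RapidDecay b) (hA : RapidDecay A) (hB : RapidDecay B) :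
    RapidDecay (Q2 μ h a b p q A B) := by
  have c := polyGrowth_const
  have ha' := ha.polyGrowth
  have hb' := hb.polyGrowth
  exact ((((((hA.Dm h).Dp h).neg.sub (hA.polyGrowth_mul ((c μ).mul (ha'.pow 2)))).sub
    (hB.polyGrowth_mul (((c μ).mul ha').mul hb'))).sub
    (hA.polyGrowth_mul (((c (3 * μ)).mul hp).mul ha'))).sub
    (hB.polyGrowth_mul (((c μ).mul hp).mul hb'))).sub
    (hB.polyGrowth_mul (((c (2 * μ)).mul hq).mul ha'))

/-- Energy inequality for one step `v ↦ V = v + k (- Q + β + G)`, before estimating the pairing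
of `Q` with `V`. -/
lemma wsum_step_le {h k : ℝ} (hh : 0 < h) (hk : 0 ≤ k) (N n : ℕ) {v V Q β G : ℤ → ℝ}
    (hv : RapidDecay v) (hV : RapidDecay V) (hQ : RapidDecay Q) (hβ : RapidDecay β)
    (hG : RapidDecay G) (hs : ∀ m, V m = v m + k * ((-1) * Q m + (β m + G m))) :
    wsum h N ((Dp h)^[n] V) ≤ wsum h N ((Dp h)^[n] v) +
      k * (2 * wsum h N ((Dp h)^[n] V) + wsum h N ((Dp h)^[n] β) + wsum h N ((Dp h)^[n] G)
        - 2 * dip h (fun m => jb ((m : ℝ) * h) ^ (2 * N) * (Dp h)^[n] Q m) ((Dp h)^[n] V)) := by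
  have e : (Dp h)^[n] V = fun m => (Dp h)^[n] v m +
      k * ((-1) * (Dp h)^[n] Q m + ((Dp h)^[n] β m + (Dp h)^[n] G m)) := by
    rw [show V = fun m => v m + k * ((-1) * Q m + (β m + G m)) from funext hs]
    simp only [iterate_Dp_add, iterate_Dp_const_mul]
  have hs' := fun m => congrFun e m
  have hv' := hv.iterate_Dp h n
  have hV' := hV.iterate_Dp h n
  have hQ' := hQ.iterate_Dp h n
  have hβ' := hβ.iterate_Dp h n
  have hG' := hG.iterate_Dp h n
  generalize (Dp h)^[n] v = v', (Dp h)^[n] V = V', (Dp h)^[n] Q = Q', (Dp h)^[n] β = β',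
    (Dp h)^[n] G = G' at *
  have hdip : HasSum (fun m : ℤ => jb ((m : ℝ) * h) ^ (2 * N) * Q' m * V' m * h)
      (dip h (fun m => jb ((m : ℝ) * h) ^ (2 * N) * Q' m) V') := by
    refine Summable.hasSum (RapidDecay.summable ?_)
    have := ((hQ'.jsq_mul h N).mul hV').mul_const h
    simpa only [pow_mul, jb_sq, zpow_natCast] using this
  refine hasSum_le (fun m => ?_) (hV'.hasSum_wsum h N) ((hv'.hasSum_wsum h N).add
    (((((hV'.hasSum_wsum h N).mul_left 2).add (hβ'.hasSum_wsum h N)).add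
      (hG'.hasSum_wsum h N)).sub (hdip.mul_left 2) |>.mul_left k))
  rw [pow_mul, jb_sq, zpow_natCast]
  have hw : 0 ≤ jsq ((m : ℝ) * h) ^ N * h := mul_nonneg (pow_nonneg (jsq_pos _).le _) hh.le
  have i : V' m ^ 2 ≤ v' m ^ 2 + k * (2 * V' m ^ 2 + β' m ^ 2 + G' m ^ 2 - 2 * (Q' m * V' m)) := by
    have j1 : 0 ≤ (V' m - v' m) ^ 2 := sq_nonneg _
    have j2 : V' m - v' m = k * (-1 * Q' m + (β' m + G' m)) := by rw [hs' m]; ring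
    have j3 := congrArg (2 * V' m * ·) j2
    have j4 := mul_nonneg hk (add_nonneg (sq_nonneg (V' m - β' m)) (sq_nonneg (V' m - G' m)))
    linarith
  have := mul_le_mul_of_nonneg_left i hw
  linarith

/-- Energy inequality at the top order for one step of the scheme satisfying the coercivity
estimate. -/
lemma exists_energy_step_le (μ : ℝ) (N n : ℕ) (c : ℝ) {C₀ : ℝ}
    (hC₀ : 0 ≤ C₀) : ∃ C ≥ 0, ∀ h ∈ Set.Ioo (0 : ℝ) 1, ∀ k > 0, ∀ p q G H a b A B : ℤ → ℝ,
      IsMeshSymbol h n c p → IsMeshSymbol h n c q →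
      RapidDecay G → RapidDecay H → wsum h N ((Dp h)^[n] G) ≤ c → wsum h N ((Dp h)^[n] H) ≤ c →
      RapidDecay a → RapidDecay b → RapidDecay A → RapidDecay B →
      SchemeStep μ h k p q G H a b A B →
      -C₀ * ((wnormSq h N n A + wnormSq h N n B) + (wnormSq h N n a + wnormSq h N n b) + 1) ≤
        dip h (fun m => jb ((m : ℝ) * h) ^ (2 * N) * (Dp h)^[n] (Q1 μ h a b p q A B) m)
          ((Dp h)^[n] A) +
        dip h (fun m => jb ((m : ℝ) * h) ^ (2 * N) * (Dp h)^[n] (Q2 μ h a b p q A B) m)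
          ((Dp h)^[n] B) →
      wnormSq h N n A + wnormSq h N n B ≤ wnormSq h N n a + wnormSq h N n b +
        C * k * ((wnormSq h N n A + wnormSq h N n B) + (wnormSq h N n a + wnormSq h N n b) +
          (lowNorms h (N - n) n a + lowNorms h (N - n) n b) + 1) := by
  obtain ⟨C1, hC1, h1⟩ := exists_wsum_iterate_Dp_potential_le n (N - n) c (-(2 * μ)) (-μ) (-(3 * μ))
  obtain ⟨C2, hC2, h2⟩ := exists_wsum_iterate_Dp_potential_le n (N - n) c (2 * μ) (3 * μ) μ
  refine ⟨2 * C₀ + 2 + C1 + C2 + 2 * |c|, by positivity, ?_⟩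
  intro h hh k hk p q G H a b A B hp hq hG hH hGc hHc ha hb hA hB hs hco
  have hp' := hp.polyGrowth
  have hq' := hq.polyGrowth
  have e1 := wsum_step_le hh.1 hk.le N n ha hA (RapidDecay.Q1 (μ := μ) (h := h) hp' hq' ha hb hA hB)
    (ha.potential (-(2 * μ)) (-μ) (-(3 * μ)) hp' hq' hb) hH.neg fun m => by
      have := (hs m).2
      have e : (A m - a m) / k * k = A m - a m := div_mul_cancel₀ _ hk.ne'
      unfold Q1
      linear_combination k * this - e
  have e2 := wsum_step_le hh.1 hk.le N n hb hB (RapidDecay.Q2 (μ := μ) (h := h) hp' hq' ha hb hA hB)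
    (hb.potential (2 * μ) (3 * μ) μ hp' hq' ha) hG fun m => by
      have := (hs m).1
      have e : (B m - b m) / k * k = B m - b m := div_mul_cancel₀ _ hk.ne'
      unfold Q2
      linear_combination k * this - e
  have f1 := h1 h hh p q a b hp hq ha hb
  have f2 := h2 h hh p q b a hp hq hb ha
  rw [sub_add_cancel] at f1 f2
  have hHn : wsum h N ((Dp h)^[n] fun m => -H m) = wsum h N ((Dp h)^[n] H) := by
    have : (fun m => -H m) = fun m => (-1) * H m := by ext; ring
    rw [this, iterate_Dp_const_mul, wsum_const_mul]; norm_num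
  rw [hHn] at e1
  simp only [wnormSq_eq_wsum] at hco ⊢
  have la := lowNorms_nonneg hh.1.le (N - n) n a
  have lb := lowNorms_nonneg hh.1.le (N - n) n b
  have wa := wsum_nonneg hh.1.le N ((Dp h)^[n] a)
  have wb := wsum_nonneg hh.1.le N ((Dp h)^[n] b)
  have wA := wsum_nonneg hh.1.le N ((Dp h)^[n] A)
  have wB := wsum_nonneg hh.1.le N ((Dp h)^[n] B)
  have hc := le_abs_self c
  have hc0 := abs_nonneg c
  generalize dip h (fun m => jb ((m : ℝ) * h) ^ (2 * N) * (Dp h)^[n] (Q1 μ h a b p q A B) m)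
    ((Dp h)^[n] A) = d1 at *
  generalize dip h (fun m => jb ((m : ℝ) * h) ^ (2 * N) * (Dp h)^[n] (Q2 μ h a b p q A B) m)
    ((Dp h)^[n] B) = d2 at *
  generalize wsum h N ((Dp h)^[n] a) = xa, wsum h N ((Dp h)^[n] b) = xb,
    wsum h N ((Dp h)^[n] A) = xA, wsum h N ((Dp h)^[n] B) = xB, wsum h N ((Dp h)^[n] G) = xG,
    wsum h N ((Dp h)^[n] H) = xH, lowNorms h (N - n) n a = ya, lowNorms h (N - n) n b = yb at *
  have g1 := mul_nonneg hC₀ (add_nonneg la lb)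
  have g2 := mul_nonneg (add_nonneg hC1 hC2) (add_nonneg (add_nonneg wA wB) (add_nonneg wa wb))
  have g3 := mul_nonneg hc0 (add_nonneg (add_nonneg wA wB) (add_nonneg wa wb))
  have g4 := mul_nonneg hc0 (add_nonneg la lb)
  have t := mul_le_mul_of_nonneg_left (add_le_add (add_le_add (add_le_add f1 f2)
    (add_le_add hGc hHc)) (mul_le_mul_of_nonneg_left hco (by norm_num : (0 : ℝ) ≤ 2))) hk.le
  have t1 := mul_nonneg hk.le (add_nonneg g1 (add_nonneg g3 g4))
  have t2 := mul_nonneg hk.le (add_nonneg g2 (add_nonneg hC1 hC2))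
  have t5 := mul_le_mul_of_nonneg_left hc hk.le
  have t3 := mul_nonneg hk.le (add_nonneg la lb)
  have t4 := mul_nonneg hk.le (add_nonneg wa wb)
  linarith

lemma exists_tent_le_weight {r : ℝ} (hr : 0 ≤ r) (L : ℕ) : ∃ C ≥ 0, ∀ h ∈ Set.Ioo (0 : ℝ) 1,
    ∀ m : ℤ, tent r ((m : ℝ) * h) ≤ C * jsq ((m : ℝ) * h) ^ (-(L : ℤ)) ∧
      tent r (((m + 1 : ℤ) : ℝ) * h) ≤ C * jsq ((m : ℝ) * h) ^ (-(L : ℤ)) ∧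
      |Dp h (fun m : ℤ => tent r ((m : ℝ) * h)) m| ≤ C * jsq ((m : ℝ) * h) ^ (-(L : ℤ)) := by
  refine ⟨(r + 1) * jsq (r + 2) ^ L, by have := jsq_pos (r + 2); positivity, fun h hh m => ?_⟩
  have hh0 := hh.1
  have hx : ((m + 1 : ℤ) : ℝ) * h = m * h + h := by push_cast; ring
  simp only [Dp, hx]
  generalize (m : ℝ) * h = x
  rw [zpow_neg, zpow_natCast]
  have jp := jsq_pos x
  have jr := jsq_pos (r + 2)
  rcases le_or_gt (r + 2) |x| with h1 | h1
  · have h2 : r + 1 ≤ |x + h| := by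
      have := abs_sub_abs_le_abs_sub x (x + h)
      rw [sub_add_cancel_left, abs_neg, abs_of_pos hh0] at this
      linarith [hh.2]
    rw [tent_eq_zero (by linarith), tent_eq_zero h2]
    have : 0 ≤ (r + 1) * jsq (r + 2) ^ L * (jsq x ^ L)⁻¹ := by positivity
    simpa using this
  · have h2 : r + 1 ≤ (r + 1) * jsq (r + 2) ^ L * (jsq x ^ L)⁻¹ := by
      rw [← div_eq_mul_inv, le_div_iff₀ (by positivity)]
      have : jsq x ≤ jsq (r + 2) := by
        unfold jsq; nlinarith [sq_abs x, abs_nonneg x]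
      gcongr
    refine ⟨(tent_le hr x).trans h2, (tent_le hr _).trans h2, ?_⟩
    rw [abs_div, abs_of_pos hh0, div_le_iff₀ hh0]
    have := tent_lipschitz r (x + h) x
    rw [add_sub_cancel_left, abs_of_pos hh0] at this
    nlinarith

lemma four_add_sq_le (w x y z : ℝ) :
    (w + x + y + z) ^ 2 ≤ 4 * (w ^ 2 + x ^ 2 + y ^ 2 + z ^ 2) := by
  linarith [sq_nonneg (w - x), sq_nonneg (w - y), sq_nonneg (w - z), sq_nonneg (x - y),
    sq_nonneg (x - z), sq_nonneg (y - z)]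

lemma add_mul_sq_le (α β A B : ℝ) :
    (α * A + β * B) ^ 2 ≤ (α ^ 2 + β ^ 2) * (A ^ 2 + B ^ 2) := by
  linarith [sq_nonneg (α * B - β * A)]

/-- Coefficients of the increments in the mass balance of one step. -/
lemma mass_coeff_sq_le {c M p q a b A B : ℝ} (hM : 0 ≤ M) (hc : 0 ≤ c)
    (hp : p ^ 2 ≤ c) (hq : q ^ 2 ≤ c) (hab : a ^ 2 + b ^ 2 ≤ M) :
    (-b * (a * A + b * B) + -p * (2 * b * A) + -q * (3 * b * B + a * A)
        + -3 * b * (p ^ 2 + q ^ 2)) ^ 2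
      + (a * (a * A + b * B) + p * (3 * a * A + b * B) + q * (2 * a * B)
        + 3 * a * (p ^ 2 + q ^ 2)) ^ 2
      ≤ 8 * (M ^ 2 + 18 * c * M + 36 * c ^ 2) * (A ^ 2 + B ^ 2 + (a ^ 2 + b ^ 2)) := by
  have hS : 0 ≤ A ^ 2 + B ^ 2 := by positivity
  have hs : 0 ≤ a ^ 2 + b ^ 2 := by positivity
  have t1 : (a ^ 2 + b ^ 2) * (a * A + b * B) ^ 2 ≤ M * (M * (A ^ 2 + B ^ 2)) := by
    refine mul_le_mul hab ((add_mul_sq_le a b A B).trans ?_) (sq_nonneg _) hM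
    exact mul_le_mul_of_nonneg_right hab hS
  have t : ∀ {x y z : ℝ}, x ^ 2 ≤ c → y ^ 2 + z ^ 2 ≤ 9 * M →
      (x * (y * A + z * B)) ^ 2 ≤ c * (9 * M * (A ^ 2 + B ^ 2)) := fun {x y z} hx hyz => by
    rw [mul_pow]
    refine mul_le_mul hx ((add_mul_sq_le y z A B).trans ?_) (sq_nonneg _) hc
    exact mul_le_mul_of_nonneg_right hyz hS
  have a2 := sq_nonneg a
  have b2 := sq_nonneg b
  have t2 := t hp (y := 2 * b) (z := 0) (by linarith)
  have t3 := t hq (y := a) (z := 3 * b) (by linarith)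
  have t4 := t hp (y := 3 * a) (z := b) (by linarith)
  have t5 := t hq (y := 0) (z := 2 * a) (by linarith)
  have t6 : (a ^ 2 + b ^ 2) * (p ^ 2 + q ^ 2) ^ 2 ≤ (a ^ 2 + b ^ 2) * (2 * c) ^ 2 := by
    gcongr; linarith
  have f1 := four_add_sq_le (-b * (a * A + b * B)) (-p * (2 * b * A)) (-q * (3 * b * B + a * A))
    (-3 * b * (p ^ 2 + q ^ 2))
  have f2 := four_add_sq_le (a * (a * A + b * B)) (p * (3 * a * A + b * B)) (q * (2 * a * B))
    (3 * a * (p ^ 2 + q ^ 2))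
  have e1 : 0 ≤ M ^ 2 * (A ^ 2 + B ^ 2) := by positivity
  have e2 : 0 ≤ M ^ 2 * (a ^ 2 + b ^ 2) := by positivity
  have e3 : 0 ≤ c * M * (a ^ 2 + b ^ 2) := by positivity
  have e4 : 0 ≤ c ^ 2 * (A ^ 2 + B ^ 2) := by positivity
  have e5 : 0 ≤ c ^ 2 * (a ^ 2 + b ^ 2) := by positivity
  have e6 : 0 ≤ c * M * (A ^ 2 + B ^ 2) := by positivity
  have s1 : (-b * (a * A + b * B)) ^ 2 + (a * (a * A + b * B)) ^ 2
      = (a ^ 2 + b ^ 2) * (a * A + b * B) ^ 2 := by ring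
  have s2 : (-p * (2 * b * A)) ^ 2 = (p * (2 * b * A + 0 * B)) ^ 2 := by ring
  have s3 : (-q * (3 * b * B + a * A)) ^ 2 = (q * (a * A + 3 * b * B)) ^ 2 := by ring
  have s5 : (q * (2 * a * B)) ^ 2 = (q * (0 * A + 2 * a * B)) ^ 2 := by ring
  have s6 : (-3 * b * (p ^ 2 + q ^ 2)) ^ 2 + (3 * a * (p ^ 2 + q ^ 2)) ^ 2
      = 9 * ((a ^ 2 + b ^ 2) * (p ^ 2 + q ^ 2) ^ 2) := by ring
  generalize A ^ 2 + B ^ 2 = S, a ^ 2 + b ^ 2 = s at *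
  linarith

lemma two_mul_add_le {κ μ R₁ R₂ d₁ d₂ : ℝ} (hμ : μ ^ 2 = 1) :
    2 * κ * μ * (R₁ * d₁ + R₂ * d₂) ≤ d₁ ^ 2 + d₂ ^ 2 + κ ^ 2 * (R₁ ^ 2 + R₂ ^ 2) := by
  have e : d₁ ^ 2 + d₂ ^ 2 + κ ^ 2 * (R₁ ^ 2 + R₂ ^ 2) - 2 * κ * μ * (R₁ * d₁ + R₂ * d₂)
      = (d₁ - κ * μ * R₁) ^ 2 + (d₂ - κ * μ * R₂) ^ 2 := by
    linear_combination -(κ ^ 2 * (R₁ ^ 2 + R₂ ^ 2)) * hμ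
  linarith [sq_nonneg (d₁ - κ * μ * R₁), sq_nonneg (d₂ - κ * μ * R₂)]

lemma mass_source_le {μ c p q a b : ℝ} (hμ : μ ^ 2 = 1) (hp : p ^ 2 ≤ c) (hq : q ^ 2 ≤ c) :
    2 * μ * ((p ^ 2 + q ^ 2) * (q * a - p * b)) ≤ 4 * c ^ 2 + 2 * c * (a ^ 2 + b ^ 2) := by
  have i1 : (p ^ 2 + q ^ 2) ^ 2 ≤ (2 * c) ^ 2 := by gcongr; linarith
  have i2 : (q * a - p * b) ^ 2 ≤ (p ^ 2 + q ^ 2) * (a ^ 2 + b ^ 2) := by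
    linarith [sq_nonneg (q * b + p * a)]
  have i3 : (p ^ 2 + q ^ 2) * (a ^ 2 + b ^ 2) ≤ (2 * c) * (a ^ 2 + b ^ 2) := by gcongr; linarith
  have e : (p ^ 2 + q ^ 2) ^ 2 + (q * a - p * b) ^ 2
      - 2 * μ * ((p ^ 2 + q ^ 2) * (q * a - p * b))
      = (μ * (p ^ 2 + q ^ 2) - (q * a - p * b)) ^ 2 := by
    linear_combination -(p ^ 2 + q ^ 2) ^ 2 * hμ
  linarith [sq_nonneg (μ * (p ^ 2 + q ^ 2) - (q * a - p * b))]

lemma two_mul_mul_le_of_sq_le {k c A δ : ℝ} (hk : 0 < k) (hδ : δ ^ 2 ≤ c * k ^ 2) :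
    2 * A * δ ≤ k * A ^ 2 + k * c := by
  refine le_of_mul_le_mul_left ?_ hk
  linarith [sq_nonneg (k * A - δ)]

lemma mass_balance {μ k p q G H a b A B U V : ℝ}
    (h1 : B - b = k * (U + μ * (a ^ 2 * A + a * b * B + q ^ 2 * a + 3 * p * a * A
          + p * b * B + 2 * q * a * B + 3 * p ^ 2 * a + 2 * p * q * b) + G))
    (h2 : A - a = -k * (V + μ * (a * b * A + b ^ 2 * B + 2 * b * p * A + a * q * A
          + 3 * b * q * B + 2 * p * q * a + p ^ 2 * b + 3 * q ^ 2 * b) + H)) :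
    2 * (A + p) * (A - a) + 2 * (B + q) * (B - b) = 2 * k * ((B + q) * U - (A + p) * V)
      + k * (2 * μ * ((p ^ 2 + q ^ 2) * (q * a - p * b)))
      + 2 * k * μ * ((-b * (a * A + b * B) + -p * (2 * b * A) + -q * (3 * b * B + a * A)
        + -3 * b * (p ^ 2 + q ^ 2)) * (A - a)
      + (a * (a * A + b * B) + p * (3 * a * A + b * B) + q * (2 * a * B)
        + 3 * a * (p ^ 2 + q ^ 2)) * (B - b))
      + 2 * k * ((B + q) * G - (A + p) * H) := by
  linear_combination 2 * (A + p) * h2 + 2 * (B + q) * h1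

/-- Pointwise inequality behind the localized mass estimate. -/
lemma mass_density_step_le {μ : ℝ} (hμ : μ ^ 2 = 1) {k c M : ℝ} (hk : 0 < k) (hc : 0 ≤ c)
    (hM : 0 ≤ M) (hkM : k * (8 * (M ^ 2 + 18 * c * M + 36 * c ^ 2)) ≤ 1)
    {p q p' q' G H a b A B U V : ℝ}
    (hp : p ^ 2 ≤ c) (hq : q ^ 2 ≤ c) (hG : G ^ 2 ≤ c) (hH : H ^ 2 ≤ c)
    (hp' : (p' - p) ^ 2 ≤ c * k ^ 2) (hq' : (q' - q) ^ 2 ≤ c * k ^ 2) (hab : a ^ 2 + b ^ 2 ≤ M)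
    (h1 : B - b = k * (U + μ * (a ^ 2 * A + a * b * B + q ^ 2 * a + 3 * p * a * A
          + p * b * B + 2 * q * a * B + 3 * p ^ 2 * a + 2 * p * q * b) + G))
    (h2 : A - a = -k * (V + μ * (a * b * A + b ^ 2 * B + 2 * b * p * A + a * q * A
          + 3 * b * q * B + 2 * p * q * a + p ^ 2 * b + 3 * q ^ 2 * b) + H)) :
    (A ^ 2 + B ^ 2 + 2 * A * p' + 2 * B * q') - (a ^ 2 + b ^ 2 + 2 * a * p + 2 * b * q) ≤
      2 * k * ((B + q) * U - (A + p) * V) +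
        k * ((4 + 8 * c + 4 * c ^ 2) * (A ^ 2 + B ^ 2 + (a ^ 2 + b ^ 2) + 1)) := by
  have key := mass_balance h1 h2
  have b1 := mass_coeff_sq_le (A := A) (B := B) hM hc hp hq hab
  have b3 := mass_source_le (a := a) (b := b) hμ hp hq
  have b4 : 2 * ((B + q) * G - (A + p) * H) ≤ 2 * (A ^ 2 + B ^ 2) + 6 * c := by
    linarith [sq_nonneg (B + q - G), sq_nonneg (A + p + H), sq_nonneg (B - q), sq_nonneg (A - p)]
  have b5 := two_mul_mul_le_of_sq_le (A := A) hk hp'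
  have b6 := two_mul_mul_le_of_sq_le (A := B) hk hq'
  have hS : 0 ≤ A ^ 2 + B ^ 2 := by positivity
  have hs : 0 ≤ a ^ 2 + b ^ 2 := by positivity
  generalize -b * (a * A + b * B) + -p * (2 * b * A) + -q * (3 * b * B + a * A)
        + -3 * b * (p ^ 2 + q ^ 2) = R₁ at key b1
  generalize a * (a * A + b * B) + p * (3 * a * A + b * B) + q * (2 * a * B)
        + 3 * a * (p ^ 2 + q ^ 2) = R₂ at key b1
  have b2 := two_mul_add_le (κ := k) (R₁ := R₁) (R₂ := R₂) (d₁ := A - a) (d₂ := B - b) hμ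
  have i2 := mul_le_mul_of_nonneg_left b1 (sq_nonneg k)
  have i3 := mul_le_mul_of_nonneg_left hkM
    (mul_nonneg hk.le (add_nonneg hS hs))
  have j3 := mul_le_mul_of_nonneg_left b3 hk.le
  have j4 := mul_le_mul_of_nonneg_left b4 hk.le
  have l1 : 0 ≤ k * (c * (A ^ 2 + B ^ 2)) := by positivity
  have l2 : 0 ≤ k * (c * (a ^ 2 + b ^ 2)) := by positivity
  have l3 : 0 ≤ k * (c ^ 2 * (A ^ 2 + B ^ 2 + (a ^ 2 + b ^ 2))) := by positivity
  have l4 : 0 ≤ k * (a ^ 2 + b ^ 2) := by positivity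
  have l5 : 0 ≤ k * (c ^ 2) := by positivity
  linarith

/-- Localized mass of the perturbation, corrected by its pairing with the background. -/
def lmom (h r : ℝ) (a b p q : ℤ → ℝ) : ℝ :=
  ∑' m : ℤ, tent r ((m : ℝ) * h) * (a m ^ 2 + b m ^ 2 + 2 * a m * p m + 2 * b m * q m) * h

lemma RapidDecay.hasSum_lmom {a b p q : ℤ → ℝ} (ha : RapidDecay a) (hb : RapidDecay b)
    (hp : PolyGrowth p) (hq : PolyGrowth q) {r : ℝ} (hr : 0 ≤ r) (h : ℝ) :
    HasSum (fun m : ℤ => tent r ((m : ℝ) * h) *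
      (a m ^ 2 + b m ^ 2 + 2 * a m * p m + 2 * b m * q m) * h) (lmom h r a b p q) := by
  refine (RapidDecay.summable ?_).hasSum
  exact (RapidDecay.polyGrowth_mul (polyGrowth_tent hr h) (((ha.sq.add hb.sq).add
    ((ha.const_mul 2).mul_polyGrowth hp)).add ((hb.const_mul 2).mul_polyGrowth hq))).mul_const h

lemma mass_flux_eq {h : ℝ} (hh : h ≠ 0) (χ p q A B : ℤ → ℝ) (m : ℤ) :
    χ m * ((B m + q m) * Dp h (Dm h A) m - (A m + p m) * Dp h (Dm h B) m) * h =
      (χ (m + 1) * ((B (m + 1) + q (m + 1)) * Dm h A (m + 1)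
          - (A (m + 1) + p (m + 1)) * Dm h B (m + 1))
        - χ m * ((B m + q m) * Dm h A m - (A m + p m) * Dm h B m))
      + (Dp h χ m * ((A m + p m) * Dp h B m - (B m + q m) * Dp h A m)
        + χ (m + 1) * (Dp h p m * Dp h B m - Dp h q m * Dp h A m)) * h := by
  simp only [Dp, Dm, add_sub_cancel_right]
  field_simp
  ring

lemma mass_flux_remainder_le {c W δ χ' p q A B p' q' A' B' : ℝ} (hδ : |δ| ≤ W) (hχ0 : 0 ≤ χ')
    (hχ : χ' ≤ W) (hp : p ^ 2 ≤ c) (hq : q ^ 2 ≤ c) (hp' : p' ^ 2 ≤ c) (hq' : q' ^ 2 ≤ c) :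
    2 * (δ * ((A + p) * B' - (B + q) * A') + χ' * (p' * B' - q' * A')) ≤
      W * (2 * (A ^ 2 + B ^ 2) + 2 * (A' ^ 2 + B' ^ 2) + 6 * c) := by
  have hW : 0 ≤ W := hχ0.trans hχ
  have h1 : 2 * |(A + p) * B' - (B + q) * A'| ≤
      2 * (A ^ 2 + B ^ 2) + (A' ^ 2 + B' ^ 2) + 4 * c := by
    rw [← abs_two, ← abs_mul, abs_le, abs_two]
    constructor <;>
      linarith [sq_nonneg (A + p + B'), sq_nonneg (A + p - B'), sq_nonneg (B + q + A'),
        sq_nonneg (B + q - A'), sq_nonneg (A - p), sq_nonneg (B - q)]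
  have h2 : 2 * (p' * B' - q' * A') ≤ (A' ^ 2 + B' ^ 2) + 2 * c := by
    linarith [sq_nonneg (p' - B'), sq_nonneg (q' + A')]
  have h3 : δ * ((A + p) * B' - (B + q) * A') ≤ W * |(A + p) * B' - (B + q) * A'| := by
    refine (le_abs_self _).trans ?_
    rw [abs_mul]
    gcongr
  have hc : 0 ≤ c := (sq_nonneg p).trans hp
  have h4 : 0 ≤ (A' ^ 2 + B' ^ 2) + 2 * c := by positivity
  have h5 : 2 * (χ' * (p' * B' - q' * A')) ≤ W * ((A' ^ 2 + B' ^ 2) + 2 * c) := by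
    calc 2 * (χ' * (p' * B' - q' * A')) = χ' * (2 * (p' * B' - q' * A')) := by ring
      _ ≤ χ' * ((A' ^ 2 + B' ^ 2) + 2 * c) := by gcongr
      _ ≤ _ := by gcongr
  have h6 := mul_le_mul_of_nonneg_left h1 hW
  linarith

lemma exists_mass_step_le {μ : ℝ} (hμ : μ ^ 2 = 1) {n : ℕ} (hn : 1 ≤ n) (b₀ : ℤ) {r c : ℝ}
    (hr : 0 ≤ r) (hc : 0 ≤ c) : ∃ C ≥ 0, ∀ M ≥ 0, ∃ κ > 0, ∀ h ∈ Set.Ioo (0 : ℝ) 1, ∀ k > 0,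
    k ≤ κ → ∀ p q p' q' G H a b A B : ℤ → ℝ, IsMeshSymbol h n c p → IsMeshSymbol h n c q →
      PolyGrowth p' → PolyGrowth q' → (∀ m, G m ^ 2 ≤ c) → (∀ m, H m ^ 2 ≤ c) →
      RapidDecay a → RapidDecay b → RapidDecay A → RapidDecay B →
      (∀ m : ℤ, |(m : ℝ) * h| ≤ r + 1 → (p' m - p m) ^ 2 ≤ c * k ^ 2 ∧
        (q' m - q m) ^ 2 ≤ c * k ^ 2 ∧ a m ^ 2 + b m ^ 2 ≤ M) →
      SchemeStep μ h k p q G H a b A B →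
      lmom h r A B p' q' ≤ lmom h r a b p q + C * k *
        (lowNorms h b₀ n A + lowNorms h b₀ n B + (lowNorms h b₀ n a + lowNorms h b₀ n b) + 1) := by
  set L : ℕ := b₀.natAbs + 1 with hL
  obtain ⟨Cw, hCw, hw⟩ := exists_tent_le_weight hr L
  set C₁ := 4 + 8 * c + 4 * c ^ 2 with hC₁
  have hC₁0 : 0 ≤ C₁ := by positivity
  refine ⟨Cw * (4 + C₁ + 16 * (6 * c + C₁)), by positivity, fun M hM =>
    ⟨(8 * (M ^ 2 + 18 * c * M + 36 * c ^ 2) + 1)⁻¹, by positivity, ?_⟩⟩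
  intro h hh k hk hkκ p q p' q' G H a b A B hp hq hp' hq' hG hH ha hb hA hB hwin hs
  have hh0 : h ≠ 0 := hh.1.ne'
  have hkM : k * (8 * (M ^ 2 + 18 * c * M + 36 * c ^ 2)) ≤ 1 := by
    have hD : 0 < 8 * (M ^ 2 + 18 * c * M + 36 * c ^ 2) + 1 := by positivity
    have := mul_le_mul_of_nonneg_right hkκ hD.le
    rw [inv_mul_cancel₀ hD.ne'] at this
    linarith
  set χ : ℤ → ℝ := fun m => tent r ((m : ℝ) * h) with hχ
  have hχp : PolyGrowth χ := polyGrowth_tent hr h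
  have hDp : ∀ {φ : ℤ → ℝ}, IsMeshSymbol h n c φ → ∀ m, Dp h φ m ^ 2 ≤ c := fun {φ} hφ m => by
    have h1 := hφ 1 hn m
    refine h1.trans (mul_le_of_le_one_right hc ?_)
    exact zpow_le_one_of_nonpos₀ (one_le_jsq _) (by simp)
  have hτ : RapidDecay fun m => χ m * ((B m + q m) * Dm h A m - (A m + p m) * Dm h B m) :=
    RapidDecay.polyGrowth_mul hχp (((hA.Dm h).polyGrowth_mul (hB.polyGrowth.add hq.polyGrowth)).sub
      ((hB.Dm h).polyGrowth_mul (hA.polyGrowth.add hp.polyGrowth)))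
  have hJ : HasSum (fun m : ℤ => (jsq ((m : ℝ) * h))⁻¹ * h)
      (∑' m : ℤ, (jsq ((m : ℝ) * h))⁻¹ * h) := (summable_inv_jsq ⟨hh.1, hh.2.le⟩).hasSum
  have hJ16 := tsum_inv_jsq_le (h := h) ⟨hh.1, hh.2.le⟩
  have key := hasSum_le (fun m => ?_) (hA.hasSum_lmom hB hp' hq' hr h)
    (((ha.hasSum_lmom hb hp.polyGrowth hq.polyGrowth hr h).add
      (hτ.hasSum_sub_shift.mul_left (2 * k))).add
      (((((hA.hasSum_wsum h b₀).add (hB.hasSum_wsum h b₀)).mul_left (2 + C₁)).add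
        ((((hA.Dp h).hasSum_wsum h (b₀ + 1)).add ((hB.Dp h).hasSum_wsum h (b₀ + 1))).mul_left 2)
        |>.add (((ha.hasSum_wsum h b₀).add (hb.hasSum_wsum h b₀)).mul_left C₁)
        |>.add (hJ.mul_left (6 * c + C₁))).mul_left (k * Cw)))
  · have hl : ∀ v, wsum h b₀ v ≤ lowNorms h b₀ n v := fun v => by
      have := Finset.single_le_sum (f := fun i : ℕ => wsum h (b₀ + i) ((Dp h)^[i] v))
        (fun i _ => wsum_nonneg hh.1.le _ _) (Finset.mem_range.2 (by omega : 0 < n + 1))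
      simpa [lowNorms] using this
    have hl' : ∀ v, wsum h (b₀ + 1) (Dp h v) ≤ lowNorms h b₀ n v := fun v => by
      have := Finset.single_le_sum (f := fun i : ℕ => wsum h (b₀ + i) ((Dp h)^[i] v))
        (fun i _ => wsum_nonneg hh.1.le _ _) (Finset.mem_range.2 (by omega : 1 < n + 1))
      simpa [lowNorms] using this
    refine key.trans ?_
    have lA := hl A
    have lB := hl B
    have la := hl a
    have lb := hl b
    have lA' := hl' A
    have lB' := hl' B
    have n0 := fun v => lowNorms_nonneg hh.1.le b₀ n v
    have nA := n0 A
    have nB := n0 B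
    have na := n0 a
    have nb := n0 b
    rw [mul_zero, add_zero]
    generalize lowNorms h b₀ n A = LA, lowNorms h b₀ n B = LB, lowNorms h b₀ n a = La,
      lowNorms h b₀ n b = Lb at *
    have i1 : (2 + C₁) * (wsum h b₀ A + wsum h b₀ B) ≤ (2 + C₁) * (LA + LB) := by gcongr
    have i2 : C₁ * (wsum h b₀ a + wsum h b₀ b) ≤ C₁ * (La + Lb) := by gcongr
    have i3 : (6 * c + C₁) * (∑' m : ℤ, (jsq ((m : ℝ) * h))⁻¹ * h) ≤ (6 * c + C₁) * 16 := by gcongr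
    have i4 : 0 ≤ (6 * c + C₁) * (LA + LB + (La + Lb)) := by positivity
    rw [show ∀ x y : ℝ, Cw * x * k * y = k * Cw * (x * y) from fun x y => by ring]
    gcongr
    linarith
  · have jp := jsq_pos ((m : ℝ) * h)
    have j1 := one_le_jsq ((m : ℝ) * h)
    have w1 : jsq ((m : ℝ) * h) ^ (-(L : ℤ)) ≤ jsq ((m : ℝ) * h) ^ b₀ :=
      zpow_le_zpow_right₀ j1 (by omega)
    have w2 : jsq ((m : ℝ) * h) ^ (-(L : ℤ)) ≤ jsq ((m : ℝ) * h) ^ (b₀ + 1) :=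
      zpow_le_zpow_right₀ j1 (by omega)
    have w3 : jsq ((m : ℝ) * h) ^ (-(L : ℤ)) ≤ (jsq ((m : ℝ) * h))⁻¹ := by
      rw [← zpow_neg_one]
      exact zpow_le_zpow_right₀ j1 (by omega)
    obtain ⟨x1, x2, x3⟩ := hw h hh m
    have x0 := tent_nonneg r (((m + 1 : ℤ) : ℝ) * h)
    have fl := mass_flux_eq hh0 χ p q A B m
    have fr := mass_flux_remainder_le (A := A m) (B := B m) (A' := Dp h A m) (B' := Dp h B m)
      x3 x0 x2 (hp.sq_le m) (hq.sq_le m) (hDp hp m) (hDp hq m)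
    have hχ0 : 0 ≤ χ m := tent_nonneg _ _
    have dens : χ m * ((A m ^ 2 + B m ^ 2 + 2 * A m * p' m + 2 * B m * q' m)
          - (a m ^ 2 + b m ^ 2 + 2 * a m * p m + 2 * b m * q m)) ≤
        χ m * (2 * k * ((B m + q m) * Dp h (Dm h A) m - (A m + p m) * Dp h (Dm h B) m)
          + k * (C₁ * (A m ^ 2 + B m ^ 2 + (a m ^ 2 + b m ^ 2) + 1))) := by
      rcases le_or_gt (r + 1) |(m : ℝ) * h| with hm | hm
      · rw [show χ m = 0 from tent_eq_zero hm, zero_mul, zero_mul]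
      · obtain ⟨y1, y2, y3⟩ := hwin m hm.le
        obtain ⟨s1, s2⟩ := hs m
        refine mul_le_mul_of_nonneg_left (mass_density_step_le hμ hk hc hM hkM (hp.sq_le m)
          (hq.sq_le m) (hG m) (hH m) y1 y2 y3 ?_ ?_) hχ0
        · field_simp at s1 ⊢
          linarith
        · field_simp at s2 ⊢
          linarith
    have hkh : 0 ≤ k * h := mul_nonneg hk.le hh.1.le
    have z0 := mul_le_mul_of_nonneg_right x1 (mul_nonneg hC₁0
      (by positivity : 0 ≤ A m ^ 2 + B m ^ 2 + (a m ^ 2 + b m ^ 2) + 1))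
    have z1 := mul_le_mul_of_nonneg_right w1 (by positivity :
      0 ≤ (2 + C₁) * (A m ^ 2 + B m ^ 2) + C₁ * (a m ^ 2 + b m ^ 2))
    have z2 := mul_le_mul_of_nonneg_right w2 (by positivity :
      0 ≤ 2 * (Dp h A m ^ 2 + Dp h B m ^ 2))
    have z3 := mul_le_mul_of_nonneg_right w3 (by positivity : 0 ≤ 6 * c + C₁)
    have y0 := mul_le_mul_of_nonneg_left (add_le_add (add_le_add z1 z2) z3)
      (mul_nonneg hkh hCw)
    have y1 := mul_le_mul_of_nonneg_left z0 hkh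
    have y2 := mul_le_mul_of_nonneg_left fr hkh
    have y3 := mul_le_mul_of_nonneg_right dens hh.1.le
    rw [show tent r ((m : ℝ) * h) = χ m from rfl] at y1 ⊢
    rw [show tent r (((m + 1 : ℤ) : ℝ) * h) = χ (m + 1) from rfl] at y2
    change k * h * (2 * (Dp h χ m * _ + _)) ≤ _ at y2
    generalize χ m * ((B m + q m) * Dm h A m - (A m + p m) * Dm h B m) = t₀ at *
    generalize χ (m + 1) * ((B (m + 1) + q (m + 1)) * Dm h A (m + 1)
          - (A (m + 1) + p (m + 1)) * Dm h B (m + 1)) = t₁ at *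
    generalize Dp h χ m * ((A m + p m) * Dp h B m - (B m + q m) * Dp h A m)
        + χ (m + 1) * (Dp h p m * Dp h B m - Dp h q m * Dp h A m) = R at *
    generalize (B m + q m) * Dp h (Dm h A) m - (A m + p m) * Dp h (Dm h B) m = F at *
    have fl' : 2 * k * (χ m * F * h) = 2 * k * (t₁ - t₀ + R * h) := by rw [fl]
    generalize jsq ((m : ℝ) * h) ^ (-(L : ℤ)) = W, jsq ((m : ℝ) * h) ^ b₀ = W₀,
      jsq ((m : ℝ) * h) ^ (b₀ + 1) = W₁, (jsq ((m : ℝ) * h))⁻¹ = W₂, χ m = X,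
      A m = A₀, B m = B₀, a m = a₀, b m = b', p m = p₀, q m = q₀, p' m = p₁, q' m = q₁,
      Dp h A m = A₁, Dp h B m = B₁ at y0 y1 y2 y3 fl' ⊢
    clear_value C₁
    linarith

lemma exists_lmom_bounds {r : ℝ} (hr : 0 ≤ r) {c : ℝ} (hc : 0 ≤ c) : ∃ C ≥ 0,
    ∀ h ∈ Set.Ioo (0 : ℝ) 1, ∀ a b p q : ℤ → ℝ, RapidDecay a → RapidDecay b → PolyGrowth p →
      PolyGrowth q → (∀ m, p m ^ 2 ≤ c) → (∀ m, q m ^ 2 ≤ c) →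
      1 / 2 * (lmass h r a + lmass h r b) ≤ lmom h r a b p q + C ∧
        lmom h r a b p q ≤ 2 * (lmass h r a + lmass h r b) + C := by
  obtain ⟨Cw, hCw, hw⟩ := exists_tent_le_weight hr 1
  refine ⟨4 * c * Cw * 16, by positivity, fun h hh a b p q ha hb hp hq hpc hqc => ?_⟩
  have hJ : HasSum (fun m : ℤ => (jsq ((m : ℝ) * h))⁻¹ * h)
      (∑' m : ℤ, (jsq ((m : ℝ) * h))⁻¹ * h) := (summable_inv_jsq ⟨hh.1, hh.2.le⟩).hasSum
  have hJ16 := mul_le_mul_of_nonneg_left (tsum_inv_jsq_le (h := h) ⟨hh.1, hh.2.le⟩)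
    (by positivity : 0 ≤ 4 * c * Cw)
  have sm := ha.hasSum_lmom hb hp hq hr h
  have sl := (ha.hasSum_lmass hr h).add (hb.hasSum_lmass hr h)
  have sj := hJ.mul_left (4 * c * Cw)
  have hχ : ∀ m : ℤ, tent r ((m : ℝ) * h) * (4 * c) * h ≤
      4 * c * Cw * ((jsq ((m : ℝ) * h))⁻¹ * h) := fun m => by
    have := mul_le_mul_of_nonneg_right (hw h hh m).1
      (mul_nonneg (by positivity : 0 ≤ 4 * c) hh.1.le)
    rw [Nat.cast_one, zpow_neg_one] at this
    linarith
  constructor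
  · refine (hasSum_le (fun m => ?_) (sl.mul_left (1 / 2)) (sm.add sj)).trans (by linarith)
    refine le_trans ?_ (add_le_add_right (hχ m) _)
    have hw0 := mul_nonneg (tent_nonneg r ((m : ℝ) * h)) hh.1.le
    have : 1 / 2 * (a m ^ 2 + b m ^ 2) ≤
        (a m ^ 2 + b m ^ 2 + 2 * a m * p m + 2 * b m * q m) + 4 * c := by
      linarith [sq_nonneg (a m + 2 * p m), sq_nonneg (b m + 2 * q m), hpc m, hqc m]
    have := mul_le_mul_of_nonneg_left this hw0
    linarith
  · refine (hasSum_le (fun m => ?_) sm ((sl.mul_left 2).add sj)).trans (by linarith)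
    refine le_trans ?_ (add_le_add_right (hχ m) _)
    have hw0 := mul_nonneg (tent_nonneg r ((m : ℝ) * h)) hh.1.le
    have : (a m ^ 2 + b m ^ 2 + 2 * a m * p m + 2 * b m * q m) ≤
        2 * (a m ^ 2 + b m ^ 2) + 4 * c := by
      linarith [sq_nonneg (a m - p m), sq_nonneg (b m - q m), hpc m, hqc m]
    have := mul_le_mul_of_nonneg_left this hw0
    linarith

lemma exists_lowNorms_le (b : ℤ) (n : ℕ) : ∃ r ≥ 0, ∃ C ≥ 0, ∀ h ∈ Set.Ioo (0 : ℝ) 1,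
    ∀ v, RapidDecay v →
      lowNorms h b n v ≤ C * (wsum h (b + n) ((Dp h)^[n] v) + lmass h r v) := by
  obtain ⟨r, hr, C, hC, hl⟩ := exists_wsum_le_top_add_lmass b n
  refine ⟨r, hr, (n + 1) * C, by positivity, fun h hh v hv => ?_⟩
  refine (Finset.sum_le_card_nsmul _ _ _ fun i hi =>
    hl h hh v hv i (by have := Finset.mem_range.1 hi; omega)).trans_eq ?_
  rw [Finset.card_range, nsmul_eq_mul]
  push_cast
  ring

lemma wsum_le_lowNorms {h : ℝ} (hh : 0 ≤ h) (b : ℤ) {i n : ℕ} (hi : i ≤ n) (v : ℤ → ℝ) :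
    wsum h (b + i) ((Dp h)^[i] v) ≤ lowNorms h b n v :=
  Finset.single_le_sum (f := fun i : ℕ => wsum h (b + i) ((Dp h)^[i] v))
    (fun i _ => wsum_nonneg hh _ _) (Finset.mem_range.2 (by omega))

lemma exists_sq_le_lowNorms (b : ℤ) {n : ℕ} (hn : 1 ≤ n) (R : ℝ) : ∃ C ≥ 0,
    ∀ h ∈ Set.Ioo (0 : ℝ) 1, ∀ v, RapidDecay v → ∀ m : ℤ, |(m : ℝ) * h| ≤ R →
      v m ^ 2 ≤ C * lowNorms h b n v := by
  obtain ⟨C, hC, hl⟩ := exists_jsq_zpow_mul_sq_le b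
  have jR := jsq_pos R
  refine ⟨jsq R ^ b.natAbs * (C * 2), by positivity, fun h hh v hv m hm => ?_⟩
  have h1 := wsum_le_lowNorms hh.1.le b n.zero_le v
  have h2 := wsum_le_lowNorms hh.1.le b hn v
  simp only [Nat.cast_zero, add_zero, Function.iterate_zero, id, Nat.cast_one,
    Function.iterate_one] at h1 h2
  have h3 : jsq ((m : ℝ) * h) ^ b * v m ^ 2 ≤ C * 2 * lowNorms h b n v := by
    refine (hl h hh v hv m).trans ?_
    rw [mul_assoc]
    gcongr
    linarith
  have j0 := jsq_pos ((m : ℝ) * h)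
  have h4 : jsq ((m : ℝ) * h) ^ (-b) ≤ jsq R ^ b.natAbs := by
    refine (zpow_le_zpow_right₀ (one_le_jsq _) (by omega : -b ≤ (b.natAbs : ℤ))).trans ?_
    rw [zpow_natCast]
    refine pow_le_pow_left₀ j0.le ?_ _
    unfold jsq
    have := pow_le_pow_left₀ (abs_nonneg _) hm 2
    rw [sq_abs] at this
    linarith
  have e : v m ^ 2 = jsq ((m : ℝ) * h) ^ (-b) * (jsq ((m : ℝ) * h) ^ b * v m ^ 2) := by
    rw [← mul_assoc, ← zpow_add₀ j0.ne', neg_add_cancel, zpow_zero, one_mul]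
  rw [e, mul_assoc]
  exact mul_le_mul h4 h3 (by positivity) (by positivity)

/-- Energy functional: weighted norms plus corrected localized mass. -/
def energyFun (h : ℝ) (N n : ℕ) (r C : ℝ) (a b p q : ℤ → ℝ) : ℝ :=
  wnormSq h N n a + wnormSq h N n b + lmom h r a b p q + C

lemma exists_energyFun_step_le {μ : ℝ} (hμ : μ ^ 2 = 1) (N : ℕ) {n : ℕ} (hn : 1 ≤ n) :
    ∃ r ≥ 0, ∀ c ≥ 0, ∀ C₀ ≥ 0, ∃ C' ≥ 0, ∃ C ≥ 0,
    (∀ h ∈ Set.Ioo (0 : ℝ) 1, ∀ a b p q : ℤ → ℝ, RapidDecay a → RapidDecay b →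
      IsMeshSymbol h n c p → IsMeshSymbol h n c q →
      wnormSq h N n a + wnormSq h N n b ≤ energyFun h N n r C' a b p q ∧
      energyFun h N n r C' a b p q ≤ wnormSq h N n a + wnormSq h N n b +
        2 * (lmass h r a + lmass h r b) + 2 * C' ∧
      ∀ m : ℤ, |(m : ℝ) * h| ≤ r + 1 → a m ^ 2 + b m ^ 2 ≤ C * energyFun h N n r C' a b p q) ∧
    ∀ M ≥ 0, ∃ κ > 0, ∀ h ∈ Set.Ioo (0 : ℝ) 1, ∀ k > 0,
      k ≤ κ → ∀ p q p' q' G H a b A B : ℤ → ℝ, IsMeshSymbol h n c p → IsMeshSymbol h n c q →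
      IsMeshSymbol h n c p' → IsMeshSymbol h n c q' → RapidDecay G → RapidDecay H →
      (∀ m, G m ^ 2 ≤ c) → (∀ m, H m ^ 2 ≤ c) →
      wsum h N ((Dp h)^[n] G) ≤ c → wsum h N ((Dp h)^[n] H) ≤ c →
      RapidDecay a → RapidDecay b → RapidDecay A → RapidDecay B →
      (∀ m : ℤ, |(m : ℝ) * h| ≤ r + 1 → (p' m - p m) ^ 2 ≤ c * k ^ 2 ∧
        (q' m - q m) ^ 2 ≤ c * k ^ 2 ∧ a m ^ 2 + b m ^ 2 ≤ M) →
      SchemeStep μ h k p q G H a b A B →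
      -C₀ * ((wnormSq h N n A + wnormSq h N n B) + (wnormSq h N n a + wnormSq h N n b) + 1) ≤
        dip h (fun m => jb ((m : ℝ) * h) ^ (2 * N) * (Dp h)^[n] (Q1 μ h a b p q A B) m)
          ((Dp h)^[n] A) +
        dip h (fun m => jb ((m : ℝ) * h) ^ (2 * N) * (Dp h)^[n] (Q2 μ h a b p q A B) m)
          ((Dp h)^[n] B) →
      energyFun h N n r C' A B p' q' ≤ energyFun h N n r C' a b p q +
        C * k * (energyFun h N n r C' a b p q + energyFun h N n r C' A B p' q' + 1) := by
  obtain ⟨r, hr, CL, hCL, hL⟩ := exists_lowNorms_le ((N : ℤ) - n) n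
  refine ⟨r, hr, fun c hc C₀ hC₀ => ?_⟩
  obtain ⟨CE, hCE, hE⟩ := exists_energy_step_le μ N n c hC₀
  obtain ⟨CM, hCM, hM⟩ := exists_mass_step_le hμ hn ((N : ℤ) - n) hr hc
  obtain ⟨C', hC', hB⟩ := exists_lmom_bounds hr hc
  obtain ⟨Cs, hCs, hs⟩ := exists_sq_le_lowNorms ((N : ℤ) - n) hn (r + 1)
  simp only [sub_add_cancel, ← wnormSq_eq_wsum] at hL
  have low : ∀ h ∈ Set.Ioo (0 : ℝ) 1, ∀ a b p q : ℤ → ℝ, RapidDecay a → RapidDecay b →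
      IsMeshSymbol h n c p → IsMeshSymbol h n c q →
      wnormSq h N n a + wnormSq h N n b ≤ energyFun h N n r C' a b p q ∧
      lowNorms h (N - n) n a + lowNorms h (N - n) n b ≤
        2 * CL * energyFun h N n r C' a b p q := fun h hh a b p q ha hb hp hq => by
    have h1 := (hB h hh a b p q ha hb hp.polyGrowth hq.polyGrowth hp.sq_le hq.sq_le).1
    have h2 := hL h hh a ha
    have h3 := hL h hh b hb
    have h4 := lmass_nonneg hh.1.le r a
    have h5 := lmass_nonneg hh.1.le r b
    have h6 : 0 ≤ wnormSq h N n a := by rw [wnormSq_eq_wsum]; exact wsum_nonneg hh.1.le _ _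
    have h7 : 0 ≤ wnormSq h N n b := by rw [wnormSq_eq_wsum]; exact wsum_nonneg hh.1.le _ _
    have h8 : wnormSq h N n a + wnormSq h N n b + (lmass h r a + lmass h r b) ≤
        2 * energyFun h N n r C' a b p q := by unfold energyFun; linarith
    have h9 := mul_le_mul_of_nonneg_left h8 hCL
    exact ⟨by unfold energyFun; linarith, by linarith⟩
  refine ⟨C', hC', 2 * CL * Cs + (CE * (1 + 2 * CL) + CM * (2 * CL + 1)), by positivity,
    fun h hh a b p q ha hb hp hq => ⟨(low h hh a b p q ha hb hp hq).1, ?_, fun m hm => ?_⟩,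
    fun M hM0 => ?_⟩
  · have := (hB h hh a b p q ha hb hp.polyGrowth hq.polyGrowth hp.sq_le hq.sq_le).2
    unfold energyFun
    linarith
  · obtain ⟨l1, l2⟩ := low h hh a b p q ha hb hp hq
    have h1 := hs h hh a ha m hm
    have h2 := hs h hh b hb m hm
    have h3 := mul_le_mul_of_nonneg_left l2 hCs
    have h6 : 0 ≤ wnormSq h N n a := by rw [wnormSq_eq_wsum]; exact wsum_nonneg hh.1.le _ _
    have h7 : 0 ≤ wnormSq h N n b := by rw [wnormSq_eq_wsum]; exact wsum_nonneg hh.1.le _ _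
    have h8 : 0 ≤ (CE * (1 + 2 * CL) + CM * (2 * CL + 1)) * energyFun h N n r C' a b p q :=
      mul_nonneg (by positivity) (by linarith)
    linarith
  · obtain ⟨κ, hκ, hstep⟩ := hM M hM0
    refine ⟨κ, hκ, fun h hh k hk hkκ p q p' q' G H a b A B hp hq hp' hq' hG hH hGc hHc hGw hHw
      ha hb hA hB hwin hsch hco => ?_⟩
    have e1 := hE h hh k hk p q G H a b A B hp hq hG hH hGw hHw ha hb hA hB hsch hco
    have e2 := hstep h hh k hk hkκ p q p' q' G H a b A B hp hq hp'.polyGrowth hq'.polyGrowth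
      hGc hHc ha hb hA hB hwin hsch
    obtain ⟨l1, l2⟩ := low h hh a b p q ha hb hp hq
    obtain ⟨l3, l4⟩ := low h hh A B p' q' hA hB hp' hq'
    have n0 : ∀ v, 0 ≤ wnormSq h N n v := fun v => by
      rw [wnormSq_eq_wsum]; exact wsum_nonneg hh.1.le _ _
    have s0 := (add_nonneg (n0 a) (n0 b)).trans l1
    have s1 := (add_nonneg (n0 A) (n0 B)).trans l3
    rw [show energyFun h N n r C' A B p' q' =
      wnormSq h N n A + wnormSq h N n B + lmom h r A B p' q' + C' from rfl] at l3 l4 s1 ⊢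
    rw [show energyFun h N n r C' a b p q =
      wnormSq h N n a + wnormSq h N n b + lmom h r a b p q + C' from rfl] at l1 l2 s0 ⊢
    set S := wnormSq h N n a + wnormSq h N n b + lmom h r a b p q + C' with hS
    set S' := wnormSq h N n A + wnormSq h N n B + lmom h r A B p' q' + C' with hS'
    have i1 : CE * k * ((wnormSq h N n A + wnormSq h N n B) + (wnormSq h N n a + wnormSq h N n b) +
        (lowNorms h (N - n) n a + lowNorms h (N - n) n b) + 1) ≤
        CE * k * (S' + S + 2 * CL * S + 1) := by gcongr
    have i2 : CM * k * (lowNorms h (N - n) n A + lowNorms h (N - n) n B +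
        (lowNorms h (N - n) n a + lowNorms h (N - n) n b) + 1) ≤
        CM * k * (2 * CL * S' + 2 * CL * S + 1) := by gcongr
    have i3 : CE * (S' + S + 2 * CL * S + 1) + CM * (2 * CL * S' + 2 * CL * S + 1) ≤
        (2 * CL * Cs + (CE * (1 + 2 * CL) + CM * (2 * CL + 1))) * (S + S' + 1) := by
      have k1 : 0 ≤ CE * CL * (1 + S') := by positivity
      have k2 : 0 ≤ CM * (S + S') := by positivity
      have k3 : 0 ≤ CM * CL := by positivity
      have k4 : 0 ≤ CL * Cs * (S + S' + 1) := by positivity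
      linarith
    have i4 := mul_le_mul_of_nonneg_left i3 hk.le
    linarith

/-- Discrete Gronwall inequality whose one-step bound is only available below the bound
to be proved. -/
lemma le_exp_mul_of_bootstrap {S : ℕ → ℝ} {C k T : ℝ} (hC : 0 ≤ C) (hk : 0 < k)
    (hCk : C * k ≤ 1 / 2) (hS : ∀ j : ℕ, (j : ℝ) * k ≤ T → 0 ≤ S j)
    (hstep : ∀ j : ℕ, ((j : ℝ) + 1) * k ≤ T → S j + 1 ≤ Real.exp (4 * C * T) * (S 0 + 1) →
      S (j + 1) ≤ S j + C * k * (S j + S (j + 1) + 1)) (j : ℕ) (hj : (j : ℝ) * k ≤ T) :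
    S j + 1 ≤ Real.exp (4 * C * T) * (S 0 + 1) := by
  have hS0 : 0 ≤ S 0 := hS 0 (by
    have : 0 ≤ (j : ℝ) * k := by positivity
    simpa using this.trans hj)
  have mono : ∀ i : ℕ, (i : ℝ) * k ≤ T →
      Real.exp (4 * C * (i * k)) * (S 0 + 1) ≤ Real.exp (4 * C * T) * (S 0 + 1) := fun i hi => by
    gcongr
  suffices H : S j + 1 ≤ Real.exp (4 * C * (j * k)) * (S 0 + 1) from H.trans (mono j hj)
  induction j with
  | zero => simp
  | succ j ih =>
    push_cast at hj
    have hj' : (j : ℝ) * k ≤ T := by linarith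
    have h1 := ih hj'
    have h2 := hstep j hj (h1.trans (mono j hj'))
    have hx : 0 ≤ C * k := by positivity
    have h3 : (1 - C * k) * (S (j + 1) + 1) ≤ (1 - C * k) * ((1 + 4 * (C * k)) * (S j + 1)) := by
      have : 0 ≤ 2 * (C * k) * (1 / 2 - C * k) * (S j + 1) :=
        mul_nonneg (mul_nonneg (by positivity) (by linarith)) (by linarith [hS j hj'])
      have := mul_nonneg hx (hS j hj')
      linarith
    have h4 := le_of_mul_le_mul_left h3 (by linarith)
    have h5 := Real.add_one_le_exp (4 * (C * k))
    push_cast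
    rw [show 4 * C * (((j : ℝ) + 1) * k) = 4 * (C * k) + 4 * C * (j * k) by ring, Real.exp_add,
      mul_assoc]
    exact h4.trans (mul_le_mul (by linarith) h1 (by linarith [hS j hj']) (Real.exp_pos _).le)

lemma IsMeshSymbol.mono {h : ℝ} {n : ℕ} {c c' : ℝ} {φ : ℤ → ℝ} (hφ : IsMeshSymbol h n c φ)
    (hc : c ≤ c') : IsMeshSymbol h n c' φ := fun i hi m =>
  (hφ i hi m).trans (mul_le_mul_of_nonneg_right hc (jsq_zpow_pos _ _).le)

lemma exists_isMeshSymbol {f : ℝ → ℝ → ℝ} {I : Set ℝ}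
    (hf : ∀ t, ∀ i : ℕ, ContDiff ℝ i fun y => f y t)
    (hdec : ∀ i : ℕ, ∃ C > (0 : ℝ), ∀ x : ℝ, ∀ t ∈ I,
      |iteratedDeriv i (fun y => f y t) x| ≤ C * jb x ^ (-(i : ℝ))) (n : ℕ) :
    ∃ c ≥ 0, ∀ h ∈ Set.Ioo (0 : ℝ) 1, ∀ t ∈ I,
      IsMeshSymbol h n c fun m : ℤ => f ((m : ℝ) * h) t := by
  choose C hC hb using hdec
  have hpos : ∀ i : ℕ, 0 ≤ C i ^ 2 * (2 + 2 * (i : ℝ) ^ 2) ^ (-(i : ℤ)).natAbs := fun i => by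
    positivity
  refine ⟨∑ i ∈ Finset.range (n + 1), C i ^ 2 * (2 + 2 * (i : ℝ) ^ 2) ^ (-(i : ℤ)).natAbs,
    Finset.sum_nonneg fun i _ => hpos i, fun h hh t ht i hi m => ?_⟩
  refine (sq_iterate_Dp_mesh_le hh i (hf t) (sq_nonneg (C i))
    (fun x => sq_le_of_abs_le_jb_rpow (hb i x t ht)) m).trans ?_
  refine mul_le_mul_of_nonneg_right ?_ (jsq_zpow_pos _ _).le
  exact Finset.single_le_sum (f := fun i : ℕ => C i ^ 2 * (2 + 2 * (i : ℝ) ^ 2) ^ (-(i : ℤ)).natAbs)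
    (fun i _ => hpos i) (Finset.mem_range.2 (by omega))

lemma exists_rapidDecay_bounds {g : ℝ → ℝ → ℝ} {I : Set ℝ}
    (hg : ∀ t, ∀ i : ℕ, ContDiff ℝ i fun y => g y t)
    (hdec : ∀ N i : ℕ, ∃ C > (0 : ℝ), ∀ x : ℝ, ∀ t ∈ I,
      |iteratedDeriv i (fun y => g y t) x| ≤ C * jb x ^ (-(N : ℝ))) (N n : ℕ) :
    ∃ c ≥ 0, ∀ h ∈ Set.Ioo (0 : ℝ) 1, ∀ t ∈ I,
      RapidDecay (fun m : ℤ => g ((m : ℝ) * h) t) ∧ (∀ m : ℤ, g ((m : ℝ) * h) t ^ 2 ≤ c) ∧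
      wsum h N ((Dp h)^[n] fun m : ℤ => g ((m : ℝ) * h) t) ≤ c := by
  obtain ⟨C, hC, hb⟩ := hdec (N + 1) n
  obtain ⟨C', hC', hb'⟩ := hdec 0 0
  refine ⟨C ^ 2 * (2 + 2 * (n : ℝ) ^ 2) ^ (-((N : ℤ) + 1)).natAbs * 16 + C' ^ 2, by positivity,
    fun h hh t ht => ⟨rapidDecay_mesh (F := fun x => g x t) hh.1 fun N' => ?_, fun m => ?_, ?_⟩⟩
  · obtain ⟨C, hC, hb⟩ := hdec N' 0
    exact ⟨C, fun x => by simpa using hb x t ht⟩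
  · have h1 := sq_le_of_abs_le_jb_rpow (hb' ((m : ℝ) * h) t ht)
    have : 0 ≤ C ^ 2 * (2 + 2 * (n : ℝ) ^ 2) ^ (-((N : ℤ) + 1)).natAbs * 16 := by positivity
    simp only [iteratedDeriv_zero, Nat.cast_zero, neg_zero, zpow_zero, mul_one] at h1
    linarith
  · have := wsum_iterate_Dp_mesh_le hh N n (hg t) (sq_nonneg C)
      (fun x => by simpa using sq_le_of_abs_le_jb_rpow (hb x t ht))
    linarith [sq_nonneg C']

lemma exists_time_lipschitz {f : ℝ → ℝ → ℝ} (hf : ContDiff ℝ 1 (Function.uncurry f)) (R T : ℝ) :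
    ∃ c ≥ 0, ∀ x, |x| ≤ R → ∀ t ∈ Set.Icc 0 T, ∀ t' ∈ Set.Icc 0 T,
      (f x t' - f x t) ^ 2 ≤ c * (t' - t) ^ 2 := by
  obtain ⟨L, hL⟩ := (hf.locallyLipschitz.locallyLipschitzOn
    (s := Set.Icc (-R) R ×ˢ Set.Icc 0 T)).exists_lipschitzOnWith_of_compact
    (isCompact_Icc.prod isCompact_Icc)
  refine ⟨(L : ℝ) ^ 2, by positivity, fun x hx t ht t' ht' => ?_⟩
  have h1 := hL.dist_le_mul (x, t') ⟨abs_le.1 hx, ht'⟩ (x, t) ⟨abs_le.1 hx, ht⟩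
  rw [Real.dist_eq, Prod.dist_eq, dist_self, max_eq_right dist_nonneg, Real.dist_eq] at h1
  have h2 := pow_le_pow_left₀ (abs_nonneg _) h1 2
  rwa [mul_pow, sq_abs, sq_abs] at h2

lemma exists_schwartz_bounds (w : SchwartzMap ℝ ℝ) (N n : ℕ) :
    ∃ c ≥ 0, ∀ h ∈ Set.Ioo (0 : ℝ) 1, RapidDecay (fun m : ℤ => w ((m : ℝ) * h)) ∧
      wsum h N ((Dp h)^[n] fun m : ℤ => w ((m : ℝ) * h)) ≤ c := by
  obtain ⟨c, hc, hb⟩ := exists_rapidDecay_bounds (g := fun x _ => w x) (I := {0})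
    (fun _ i => w.smooth i) (fun N' i => by
      obtain ⟨C, hC, hb⟩ := exists_schwartz_abs_le w i N'
      refine ⟨C + 1, by positivity, fun x _ _ => (hb x).trans ?_⟩
      exact mul_le_mul_of_nonneg_right (by linarith) (Real.rpow_nonneg (jb_pos x).le _)) N n
  exact ⟨c, hc, fun h hh => ⟨(hb h hh 0 rfl).1, (hb h hh 0 rfl).2.2⟩⟩

lemma lmass_le {h r : ℝ} (hh : 0 ≤ h) (hr : 0 ≤ r) {v : ℤ → ℝ} (hv : RapidDecay v) :
    lmass h r v ≤ (r + 1) * wsum h 0 v := by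
  refine hasSum_le (fun m => ?_) (hv.hasSum_lmass hr h) ((hv.hasSum_wsum h 0).mul_left (r + 1))
  have := mul_le_mul_of_nonneg_right (tent_le hr ((m : ℝ) * h))
    (mul_nonneg (sq_nonneg (v m)) hh)
  rw [zpow_zero]
  linarith

lemma IsSolOn.rapidDecay {μ h k T : ℝ} (hh : 0 < h) (hk : 0 < k) {f1 f2 g1 g2 : ℝ → ℝ → ℝ}
    {w1 w2 : ℝ → ℝ} {u1 u2 : ℕ → ℤ → ℝ} (hu : IsSolOn μ h k T f1 f2 g1 g2 w1 w2 u1 u2)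
    (hf : ∀ t ∈ Set.Icc 0 T, PolyGrowth (fun m : ℤ => f1 ((m : ℝ) * h) t) ∧
      PolyGrowth (fun m : ℤ => f2 ((m : ℝ) * h) t))
    (hg : ∀ t ∈ Set.Icc 0 T, RapidDecay (fun m : ℤ => g1 ((m : ℝ) * h) t) ∧
      RapidDecay (fun m : ℤ => g2 ((m : ℝ) * h) t))
    (hw1 : RapidDecay fun m : ℤ => w1 ((m : ℝ) * h))
    (hw2 : RapidDecay fun m : ℤ => w2 ((m : ℝ) * h)) (j : ℕ) (hj : (j : ℝ) * k ≤ T) :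
    RapidDecay (u1 j) ∧ RapidDecay (u2 j) := by
  induction j with
  | zero =>
    rw [show u1 0 = _ from funext fun m => (hu.1 m).1,
      show u2 0 = _ from funext fun m => (hu.1 m).2]
    exact ⟨hw1, hw2⟩
  | succ j ih =>
    obtain ⟨i1, i2⟩ := hu.2.2 (j + 1) hj
    obtain ⟨K1, hK1⟩ := i1.exists_abs_le hh
    obtain ⟨K2, hK2⟩ := i2.exists_abs_le hh
    push_cast at hj
    have hj' : (j : ℝ) * k ≤ T := by linarith
    have ht : (j : ℝ) * k ∈ Set.Icc 0 T := ⟨by positivity, hj'⟩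
    exact SchemeStep.rapidDecay hh hk (hu.2.1 j hj) (hf _ ht).1 (hf _ ht).2 (hg _ ht).1 (hg _ ht).2
      (ih hj').1 (ih hj').2 (K := max K1 K2) (fun m => (hK1 m).trans (le_max_left _ _))
      (fun m => (hK2 m).trans (le_max_right _ _))

/-- if the coercivity estimate for `(⟨x⟩^{2N} D₊^n (Q_j u_{j+1}), D₊^n u_{j+1})`
holds uniformly, then the weighted discrete norms `‖⟨x⟩^N D₊^n u_j‖_{L²_h}` of the discrete
solutions are uniformly bounded for `k` small enough. -/
theorem statement11 (μ : ℝ) (hμ : μ = 1 ∨ μ = -1)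
    (f1 f2 : ℝ → ℝ → ℝ)
    (hf1s : ∀ n : ℕ, ContDiff ℝ n (Function.uncurry f1))
    (hf2s : ∀ n : ℕ, ContDiff ℝ n (Function.uncurry f2))
    (hfdec : ∀ b > (0 : ℝ), ∀ n : ℕ, ∃ C > (0 : ℝ), ∀ x : ℝ, ∀ t ∈ Set.Icc (0 : ℝ) b,
      |iteratedDeriv n (fun y => f1 y t) x| ≤ C * jb x ^ (-(n : ℝ)) ∧
      |iteratedDeriv n (fun y => f2 y t) x| ≤ C * jb x ^ (-(n : ℝ)))
    (g1 g2 : ℝ → ℝ → ℝ)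
    (hg1s : ∀ n : ℕ, ContDiff ℝ n (Function.uncurry g1))
    (hg2s : ∀ n : ℕ, ContDiff ℝ n (Function.uncurry g2))
    (hgdec : ∀ b > (0 : ℝ), ∀ N' i' j' : ℕ, ∃ C > (0 : ℝ), ∀ x : ℝ, ∀ t ∈ Set.Icc (0 : ℝ) b,
      |iteratedDeriv i' (fun s => iteratedDeriv j' (fun y => g1 y s) x) t| ≤ C * jb x ^ (-(N' : ℝ)) ∧
      |iteratedDeriv i' (fun s => iteratedDeriv j' (fun y => g2 y s) x) t| ≤ C * jb x ^ (-(N' : ℝ)))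
    (w1 w2 : SchwartzMap ℝ ℝ) (K : ℝ) (hK : 0 < K)
    (hKnorm : ∀ h ∈ Set.Ioo (0 : ℝ) 1,
      Real.sqrt (shnormSq h (fun m : ℤ => w1 ((m : ℝ) * h)) (fun m : ℤ => w2 ((m : ℝ) * h))) ≤ K)
    (T ε : ℝ) (hT : 0 < T) (hε : 0 < ε)
    (hexist : ∀ h ∈ Set.Ioo (0 : ℝ) 1, ∀ k : ℝ, 0 < k → k < ε →
      ∃ u1 u2 : ℕ → ℤ → ℝ, IsSolOn μ h k T f1 f2 g1 g2 (⇑w1) (⇑w2) u1 u2)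
    (N n : ℕ) (C₀ : ℝ) (hC₀pos : 0 < C₀)
    (hC₀ : ∀ h ∈ Set.Ioo (0 : ℝ) 1, ∀ k : ℝ, 0 < k → k < ε →
      ∀ u1 u2 : ℕ → ℤ → ℝ, IsSolOn μ h k T f1 f2 g1 g2 (⇑w1) (⇑w2) u1 u2 →
      ∀ j : ℕ, ((j : ℝ) + 1) * k ≤ T →
        dip h (fun m => jb ((m : ℝ) * h) ^ (2 * N) *
            (Dp h)^[n] (Q1 μ h (u1 j) (u2 j)
              (fun m' => f1 ((m' : ℝ) * h) ((j : ℝ) * k))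
              (fun m' => f2 ((m' : ℝ) * h) ((j : ℝ) * k)) (u1 (j + 1)) (u2 (j + 1))) m)
          ((Dp h)^[n] (u1 (j + 1)))
        + dip h (fun m => jb ((m : ℝ) * h) ^ (2 * N) *
            (Dp h)^[n] (Q2 μ h (u1 j) (u2 j)
              (fun m' => f1 ((m' : ℝ) * h) ((j : ℝ) * k))
              (fun m' => f2 ((m' : ℝ) * h) ((j : ℝ) * k)) (u1 (j + 1)) (u2 (j + 1))) m)
          ((Dp h)^[n] (u2 (j + 1)))
        ≥ -C₀ * ((wnormSq h N n (u1 (j + 1)) + wnormSq h N n (u2 (j + 1)))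
            + (wnormSq h N n (u1 j) + wnormSq h N n (u2 j)) + 1)) :
    ∃ k₀ : ℝ, 0 < k₀ ∧ k₀ ≤ ε ∧ ∃ C > (0 : ℝ),
      ∀ h ∈ Set.Ioo (0 : ℝ) 1, ∀ k : ℝ, 0 < k → k < k₀ →
      ∀ u1 u2 : ℕ → ℤ → ℝ, IsSolOn μ h k T f1 f2 g1 g2 (⇑w1) (⇑w2) u1 u2 →
      ∀ j : ℕ, (j : ℝ) * k ≤ T →
        Real.sqrt (wnormSq h N n (u1 j) + wnormSq h N n (u2 j)) < C := by
  have hμ2 : μ ^ 2 = 1 := by rcases hμ with rfl | rfl <;> norm_num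
  have hsec : ∀ {f : ℝ → ℝ → ℝ}, (∀ n : ℕ, ContDiff ℝ n (Function.uncurry f)) →
      ∀ t, ∀ i : ℕ, ContDiff ℝ i fun y => f y t := fun hf t i =>
    (hf i).comp (contDiff_id.prodMk contDiff_const)
  obtain ⟨cf1, hcf1, sf1⟩ := exists_isMeshSymbol (I := Set.Icc 0 T) (hsec hf1s) (fun i => by
    obtain ⟨C, hC, hb⟩ := hfdec T hT i
    exact ⟨C, hC, fun x t ht => (hb x t ht).1⟩) n
  obtain ⟨cf2, hcf2, sf2⟩ := exists_isMeshSymbol (I := Set.Icc 0 T) (hsec hf2s) (fun i => by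
    obtain ⟨C, hC, hb⟩ := hfdec T hT i
    exact ⟨C, hC, fun x t ht => (hb x t ht).2⟩) n
  obtain ⟨cg1, hcg1, sg1⟩ := exists_rapidDecay_bounds (I := Set.Icc 0 T) (hsec hg1s)
    (fun N' i => by
      obtain ⟨C, hC, hb⟩ := hgdec T hT N' 0 i
      exact ⟨C, hC, fun x t ht => by simpa only [iteratedDeriv_zero] using (hb x t ht).1⟩) N n
  obtain ⟨cg2, hcg2, sg2⟩ := exists_rapidDecay_bounds (I := Set.Icc 0 T) (hsec hg2s)
    (fun N' i => by
      obtain ⟨C, hC, hb⟩ := hgdec T hT N' 0 i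
      exact ⟨C, hC, fun x t ht => by simpa only [iteratedDeriv_zero] using (hb x t ht).2⟩) N n
  obtain ⟨cw1, hcw1, sw1⟩ := exists_schwartz_bounds w1 N n
  obtain ⟨cw2, hcw2, sw2⟩ := exists_schwartz_bounds w2 N n
  have hdec : ∀ h ∈ Set.Ioo (0 : ℝ) 1, ∀ k > 0, ∀ u1 u2 : ℕ → ℤ → ℝ,
      IsSolOn μ h k T f1 f2 g1 g2 (⇑w1) (⇑w2) u1 u2 → ∀ j : ℕ, (j : ℝ) * k ≤ T →
      RapidDecay (u1 j) ∧ RapidDecay (u2 j) := fun h hh k hk u1 u2 hu =>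
    hu.rapidDecay hh.1 hk
      (fun t ht => ⟨(sf1 h hh t ht).polyGrowth, (sf2 h hh t ht).polyGrowth⟩)
      (fun t ht => ⟨(sg1 h hh t ht).1, (sg2 h hh t ht).1⟩) (sw1 h hh).1 (sw2 h hh).1
  have hinit : ∀ h ∈ Set.Ioo (0 : ℝ) 1, ∀ k, ∀ u1 u2 : ℕ → ℤ → ℝ,
      IsSolOn μ h k T f1 f2 g1 g2 (⇑w1) (⇑w2) u1 u2 →
      u1 0 = (fun m : ℤ => w1 ((m : ℝ) * h)) ∧ u2 0 = fun m : ℤ => w2 ((m : ℝ) * h) :=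
    fun h hh k u1 u2 hu => ⟨funext fun m => (hu.1 m).1, funext fun m => (hu.1 m).2⟩
  have hE0 : ∀ h ∈ Set.Ioo (0 : ℝ) 1, ∀ k, ∀ u1 u2 : ℕ → ℤ → ℝ,
      IsSolOn μ h k T f1 f2 g1 g2 (⇑w1) (⇑w2) u1 u2 →
      wnormSq h N n (u1 0) + wnormSq h N n (u2 0) ≤ cw1 + cw2 := fun h hh k u1 u2 hu => by
    obtain ⟨e1, e2⟩ := hinit h hh k u1 u2 hu
    rw [e1, e2, wnormSq_eq_wsum, wnormSq_eq_wsum]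
    exact add_le_add (sw1 h hh).2 (sw2 h hh).2
  have hn0 : ∀ h ∈ Set.Ioo (0 : ℝ) 1, ∀ v, 0 ≤ wnormSq h N n v := fun h hh v => by
    rw [wnormSq_eq_wsum]; exact wsum_nonneg hh.1.le _ _
  have hmem : ∀ {k : ℝ}, 0 < k → ∀ j : ℕ, (j : ℝ) * k ≤ T → (j : ℝ) * k ∈ Set.Icc 0 T :=
    fun hk j hj => ⟨mul_nonneg j.cast_nonneg hk.le, hj⟩
  have hdata : ∀ c, cf1 + cf2 + cg1 + cg2 ≤ c → ∀ h ∈ Set.Ioo (0 : ℝ) 1, ∀ t ∈ Set.Icc 0 T,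
      IsMeshSymbol h n c (fun m : ℤ => f1 ((m : ℝ) * h) t) ∧
      IsMeshSymbol h n c (fun m : ℤ => f2 ((m : ℝ) * h) t) ∧
      RapidDecay (fun m : ℤ => g1 ((m : ℝ) * h) t) ∧
      RapidDecay (fun m : ℤ => g2 ((m : ℝ) * h) t) ∧
      (∀ m : ℤ, g1 ((m : ℝ) * h) t ^ 2 ≤ c) ∧ (∀ m : ℤ, g2 ((m : ℝ) * h) t ^ 2 ≤ c) ∧
      wsum h N ((Dp h)^[n] fun m : ℤ => g1 ((m : ℝ) * h) t) ≤ c ∧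
      wsum h N ((Dp h)^[n] fun m : ℤ => g2 ((m : ℝ) * h) t) ≤ c := fun c hc h hh t ht => by
    obtain ⟨a1, a2, a3⟩ := sg1 h hh t ht
    obtain ⟨b1, b2, b3⟩ := sg2 h hh t ht
    exact ⟨(sf1 h hh t ht).mono (by linarith), (sf2 h hh t ht).mono (by linarith), a1, b1,
      fun m => (a2 m).trans (by linarith), fun m => (b2 m).trans (by linarith),
      a3.trans (by linarith), b3.trans (by linarith)⟩
  obtain ⟨κ, hκ, C, hC, B, hB, hS⟩ : ∃ κ > 0, ∃ C ≥ 0, ∃ B ≥ 0,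
      ∀ h ∈ Set.Ioo (0 : ℝ) 1, ∀ k > 0,
      k < ε → k ≤ κ → ∀ u1 u2 : ℕ → ℤ → ℝ, IsSolOn μ h k T f1 f2 g1 g2 (⇑w1) (⇑w2) u1 u2 →
      ∃ S : ℕ → ℝ, S 0 ≤ B ∧
      (∀ j : ℕ, (j : ℝ) * k ≤ T → wnormSq h N n (u1 j) + wnormSq h N n (u2 j) ≤ S j) ∧
      ∀ j : ℕ, ((j : ℝ) + 1) * k ≤ T → S j + 1 ≤ Real.exp (4 * C * T) * (B + 1) →
        S (j + 1) ≤ S j + C * k * (S j + S (j + 1) + 1) := by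
    rcases n.eq_zero_or_pos with rfl | hn
    · obtain ⟨CE, hCE, hE⟩ := exists_energy_step_le μ N 0 (cf1 + cf2 + cg1 + cg2) hC₀pos.le
      refine ⟨1, one_pos, 2 * CE, by positivity, cw1 + cw2, by positivity,
        fun h hh k hk hkε _ u1 u2 hu => ⟨fun j => wnormSq h N 0 (u1 j) + wnormSq h N 0 (u2 j),
        hE0 h hh k u1 u2 hu, fun j _ => le_rfl, fun j hj _ => ?_⟩⟩
      have hj' : (j : ℝ) * k ≤ T := by linarith
      obtain ⟨a1, a2, a3, a4, -, -, a5, a6⟩ := hdata _ le_rfl h hh _ (hmem hk j hj')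
      obtain ⟨r1, r2⟩ := hdec h hh k hk u1 u2 hu j hj'
      obtain ⟨r3, r4⟩ := hdec h hh k hk u1 u2 hu (j + 1) (by push_cast; exact hj)
      have e := hE h hh k hk _ _ _ _ _ _ _ _ a1 a2 a3 a4 a5 a6 r1 r2 r3 r4 (hu.2.1 j hj)
        (hC₀ h hh k hk hkε u1 u2 hu j hj)
      have low : ∀ v, lowNorms h ((N : ℤ) - (0 : ℕ)) 0 v = wnormSq h N 0 v := fun v => by
        simp [lowNorms, wnormSq_eq_wsum]
      rw [low, low] at e
      refine e.trans ?_
      have x1 := hn0 h hh (u1 (j + 1))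
      have x2 := hn0 h hh (u2 (j + 1))
      have x3 : 0 ≤ CE * k * (wnormSq h N 0 (u1 (j + 1)) + wnormSq h N 0 (u2 (j + 1)) + 1) := by
        positivity
      linarith
    · obtain ⟨r, hr, hF⟩ := exists_energyFun_step_le hμ2 N hn
      obtain ⟨cl1, hcl1, sl1⟩ := exists_time_lipschitz (hf1s 1) (r + 1) T
      obtain ⟨cl2, hcl2, sl2⟩ := exists_time_lipschitz (hf2s 1) (r + 1) T
      set c := cf1 + cf2 + cg1 + cg2 + cl1 + cl2 with hc
      obtain ⟨C', hC', C, hC, hbd, hstep⟩ := hF c (by positivity) C₀ hC₀pos.le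
      obtain ⟨cm1, hcm1, sm1⟩ := exists_schwartz_bounds w1 0 0
      obtain ⟨cm2, hcm2, sm2⟩ := exists_schwartz_bounds w2 0 0
      set B := cw1 + cw2 + 2 * ((r + 1) * cm1 + (r + 1) * cm2) + 2 * C' with hB
      have hB0 : 0 ≤ B := by positivity
      obtain ⟨κ, hκ, hstep⟩ := hstep (C * (Real.exp (4 * C * T) * (B + 1))) (by positivity)
      have hcc : cf1 + cf2 + cg1 + cg2 ≤ c := by linarith
      refine ⟨κ, hκ, C, hC, B, hB0, fun h hh k hk hkε hkκ u1 u2 hu =>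
        ⟨fun j => energyFun h N n r C' (u1 j) (u2 j) (fun m : ℤ => f1 ((m : ℝ) * h) ((j : ℝ) * k))
          (fun m : ℤ => f2 ((m : ℝ) * h) ((j : ℝ) * k)), ?_, fun j hj => ?_, fun j hj hSj => ?_⟩⟩
      · have h0 : ((0 : ℕ) : ℝ) * k ≤ T := by simpa using hT.le
        obtain ⟨a1, a2, -⟩ := hdata c hcc h hh _ (hmem hk 0 h0)
        obtain ⟨r1, r2⟩ := hdec h hh k hk u1 u2 hu 0 h0
        refine (hbd h hh _ _ _ _ r1 r2 a1 a2).2.1.trans ?_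
        have x0 := hE0 h hh k u1 u2 hu
        have x1 := lmass_le hh.1.le hr r1
        have x2 := lmass_le hh.1.le hr r2
        obtain ⟨e1, e2⟩ := hinit h hh k u1 u2 hu
        have x3 : (r + 1) * wsum h 0 (u1 0) ≤ (r + 1) * cm1 := by
          rw [e1]
          exact mul_le_mul_of_nonneg_left (sm1 h hh).2 (by positivity)
        have x4 : (r + 1) * wsum h 0 (u2 0) ≤ (r + 1) * cm2 := by
          rw [e2]
          exact mul_le_mul_of_nonneg_left (sm2 h hh).2 (by positivity)
        linarith
      · obtain ⟨a1, a2, -⟩ := hdata c hcc h hh _ (hmem hk j hj)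
        obtain ⟨r1, r2⟩ := hdec h hh k hk u1 u2 hu j hj
        exact (hbd h hh _ _ _ _ r1 r2 a1 a2).1
      · have hj' : (j : ℝ) * k ≤ T := by linarith
        have hjs : ((j + 1 : ℕ) : ℝ) * k ≤ T := by push_cast; exact hj
        obtain ⟨a1, a2, a3, a4, a5, a6, a7, a8⟩ := hdata c hcc h hh _ (hmem hk j hj')
        obtain ⟨b1, b2, -⟩ := hdata c hcc h hh _ (hmem hk (j + 1) hjs)
        obtain ⟨r1, r2⟩ := hdec h hh k hk u1 u2 hu j hj'
        obtain ⟨r3, r4⟩ := hdec h hh k hk u1 u2 hu (j + 1) hjs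
        refine hstep h hh k hk hkκ _ _ _ _ _ _ _ _ _ _ a1 a2 b1 b2 a3 a4 a5 a6 a7 a8 r1 r2 r3 r4
          (fun m hm => ⟨?_, ?_, ?_⟩) (hu.2.1 j hj) (hC₀ h hh k hk hkε u1 u2 hu j hj)
        · refine (sl1 _ hm _ (hmem hk j hj') _ (hmem hk (j + 1) hjs)).trans ?_
          rw [show ((j + 1 : ℕ) : ℝ) * k - j * k = k by push_cast; ring]
          gcongr
          linarith
        · refine (sl2 _ hm _ (hmem hk j hj') _ (hmem hk (j + 1) hjs)).trans ?_
          rw [show ((j + 1 : ℕ) : ℝ) * k - j * k = k by push_cast; ring]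
          gcongr
          linarith
        · refine ((hbd h hh _ _ _ _ r1 r2 a1 a2).2.2 m hm).trans ?_
          gcongr
          linarith
  refine ⟨min ε (min κ (1 / (2 * C + 1))), by positivity, min_le_left _ _,
    Real.sqrt (Real.exp (4 * C * T) * (B + 1)), by positivity,
    fun h hh k hk hkk u1 u2 hu j hj => ?_⟩
  obtain ⟨k1, k2⟩ := lt_min_iff.1 hkk
  obtain ⟨k2, k3⟩ := lt_min_iff.1 k2
  rw [lt_div_iff₀ (by positivity)] at k3
  obtain ⟨S, hS0, hSE, hstep⟩ := hS h hh k hk k1 k2.le u1 u2 hu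
  have hexp : Real.exp (4 * C * T) * (S 0 + 1) ≤ Real.exp (4 * C * T) * (B + 1) := by gcongr
  have hfin := le_exp_mul_of_bootstrap hC hk (by linarith)
    (fun j hj => (add_nonneg (hn0 h hh _) (hn0 h hh _)).trans (hSE j hj))
    (fun j hj hb => hstep j hj (hb.trans hexp)) j hj
  exact Real.sqrt_lt_sqrt (add_nonneg (hn0 h hh _) (hn0 h hh _)) (by linarith [hSE j hj])
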